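/- arXiv:1811.11417 — 3 statements merged into one kernel-verified Lean document; each statement's English description precedes it below -/
import Mathlib

section
/- Let (f, M) be a matroid winner-selection environment with n candidates and a total of m types, and let x be an interim rule that is feasible within (f, M). Then there exist winner-selecting dice (one die per type), each die supported on at most m+1 real values, whose induced dice-based winner-selection rule implements x. -/
/-!
Statement 0: For every matroid winner-selection environment `(f, M)` with a total of
`m` types and every interim rule `x` that is feasible within it, there exist
winner-selecting dice (one die per type), each supported on at most `m + 1` real values,
whose induced dice-based winner-selection rule implements `x` in `(f, M)`.
Here `m = Fintype.card T` is the total number of types of all candidates.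

Formalization conventions:
* Candidates are `Fin n`; all types (of all candidates) form the finite type `T`, and
  `cand t` is the candidate owning type `t` (type sets of distinct candidates are disjoint
  by construction).
* `f : T → ℝ` is the prior: for each candidate, the probabilities of its types sum to `1`.
* A type profile is `p : Fin n → T` with `cand (p i) = i` for all `i`; its prior weight is
  `∏ j, f (p j)` (types drawn independently).
* A randomized winner-selection rule is `A : (Fin n → T) → Finset (Fin n) → ℝ` giving, for
  each profile, a distribution over winner sets; it must be supported on independent sets
  of the matroid `M`.
* The dice-based rule: every candidate rolls its realized type's die independently, and
  winners are selected greedily in decreasing order of score (ties broken uniformly at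
  random, realized here by averaging over a uniformly random permutation used as a
  tie-breaker), adding a candidate while its score is positive and the set stays
  independent in `M`.  By the standard greedy characterization, candidate `i` wins iff its
  score is positive and `i` is not spanned by the higher-ranked positive-score candidates.
-/

open MeasureTheory Finset

namespace Stmt0

variable {n : ℕ} {T : Type} [Fintype T] [DecidableEq T]

/-- Greedy winning predicate with permutation tie-breaking: `i` is selected iff it is in
the ground set, has positive score, and is not spanned by the positive-score candidates
preceding it in the order "higher score first, ties broken by `π`". -/
def Wins (M : Matroid (Fin n)) (s : Fin n → ℝ) (π : Equiv.Perm (Fin n)) (i : Fin n) : Prop :=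
  i ∈ M.E ∧ 0 < s i ∧
    i ∉ M.closure {j | 0 < s j ∧ (s i < s j ∨ (s i = s j ∧ π i < π j))}

/-- Probability that candidate `i` wins, when candidate `j` rolls the die `d j`
(all rolls independent) and ties are broken uniformly at random. -/
noncomputable def winProb (M : Matroid (Fin n)) (d : Fin n → Measure ℝ) (i : Fin n) : ℝ :=
  (∑ π : Equiv.Perm (Fin n), ((Measure.pi d) {s | Wins M s π i}).toReal) / (Nat.factorial n)

/-- Valid type profiles. -/
def profiles (cand : T → Fin n) : Finset (Fin n → T) :=
  Finset.univ.filter fun p => ∀ i, cand (p i) = i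

/-- Conditional probability that type `t` wins under the dice-based rule, given that the
candidate `cand t` has realized type `t`. -/
noncomputable def diceInterim (cand : T → Fin n) (f : T → ℝ) (M : Matroid (Fin n))
    (D : T → Measure ℝ) (t : T) : ℝ :=
  ∑ p ∈ (profiles cand).filter (fun p => p (cand t) = t),
    (∏ j ∈ Finset.univ.erase (cand t), f (p j)) * winProb M (fun j => D (p j)) (cand t)

/-- `A` is a winner-selection rule with feasible sets `Feas` implementing the interim
rule `x` for the prior `f`. -/
def ImplementsRule (cand : T → Fin n) (f : T → ℝ) (Feas : Finset (Fin n) → Prop)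
    (A : (Fin n → T) → Finset (Fin n) → ℝ) (x : T → ℝ) : Prop :=
  (∀ p S, 0 ≤ A p S) ∧ (∀ p, ∑ S : Finset (Fin n), A p S = 1) ∧
  (∀ p S, A p S ≠ 0 → Feas S) ∧
  ∀ t : T, ∑ p ∈ (profiles cand).filter (fun p => p (cand t) = t),
      (∏ j ∈ Finset.univ.erase (cand t), f (p j)) *
        (∑ S ∈ Finset.univ.filter (fun S : Finset (Fin n) => cand t ∈ S), A p S) = x t

section KeyLemma

variable {T : Type} [DecidableEq T]

/-- state after a list of moves -/
def runM : List (T × ℝ) → (T → ℝ) → (T → ℝ)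
  | [], z => z
  | (s, a) :: L, z => runM L (Function.update z s (z s + a))

/-- gain of type `t` along a list of moves -/
def gainM (W : (T → ℝ) → T → ℝ) : List (T × ℝ) → (T → ℝ) → T → ℝ
  | [], _, _ => 0
  | (s, a) :: L, z, t =>
      (if s = t then a * W z t else 0) + gainM W L (Function.update z s (z s + a)) t

/-- number of moves of `t` -/
def cntM (L : List (T × ℝ)) (t : T) : ℕ := L.countP (fun e => decide (e.1 = t))

lemma cntM_cons (s : T) (a : ℝ) (L : List (T × ℝ)) (t : T) :
    cntM ((s, a) :: L) t = cntM L t + if s = t then 1 else 0 := by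
  simp [cntM, List.countP_cons]

lemma cntM_append (L L' : List (T × ℝ)) (t : T) :
    cntM (L ++ L') t = cntM L t + cntM L' t := by
  simp [cntM, List.countP_append]

lemma runM_append (L L' : List (T × ℝ)) (z : T → ℝ) :
    runM (L ++ L') z = runM L' (runM L z) := by
  induction L generalizing z with
  | nil => rfl
  | cons e L ih => obtain ⟨s, a⟩ := e; simp [runM, ih]

lemma gainM_append (W : (T → ℝ) → T → ℝ) (L L' : List (T × ℝ)) (z : T → ℝ) (t : T) :
    gainM W (L ++ L') z t = gainM W L z t + gainM W L' (runM L z) t := by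
  induction L generalizing z with
  | nil => simp [gainM, runM]
  | cons e L ih => obtain ⟨s, a⟩ := e; simp [gainM, runM, ih, add_assoc]

lemma cntM_notMem {L : List (T × ℝ)} {S : Finset T} (h : ∀ e ∈ L, e.1 ∈ S) {t : T} (ht : t ∉ S) :
    cntM L t = 0 := by
  simp only [cntM, List.countP_eq_zero, decide_eq_true_eq]
  rintro e he rfl; exact ht (h e he)

lemma runM_notMem {L : List (T × ℝ)} {S : Finset T} (h : ∀ e ∈ L, e.1 ∈ S) {t : T} (ht : t ∉ S)
    (z : T → ℝ) : runM L z t = z t := by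
  induction L generalizing z with
  | nil => rfl
  | cons e L ih =>
    obtain ⟨s, a⟩ := e
    have hs : s ∈ S := h (s, a) (by simp)
    rw [runM, ih (fun e he => h e (by simp [he])), Function.update_of_ne]
    rintro rfl; exact ht hs

lemma gainM_notMem (W : (T → ℝ) → T → ℝ) {L : List (T × ℝ)} {S : Finset T}
    (h : ∀ e ∈ L, e.1 ∈ S) {t : T} (ht : t ∉ S)
    (z : T → ℝ) : gainM W L z t = 0 := by
  induction L generalizing z with
  | nil => rfl
  | cons e L ih =>
    obtain ⟨s, a⟩ := e
    have hs : s ∈ S := h (s, a) (by simp)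
    have : s ≠ t := by rintro rfl; exact ht hs
    rw [gainM, ih (fun e he => h e (by simp [he])), if_neg this, add_zero]

lemma le_runM {L : List (T × ℝ)} (h : ∀ e ∈ L, 0 ≤ e.2) (t : T)
    (z : T → ℝ) : z t ≤ runM L z t := by
  induction L generalizing z with
  | nil => exact le_rfl
  | cons e L ih =>
    obtain ⟨s, a⟩ := e
    have hs : 0 ≤ a := h (s, a) (by simp)
    rw [runM]
    refine le_trans ?_ (ih (fun e he => h e (by simp [he])) _)
    by_cases hst : t = s
    · subst hst; simp [hs]
    · simp [Function.update_of_ne hst]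

lemma F_runM (F : (T → ℝ) → ℝ) (W : (T → ℝ) → T → ℝ) (f : T → ℝ)
    (hF : ∀ z t a, F (Function.update z t (z t + a)) = F z + a * f t * W z t)
    {L : List (T × ℝ)} {S : Finset T}
    (h : ∀ e ∈ L, e.1 ∈ S) (z : T → ℝ) :
    F (runM L z) = F z + ∑ t ∈ S, f t * gainM W L z t := by
  induction L generalizing z with
  | nil => simp [runM, gainM]
  | cons e L ih =>
    obtain ⟨s, a⟩ := e
    have hs : s ∈ S := h (s, a) (by simp)
    rw [runM, ih (fun e he => h e (by simp [he])), hF]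
    simp only [gainM, mul_add, Finset.sum_add_distrib, mul_ite, mul_zero, Finset.sum_ite_eq, hs,
      if_true]
    ring

lemma key (F : (T → ℝ) → ℝ) (W : (T → ℝ) → T → ℝ) (f : T → ℝ)
    (hF : ∀ z t a, F (Function.update z t (z t + a)) = F z + a * f t * W z t)
    (hsub : ∀ (z : T → ℝ), (∀ t, 0 ≤ z t) → (∀ t, z t ≤ 1) → ∀ U V : Finset T,
      F z + F ((U ∪ V).piecewise 1 z) ≤ F (U.piecewise 1 z) + F (V.piecewise 1 z)) :
    ∀ (k : ℕ) (S : Finset T), S.card = k → (∀ t ∈ S, 0 < f t) →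
      ∀ (z x : T → ℝ), (∀ t, 0 ≤ z t) → (∀ t, z t ≤ 1) → (∀ t ∈ S, 0 ≤ x t) →
      (∀ U ⊆ S, ∑ t ∈ U, f t * x t ≤ F (U.piecewise 1 z) - F z) →
      ∃ L : List (T × ℝ), (∀ e ∈ L, e.1 ∈ S) ∧ (∀ e ∈ L, 0 ≤ e.2) ∧ (∀ t, runM L z t ≤ 1) ∧
        (∀ t ∈ S, gainM W L z t = x t) ∧ ∀ t ∈ S, cntM L t ≤ k := by
  intro k
  induction k using Nat.strong_induction_on with
  | _ k ih =>
  intro S hS hfS z x hz0 hz1 hx hfeas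
  rcases S.eq_empty_or_nonempty with rfl | ⟨t, htS⟩
  · exact ⟨[], by simp, by simp, by simpa [runM] using hz1, by simp, by simp⟩
  set za : ℝ → T → ℝ := fun a => Function.update z t (z t + a) with hza
  have hFza : ∀ a, F (za a) = F z + a * f t * W z t := fun a => hF z t a
  have hpwn : ∀ U : Finset T, t ∉ U → ∀ a, F (U.piecewise 1 (za a)) =
      F (U.piecewise 1 z) + a * f t * W (U.piecewise 1 z) t := by
    intro U htU a
    rw [← hF]
    congr 1
    rw [hza]
    funext u
    by_cases hu : u = t
    · subst hu; simp [htU]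
    · by_cases huU : u ∈ U <;> simp [huU, hu]
  have hpwm : ∀ U : Finset T, t ∈ U → ∀ a, U.piecewise 1 (za a) = U.piecewise 1 z := by
    intro U htU a
    funext u
    by_cases hu : u ∈ U
    · simp [hu]
    · have : u ≠ t := by rintro rfl; exact hu htU
      simp [hu, hza, this]
  let g : Finset T → ℝ → ℝ := fun U a => if U = ∅ then f t * (x t - a * W z t) else
    (F (U.piecewise 1 z) + a * f t * W (U.piecewise 1 z) t) - (F z + a * f t * W z t)
      - ∑ u ∈ U, f u * x u
  have hne : ((S.erase t).powerset).Nonempty := ⟨∅, by simp⟩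
  let φ : ℝ → ℝ := fun a => (S.erase t).powerset.inf' hne (fun U => g U a)
  have hφc : Continuous φ := by
    apply Continuous.finset_inf'_apply
    intro U _
    by_cases hU : U = ∅ <;> simp only [g, hU, if_true, if_false] <;> fun_prop
  have hft := hfS t htS
  have h0 : 0 ≤ φ 0 := by
    apply Finset.le_inf'
    intro U hU
    rw [Finset.mem_powerset] at hU
    by_cases hU' : U = ∅
    · simp only [g, hU', if_true]; have := mul_nonneg hft.le (hx t htS); simpa using this
    · simp only [g, hU', if_false]
      have := hfeas U (hU.trans (Finset.erase_subset _ _))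
      linarith
  have h1 : φ (1 - z t) ≤ 0 := by
    refine (Finset.inf'_le _ (b := ∅) (by simp)).trans ?_
    simp only [g, if_true]
    have h2 := hfeas {t} (by simpa using htS)
    have h3 : ({t} : Finset T).piecewise 1 z = Function.update z t (z t + (1 - z t)) := by
      funext u
      by_cases hu : u = t
      · subst hu; simp
      · simp [hu]
    rw [h3, hF] at h2
    simp only [Finset.sum_singleton] at h2
    linarith
  obtain ⟨a, ⟨ha0, ha1⟩, hφa⟩ : ∃ a ∈ Set.Icc 0 (1 - z t), φ a = 0 := by
    have := intermediate_value_Icc' (f := φ) (a := 0) (b := 1 - z t)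
      (by linarith [hz1 t]) hφc.continuousOn
    obtain ⟨a, ha, h⟩ := this ⟨h1, h0⟩
    exact ⟨a, ha, h⟩
  have hga : ∀ U ⊆ S.erase t, 0 ≤ g U a := by
    intro U hU
    rw [← hφa]
    exact Finset.inf'_le _ (by simpa using hU)
  obtain ⟨U0, hU0, hU0g⟩ : ∃ U ⊆ S.erase t, g U a = 0 := by
    obtain ⟨U, hU, h⟩ := Finset.exists_mem_eq_inf' hne (fun U => g U a)
    exact ⟨U, by simpa using hU, by rw [← h]; exact hφa⟩
  -- the new state
  have hza0 : ∀ u, 0 ≤ za a u := by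
    intro u
    by_cases hu : u = t
    · subst hu; simp [hza]; linarith [hz0 u]
    · simp [hza, hu, hz0]
  have hza1 : ∀ u, za a u ≤ 1 := by
    intro u
    by_cases hu : u = t
    · subst hu; simp [hza]; linarith [hz0 u]
    · simp [hza, hu, hz1]
  have hfe : ∀ U ⊆ S.erase t, ∑ u ∈ U, f u * x u ≤ F (U.piecewise 1 (za a)) - F (za a) := by
    intro U hU
    rcases eq_or_ne U ∅ with rfl | hU'
    · simp
    have := hga U hU
    simp only [g, hU', if_false] at this
    rw [hpwn U (fun h => by simpa using hU h), hFza]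
    linarith
  have hkpos : 0 < k := by rw [← hS]; exact Finset.card_pos.2 ⟨t, htS⟩
  have hcE : (S.erase t).card = k - 1 := by rw [Finset.card_erase_of_mem htS, hS]
  rcases eq_or_ne U0 ∅ with rfl | hU0'
  · -- t is finished
    simp only [g, if_true] at hU0g
    have hxt : x t = a * W z t := by
      rcases mul_eq_zero.1 hU0g with h | h
      · linarith
      · linarith
    obtain ⟨L, hL1, hL2, hL3, hL4, hL5⟩ := ih (k - 1) (by omega) (S.erase t) hcE
      (fun u hu => hfS u (Finset.mem_of_mem_erase hu)) (za a) x hza0 hza1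
      (fun u hu => hx u (Finset.mem_of_mem_erase hu)) hfe
    refine ⟨(t, a) :: L, ?_, ?_, ?_, ?_, ?_⟩
    · intro e he
      rcases List.mem_cons.1 he with rfl | he
      · exact htS
      · exact Finset.mem_of_mem_erase (hL1 e he)
    · intro e he
      rcases List.mem_cons.1 he with rfl | he
      · exact ha0
      · exact hL2 e he
    · exact hL3
    · intro u hu
      rw [gainM]
      by_cases hut : u = t
      · subst hut
        rw [gainM_notMem W hL1 (by simp), if_pos rfl, hxt, add_zero]
      · rw [if_neg (Ne.symm hut), zero_add]
        exact hL4 u (by simp [hut, hu])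
    · intro u hu
      rw [cntM_cons]
      by_cases hut : u = t
      · subst hut
        rw [cntM_notMem hL1 (by simp)]; simp; omega
      · have := hL5 u (by simp [hut, hu])
        rw [if_neg (Ne.symm hut)]; omega
  · -- U0 is tight
    simp only [g, hU0', if_false] at hU0g
    have htU0 : t ∉ U0 := fun h => by simpa using hU0 h
    have hU0S : U0 ⊆ S := hU0.trans (Finset.erase_subset _ _)
    have htight : ∑ u ∈ U0, f u * x u = F (U0.piecewise 1 (za a)) - F (za a) := by
      rw [hpwn U0 htU0, hFza]; linarith
    have hcU : U0.card + (S \ U0).card = k := by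
      rw [← hS, add_comm, Finset.card_sdiff_add_card_eq_card hU0S]
    have hU0c : 0 < U0.card := Finset.card_pos.2 (Finset.nonempty_iff_ne_empty.2 hU0')
    have htD : t ∈ S \ U0 := by simp [htS, htU0]
    have hDc : 0 < (S \ U0).card := Finset.card_pos.2 ⟨t, htD⟩
    obtain ⟨L, hL1, hL2, hL3, hL4, hL5⟩ := ih U0.card (by omega) U0 rfl
      (fun u hu => hfS u (hU0S hu)) (za a) x hza0 hza1
      (fun u hu => hx u (hU0S hu)) (fun U hU => hfe U (hU.trans hU0))
    set z' := runM L (za a) with hz'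
    have hFz' : F z' = F (U0.piecewise 1 (za a)) := by
      rw [hz', F_runM F W f hF hL1, Finset.sum_congr rfl (fun u hu => by rw [hL4 u hu]), htight]
      ring
    have hz'0 : ∀ u, 0 ≤ z' u := fun u => (hza0 u).trans (le_runM hL2 u _)
    have hpz' : ∀ U : Finset T, U0 ⊆ U → U.piecewise 1 z' = U.piecewise 1 (za a) := by
      intro U hU
      funext u
      by_cases hu : u ∈ U
      · simp [hu]
      · simp only [hu, Finset.piecewise_eq_of_notMem, not_false_eq_true]
        exact runM_notMem hL1 (fun h => hu (hU h)) _
    let x' : T → ℝ := Function.update x t (x t - a * W z t)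
    have hxt' : 0 ≤ x t - a * W z t := by
      have := hga ∅ (by simp)
      simp only [g, if_true] at this
      exact nonneg_of_mul_nonneg_right this hft
    -- feasibility in the middle state for sets
    have hfe2 : ∀ U ⊆ S, ∑ u ∈ U, f u * x' u ≤ F (U.piecewise 1 (za a)) - F (za a) := by
      intro U hU
      by_cases htU : t ∈ U
      · rw [hpwm U htU, hFza, ← Finset.add_sum_erase _ _ htU]
        have h1 := hfeas U hU
        rw [← Finset.add_sum_erase _ _ htU] at h1
        have h2 : ∑ u ∈ U.erase t, f u * x' u = ∑ u ∈ U.erase t, f u * x u := by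
          apply Finset.sum_congr rfl
          intro u hu
          simp [x', Finset.ne_of_mem_erase hu]
        rw [h2]
        simp only [x', Function.update_self]
        linarith
      · have h2 : ∑ u ∈ U, f u * x' u = ∑ u ∈ U, f u * x u := by
          apply Finset.sum_congr rfl
          intro u hu
          have : u ≠ t := by rintro rfl; exact htU hu
          simp [x', this]
        rw [h2]
        refine hfe U (fun u hu => ?_)
        have : u ≠ t := by rintro rfl; exact htU hu
        simp [this, hU hu]
    have hfe3 : ∀ V ⊆ S \ U0, ∑ u ∈ V, f u * x' u ≤ F (V.piecewise 1 z') - F z' := by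
      intro V hV
      have h1 := hfe2 (V ∪ U0) (Finset.union_subset (hV.trans Finset.sdiff_subset) hU0S)
      have hdisj : Disjoint V U0 := Finset.disjoint_of_subset_left hV Finset.sdiff_disjoint
      rw [Finset.sum_union hdisj] at h1
      have h2 : ∑ u ∈ U0, f u * x' u = ∑ u ∈ U0, f u * x u := by
        apply Finset.sum_congr rfl
        intro u hu
        have : u ≠ t := by rintro rfl; exact htU0 hu
        simp [x', this]
      rw [h2, htight] at h1
      have h3 := hsub z' hz'0 hL3 V U0
      rw [hpz' _ Finset.subset_union_right, hpz' _ subset_rfl] at h3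
      linarith
    obtain ⟨L', hL1', hL2', hL3', hL4', hL5'⟩ := ih (S \ U0).card (by omega) (S \ U0) rfl
      (fun u hu => hfS u (Finset.sdiff_subset hu)) z' x' hz'0 hL3
      (fun u hu => by
        by_cases hut : u = t
        · subst hut; simpa [x'] using hxt'
        · simpa [x', hut] using hx u (Finset.sdiff_subset hu)) hfe3
    refine ⟨(t, a) :: (L ++ L'), ?_, ?_, ?_, ?_, ?_⟩
    · intro e he
      rcases List.mem_cons.1 he with rfl | he
      · exact htS
      · rcases List.mem_append.1 he with he | he
        · exact hU0S (hL1 e he)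
        · exact Finset.sdiff_subset (hL1' e he)
    · intro e he
      rcases List.mem_cons.1 he with rfl | he
      · exact ha0
      · rcases List.mem_append.1 he with he | he
        · exact hL2 e he
        · exact hL2' e he
    · intro u
      rw [runM, runM_append]
      exact hL3' u
    · intro u hu
      rw [gainM, gainM_append]
      change _ + (gainM W L (za a) u + gainM W L' z' u) = _
      by_cases huU : u ∈ U0
      · have hut : t ≠ u := by rintro rfl; exact htU0 huU
        rw [if_neg hut, hL4 u huU, gainM_notMem W hL1' (by simp [huU])]
        ring
      · rw [gainM_notMem W hL1 huU, hL4' u (by simp [hu, huU])]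
        by_cases hut : u = t
        · subst hut; simp [x']
        · simp [x', hut, Ne.symm hut]
    · intro u hu
      rw [cntM_cons, cntM_append]
      by_cases huU : u ∈ U0
      · have hut : t ≠ u := by rintro rfl; exact htU0 huU
        rw [if_neg hut, cntM_notMem hL1' (by simp [huU])]
        have := hL5 u huU
        omega
      · rw [cntM_notMem hL1 huU]
        have := hL5' u (by simp [hu, huU])
        split_ifs <;> omega

end KeyLemma
section Expect

variable {n : ℕ}

/-- probability that the active set is exactly `B` -/
noncomputable def prB (q : Fin n → ℝ) (B : Finset (Fin n)) : ℝ :=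
  ∏ j, if j ∈ B then q j else 1 - q j

/-- expectation over the random active set -/
noncomputable def EB (q : Fin n → ℝ) (φ : Finset (Fin n) → ℝ) : ℝ :=
  ∑ B : Finset (Fin n), prB q B * φ B

lemma prB_nonneg (q : Fin n → ℝ) (h0 : ∀ j, 0 ≤ q j) (h1 : ∀ j, q j ≤ 1) (B : Finset (Fin n)) :
    0 ≤ prB q B := by
  apply Finset.prod_nonneg
  intro j _
  split_ifs
  · exact h0 j
  · linarith [h1 j]

lemma EB_split (q : Fin n → ℝ) (φ : Finset (Fin n) → ℝ) (i : Fin n) :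
    EB q φ = ∑ B ∈ (Finset.univ.erase i).powerset,
      (∏ j ∈ Finset.univ.erase i, if j ∈ B then q j else 1 - q j) *
        ((1 - q i) * φ B + q i * φ (insert i B)) := by
  have h : (Finset.univ : Finset (Finset (Fin n))) = (insert i (Finset.univ.erase i)).powerset := by
    rw [Finset.insert_erase (Finset.mem_univ i)]; simp
  rw [EB, h, Finset.sum_powerset_insert (by simp), ← Finset.sum_add_distrib]
  apply Finset.sum_congr rfl
  intro B hB
  have hiB : i ∉ B := fun h => by simpa using (Finset.mem_powerset.1 hB) h
  rw [prB, prB, ← Finset.mul_prod_erase _ _ (Finset.mem_univ i),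
    ← Finset.mul_prod_erase (a := i) _ _ (Finset.mem_univ i)]
  have h2 : ∏ j ∈ Finset.univ.erase i, (if j ∈ insert i B then q j else 1 - q j) =
      ∏ j ∈ Finset.univ.erase i, (if j ∈ B then q j else 1 - q j) := by
    apply Finset.prod_congr rfl
    intro j hj
    simp [Finset.ne_of_mem_erase hj]
  rw [h2]
  simp only [hiB, if_false, Finset.mem_insert_self, if_true]
  ring

lemma EB_update (q : Fin n → ℝ) (φ : Finset (Fin n) → ℝ) (i : Fin n) (c : ℝ) :
    EB (Function.update q i c) φ =
      EB q (fun B => (1 - c) * φ (B.erase i) + c * φ (insert i B)) := by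
  rw [EB_split _ _ i, EB_split _ _ i]
  apply Finset.sum_congr rfl
  intro B hB
  have hiB : i ∉ B := fun h => by simpa using (Finset.mem_powerset.1 hB) h
  have h2 : ∏ j ∈ Finset.univ.erase i, (if j ∈ B then Function.update q i c j
        else 1 - Function.update q i c j) =
      ∏ j ∈ Finset.univ.erase i, (if j ∈ B then q j else 1 - q j) := by
    apply Finset.prod_congr rfl
    intro j hj
    simp [Finset.ne_of_mem_erase hj]
  rw [h2]
  simp only [Function.update_self, Finset.erase_eq_of_notMem hiB, Finset.erase_insert hiB,
    Finset.insert_idem]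
  ring

lemma EB_add (q : Fin n → ℝ) (φ ψ : Finset (Fin n) → ℝ) :
    EB q (fun B => φ B + ψ B) = EB q φ + EB q ψ := by
  simp [EB, mul_add, Finset.sum_add_distrib]

lemma EB_smul (q : Fin n → ℝ) (φ : Finset (Fin n) → ℝ) (c : ℝ) :
    EB q (fun B => c * φ B) = c * EB q φ := by
  simp only [EB, Finset.mul_sum]
  exact Finset.sum_congr rfl fun _ _ => by ring

lemma EB_mono (q : Fin n → ℝ) (h0 : ∀ j, 0 ≤ q j) (h1 : ∀ j, q j ≤ 1)
    (φ ψ : Finset (Fin n) → ℝ) (h : ∀ B, φ B ≤ ψ B) : EB q φ ≤ EB q ψ :=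
  Finset.sum_le_sum fun B _ => mul_le_mul_of_nonneg_left (h B) (prB_nonneg q h0 h1 B)

lemma EB_move (q : Fin n → ℝ) (φ : Finset (Fin n) → ℝ) (i : Fin n) (a : ℝ) :
    EB (Function.update q i (q i + a)) φ =
      EB q φ + a * EB q (fun B => φ (insert i B) - φ (B.erase i)) := by
  have h := EB_update q φ i (q i)
  rw [Function.update_eq_self] at h
  rw [EB_update, h, ← EB_smul, ← EB_add]
  congr 1
  funext B
  ring

lemma EB_piecewise (q : Fin n → ℝ) (φ : Finset (Fin n) → ℝ) (V : Finset (Fin n)) :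
    EB (V.piecewise 1 q) φ = EB q (fun B => φ (B ∪ V)) := by
  induction V using Finset.induction_on generalizing φ with
  | empty => simp
  | insert i V hi ih =>
    rw [Finset.piecewise_insert, Pi.one_apply, EB_update]
    simp only [sub_self, zero_mul, one_mul, zero_add]
    rw [ih]
    simp [Finset.union_insert]

lemma EB_zero (q : Fin n → ℝ) (hq : ∀ j, q j = 0) (φ : Finset (Fin n) → ℝ) :
    EB q φ = φ ∅ := by
  have hp : ∀ B : Finset (Fin n), B ≠ ∅ → prB q B = 0 := by
    intro B hB
    obtain ⟨j, hj⟩ := Finset.nonempty_iff_ne_empty.2 hB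
    exact Finset.prod_eq_zero (Finset.mem_univ j) (by simp [hj, hq])
  rw [EB, Finset.sum_eq_single ∅ (fun B _ hB => by rw [hp B hB, zero_mul]) (by simp)]
  simp [prB, hq]

/-- real-valued rank -/
noncomputable def rkR (M : Matroid (Fin n)) (B : Finset (Fin n)) : ℝ :=
  ((M.eRk (B : Set (Fin n))).toNat : ℝ)

lemma eRk_lt_top' (M : Matroid (Fin n)) (X : Set (Fin n)) : M.eRk X ≠ ⊤ := by
  intro h
  have := M.eRk_le_encard X
  rw [h, top_le_iff] at this
  exact (Set.toFinite X).encard_lt_top.ne this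

lemma rkR_submod (M : Matroid (Fin n)) (B U V : Finset (Fin n)) :
    rkR M B + rkR M (B ∪ (U ∪ V)) ≤ rkR M (B ∪ U) + rkR M (B ∪ V) := by
  have h := M.eRk_inter_add_eRk_union_le (↑(B ∪ U)) (↑(B ∪ V))
  have h2 : M.eRk (B : Set (Fin n)) ≤ M.eRk ((↑(B ∪ U) : Set (Fin n)) ∩ ↑(B ∪ V)) := by
    apply M.eRk_mono
    intro j hj
    simp at hj ⊢
    simp [hj]
  have h3 : (↑(B ∪ U) : Set (Fin n)) ∪ ↑(B ∪ V) = ↑(B ∪ (U ∪ V)) := by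
    ext j; simp; tauto
  rw [h3] at h
  have h4 := (add_le_add_left h2 _).trans h
  unfold rkR
  rw [← ENat.natCast_toNat (eRk_lt_top' M (B : Set (Fin n))),
    ← ENat.natCast_toNat (eRk_lt_top' M (↑(B ∪ (U ∪ V)) : Set (Fin n))),
    ← ENat.natCast_toNat (eRk_lt_top' M (↑(B ∪ U) : Set (Fin n))),
    ← ENat.natCast_toNat (eRk_lt_top' M (↑(B ∪ V) : Set (Fin n)))] at h4
  exact_mod_cast h4

open Classical in
/-- indicator that `i` is not spanned by the others -/
noncomputable def indW (M : Matroid (Fin n)) (i : Fin n) (B : Finset (Fin n)) : ℝ :=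
  if i ∉ M.closure (↑(B.erase i) : Set (Fin n)) then 1 else 0

lemma indW_insert (M : Matroid (Fin n)) (i : Fin n) (B : Finset (Fin n)) :
    indW M i (insert i B) = indW M i B := by
  have h : (insert i B).erase i = B.erase i := Finset.erase_insert_eq_erase B i
  unfold indW
  rw [h]

lemma indW_erase (M : Matroid (Fin n)) (i : Fin n) (B : Finset (Fin n)) :
    indW M i (B.erase i) = indW M i B := by
  have h : (B.erase i).erase i = B.erase i := Finset.erase_idem
  unfold indW
  rw [h]

lemma EB_indW_update (M : Matroid (Fin n)) (i : Fin n) (q : Fin n → ℝ) (c : ℝ) :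
    EB (Function.update q i c) (indW M i) = EB q (indW M i) := by
  rw [EB_update]
  congr 1
  funext B
  rw [indW_insert, indW_erase]
  ring

lemma rkR_diff (M : Matroid (Fin n)) (hME : M.E = Set.univ) (i : Fin n) (B : Finset (Fin n)) :
    rkR M (insert i B) - rkR M (B.erase i) = indW M i B := by
  have h0 : insert i B = insert i (B.erase i) := by ext j; by_cases h : j = i <;> simp [h]
  rw [h0]
  unfold rkR indW
  by_cases h : i ∈ M.closure (↑(B.erase i) : Set (Fin n))
  · have h1 : M.eRk (↑(insert i (B.erase i)) : Set (Fin n)) = M.eRk (↑(B.erase i)) := by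
      rw [Finset.coe_insert, ← M.eRk_insert_closure_eq, Set.insert_eq_of_mem h, M.eRk_closure_eq]
    rw [h1, if_neg (not_not.2 h)]; simp
  · have h1 : M.eRk (↑(insert i (B.erase i)) : Set (Fin n)) = M.eRk (↑(B.erase i)) + 1 := by
      rw [Finset.coe_insert]
      exact Matroid.eRk_insert_eq_add_one ⟨by simp [hME], h⟩
    rw [h1, ENat.toNat_add (eRk_lt_top' _ _) (by simp), if_pos h]; simp

lemma rkR_indep (M : Matroid (Fin n)) (I X : Finset (Fin n)) (hI : M.Indep (I : Set (Fin n)))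
    (h : I ⊆ X) : (I.card : ℝ) ≤ rkR M X := by
  have h1 := hI.encard_le_eRk_of_subset (X := (X : Set (Fin n))) (by simpa using h)
  rw [Set.encard_coe_eq_coe_finsetCard, ← ENat.natCast_toNat (eRk_lt_top' M (X : Set (Fin n)))] at h1
  unfold rkR
  exact_mod_cast h1

lemma rkR_empty (M : Matroid (Fin n)) : rkR M ∅ = 0 := by simp [rkR]

end Expect

section FW

variable {n : ℕ} {T : Type} [Fintype T] [DecidableEq T]

/-- expected rank -/
noncomputable def FF (cand : T → Fin n) (f : T → ℝ) (M : Matroid (Fin n)) (z : T → ℝ) : ℝ :=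
  ∑ p ∈ profiles cand, (∏ j, f (p j)) * EB (fun j => z (p j)) (rkR M)

/-- interim win probability against `z` -/
noncomputable def WW (cand : T → Fin n) (f : T → ℝ) (M : Matroid (Fin n)) (z : T → ℝ) (t : T) : ℝ :=
  ∑ p ∈ (profiles cand).filter (fun p => p (cand t) = t),
    (∏ j ∈ Finset.univ.erase (cand t), f (p j)) * EB (fun j => z (p j)) (indW M (cand t))

lemma FF_move (cand : T → Fin n) (f : T → ℝ) (M : Matroid (Fin n)) (hME : M.E = Set.univ)
    (z : T → ℝ) (t : T) (a : ℝ) :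
    FF cand f M (Function.update z t (z t + a)) = FF cand f M z + a * f t * WW cand f M z t := by
  rw [WW, Finset.sum_filter, FF, FF, Finset.mul_sum, ← Finset.sum_add_distrib]
  apply Finset.sum_congr rfl
  intro p hp
  have hp' : ∀ i, cand (p i) = i := by simpa [profiles] using hp
  by_cases h : p (cand t) = t
  · have h1 : (fun j => Function.update z t (z t + a) (p j)) =
        Function.update (fun j => z (p j)) (cand t) ((fun j => z (p j)) (cand t) + a) := by
      funext j
      by_cases hj : j = cand t
      · subst hj; simp [h]
      · have : p j ≠ t := by rintro rfl; exact hj (hp' j).symm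
        simp [hj, this]
    rw [h1, EB_move, if_pos h, ← Finset.mul_prod_erase _ _ (Finset.mem_univ (cand t)), h]
    have h2 : (fun B => rkR M (insert (cand t) B) - rkR M (B.erase (cand t))) = indW M (cand t) := by
      funext B; exact rkR_diff M hME _ _
    rw [h2]
    ring
  · have h1 : (fun j => Function.update z t (z t + a) (p j)) = fun j => z (p j) := by
      funext j
      have : p j ≠ t := by rintro rfl; exact h (by rw [hp' j])
      simp [this]
    rw [h1, if_neg h]; ring

lemma FF_piecewise (cand : T → Fin n) (f : T → ℝ) (M : Matroid (Fin n)) (z : T → ℝ)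
    (U : Finset T) : FF cand f M (U.piecewise 1 z) =
    ∑ p ∈ profiles cand, (∏ j, f (p j)) * EB (fun j => z (p j))
      (fun B => rkR M (B ∪ Finset.univ.filter (fun j => p j ∈ U))) := by
  apply Finset.sum_congr rfl
  intro p _
  rw [← EB_piecewise]
  congr 2
  funext j
  by_cases h : p j ∈ U <;> simp [h]

lemma FF_submod (cand : T → Fin n) (f : T → ℝ) (hf0 : ∀ t, 0 ≤ f t) (M : Matroid (Fin n))
    (z : T → ℝ) (hz0 : ∀ t, 0 ≤ z t) (hz1 : ∀ t, z t ≤ 1) (U V : Finset T) :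
    FF cand f M z + FF cand f M ((U ∪ V).piecewise 1 z) ≤
      FF cand f M (U.piecewise 1 z) + FF cand f M (V.piecewise 1 z) := by
  rw [FF_piecewise, FF_piecewise, FF_piecewise, FF, ← Finset.sum_add_distrib,
    ← Finset.sum_add_distrib]
  apply Finset.sum_le_sum
  intro p _
  rw [← mul_add, ← mul_add, ← EB_add, ← EB_add]
  refine mul_le_mul_of_nonneg_left ?_ (Finset.prod_nonneg fun j _ => hf0 _)
  apply EB_mono _ (fun j => hz0 _) (fun j => hz1 _)
  intro B
  have h : Finset.univ.filter (fun j => p j ∈ U ∪ V) =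
    Finset.univ.filter (fun j => p j ∈ U) ∪ Finset.univ.filter (fun j => p j ∈ V) := by
    ext j; simp
  rw [h]
  exact rkR_submod M _ _ _

/-- `FF` only depends on positive types. -/
lemma FF_congr (cand : T → Fin n) (f : T → ℝ) (M : Matroid (Fin n)) (z z' : T → ℝ)
    (h : ∀ t, f t ≠ 0 → z t = z' t) : FF cand f M z = FF cand f M z' := by
  apply Finset.sum_congr rfl
  intro p _
  by_cases hp : ∃ j, f (p j) = 0
  · obtain ⟨j, hj⟩ := hp
    rw [Finset.prod_eq_zero (Finset.mem_univ j) hj]; simp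
  · push Not at hp
    congr 2
    funext j
    exact h _ (hp j)

lemma feas_FF (cand : T → Fin n) (f : T → ℝ) (hf0 : ∀ t, 0 ≤ f t) (M : Matroid (Fin n))
    (x : T → ℝ) (A : (Fin n → T) → Finset (Fin n) → ℝ)
    (hA : ImplementsRule cand f (fun S => M.Indep ↑S) A x) (U : Finset T) (z : T → ℝ)
    (hz : ∀ t, f t ≠ 0 → z t = 0) :
    ∑ t ∈ U, f t * x t ≤ FF cand f M (U.piecewise 1 z) - FF cand f M z := by
  obtain ⟨hA0, hA1, hAI, hAx⟩ := hA
  have h0 : FF cand f M z = 0 := by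
    rw [FF_congr cand f M z 0 (by simpa using hz)]
    apply Finset.sum_eq_zero
    intro p _
    rw [EB_zero _ (by simp), rkR_empty, mul_zero]
  have h1 : FF cand f M (U.piecewise 1 z) = FF cand f M (U.piecewise 1 0) := by
    apply FF_congr
    intro t ht
    by_cases htU : t ∈ U <;> simp [htU, hz t ht]
  rw [h0, h1, sub_zero, FF_piecewise]
  have h2 : ∑ t ∈ U, f t * x t = ∑ p ∈ profiles cand, (∏ j, f (p j)) *
      ∑ S : Finset (Fin n), A p S * ((S.filter (fun j => p j ∈ U)).card : ℝ) := by
    have h3 : ∀ t ∈ U, f t * x t = ∑ p ∈ profiles cand, if p (cand t) = t then (∏ j, f (p j)) *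
        ∑ S : Finset (Fin n), (if cand t ∈ S then A p S else 0) else 0 := by
      intro t _
      rw [← hAx t, Finset.sum_filter, Finset.mul_sum]
      apply Finset.sum_congr rfl
      intro p _
      by_cases h : p (cand t) = t
      · rw [if_pos h, if_pos h, ← Finset.mul_prod_erase _ _ (Finset.mem_univ (cand t)), h,
          Finset.sum_filter]
        ring
      · simp [h]
    rw [Finset.sum_congr rfl h3, Finset.sum_comm]
    apply Finset.sum_congr rfl
    intro p hp
    have hp' : ∀ i, cand (p i) = i := by simpa [profiles] using hp
    have h4 : ∀ t ∈ U, (if p (cand t) = t then (∏ j, f (p j)) *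
        ∑ S : Finset (Fin n), (if cand t ∈ S then A p S else 0) else 0) =
        (∏ j, f (p j)) * ∑ S : Finset (Fin n), A p S *
          (if p (cand t) = t ∧ cand t ∈ S then 1 else 0) := by
      intro t _
      by_cases h : p (cand t) = t <;> simp [h]
    rw [Finset.sum_congr rfl h4, ← Finset.mul_sum, Finset.sum_comm]
    congr 1
    apply Finset.sum_congr rfl
    intro S _
    rw [← Finset.mul_sum, ← Finset.sum_filter, Finset.sum_const, nsmul_eq_mul, mul_one]
    congr 2
    symm
    refine Finset.card_bij (fun j _ => p j) ?_ ?_ ?_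
    · intro j hj; simp only [Finset.mem_filter] at hj ⊢; simp [hp', hj]
    · intro j _ k _ h
      have := congrArg cand h
      simpa [hp'] using this
    · intro t ht
      simp only [Finset.mem_filter] at ht
      exact ⟨cand t, by simp [ht], ht.2.1⟩
  rw [h2]
  apply Finset.sum_le_sum
  intro p _
  refine mul_le_mul_of_nonneg_left ?_ (Finset.prod_nonneg fun j _ => hf0 _)
  rw [EB_zero _ (by simp)]
  calc ∑ S : Finset (Fin n), A p S * ((S.filter (fun j => p j ∈ U)).card : ℝ)
      ≤ ∑ S : Finset (Fin n), A p S * rkR M (Finset.univ.filter (fun j => p j ∈ U)) := by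
        apply Finset.sum_le_sum
        intro S _
        rcases eq_or_ne (A p S) 0 with h | h
        · simp [h]
        · refine mul_le_mul_of_nonneg_left ?_ (hA0 p S)
          apply rkR_indep
          · exact (hAI p S h).subset (by intro j; simp; tauto)
          · intro j; simp
    _ = _ := by rw [← Finset.sum_mul, hA1, one_mul, Finset.empty_union]

lemma sum_prod_profiles (cand : T → Fin n) (f : T → ℝ)
    (hf1 : ∀ i : Fin n, ∑ t ∈ Finset.univ.filter (fun t => cand t = i), f t = 1) (t : T) :
    ∑ p ∈ (profiles cand).filter (fun p => p (cand t) = t),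
      (∏ j ∈ Finset.univ.erase (cand t), f (p j)) = 1 := by
  let g : Fin n → T → ℝ := fun j u => if j = cand t then 1 else f u
  let s : Fin n → Finset T := fun j => if j = cand t then {t} else
    Finset.univ.filter (fun u => cand u = j)
  have h1 : (profiles cand).filter (fun p => p (cand t) = t) = Fintype.piFinset s := by
    ext p
    simp only [profiles, Finset.mem_filter, Finset.mem_univ, true_and, Fintype.mem_piFinset, s]
    constructor
    · rintro ⟨h, h'⟩ j
      by_cases hj : j = cand t
      · subst hj; simp [h']
      · simp [hj, h]
    · intro h
      have ht := h (cand t)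
      simp at ht
      refine ⟨fun j => ?_, ht⟩
      by_cases hj : j = cand t
      · subst hj; rw [ht]
      · simpa [hj] using h j
  have h2 : ∀ p : Fin n → T, (∏ j ∈ Finset.univ.erase (cand t), f (p j)) = ∏ j, g j (p j) := by
    intro p
    rw [← Finset.mul_prod_erase _ _ (Finset.mem_univ (cand t))]
    simp only [g, if_true, one_mul]
    apply Finset.prod_congr rfl
    intro j hj
    simp [Finset.ne_of_mem_erase hj]
  rw [h1, Finset.sum_congr rfl (fun p _ => h2 p), ← Finset.prod_univ_sum]
  apply Finset.prod_eq_one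
  intro j _
  by_cases hj : j = cand t
  · simp [s, g, hj]
  · simp only [s, g, hj, if_false]; exact hf1 j

lemma WW_zero (cand : T → Fin n) (f : T → ℝ)
    (hf1 : ∀ i : Fin n, ∑ t ∈ Finset.univ.filter (fun t => cand t = i), f t = 1)
    (M : Matroid (Fin n)) (z : T → ℝ)
    (hz : ∀ t, f t ≠ 0 → z t = 0) (t : T) :
    WW cand f M z t = indW M (cand t) ∅ := by
  have : ∀ p ∈ (profiles cand).filter (fun p => p (cand t) = t),
      (∏ j ∈ Finset.univ.erase (cand t), f (p j)) * EB (fun j => z (p j)) (indW M (cand t)) =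
      (∏ j ∈ Finset.univ.erase (cand t), f (p j)) * indW M (cand t) ∅ := by
    intro p _
    by_cases hp : ∃ j, j ≠ cand t ∧ f (p j) = 0
    · obtain ⟨j, hj, hj0⟩ := hp
      rw [Finset.prod_eq_zero (i := j) (by simp [hj]) hj0]; simp
    · push Not at hp
      congr 1
      rw [← EB_indW_update M (cand t) _ 0, EB_zero]
      intro j
      by_cases hj : j = cand t
      · simp [hj]
      · simp [hj, hz _ (hp j hj)]
  rw [WW, Finset.sum_congr rfl this, ← Finset.sum_mul, sum_prod_profiles cand f hf1, one_mul]

end FW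
section Dice

/-- finite die on the values `0, …, K` with weights `w` -/
noncomputable def die (K : ℕ) (w : ℕ → ℝ) : Measure ℝ :=
  ∑ v ∈ Finset.range (K + 1), ENNReal.ofReal (w v) • Measure.dirac (v : ℝ)

open Classical in
lemma die_apply (K : ℕ) (w : ℕ → ℝ) (hw : ∀ v, 0 ≤ w v) (A : Set ℝ) (hA : MeasurableSet A) :
    die K w A = ENNReal.ofReal (∑ v ∈ Finset.range (K + 1), if (v : ℝ) ∈ A then w v else 0) := by
  rw [ENNReal.ofReal_sum_of_nonneg (fun v _ => by split_ifs <;> simp [hw])]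
  simp only [die, Measure.coe_finsetSum, Finset.sum_apply, Measure.smul_apply, smul_eq_mul]
  apply Finset.sum_congr rfl
  intro v _
  rw [Measure.dirac_apply' _ hA]
  by_cases h : (v : ℝ) ∈ A <;> simp [h]

lemma die_prob (K : ℕ) (w : ℕ → ℝ) (hw : ∀ v, 0 ≤ w v)
    (h1 : ∑ v ∈ Finset.range (K + 1), w v = 1) : IsProbabilityMeasure (die K w) := by
  classical
  constructor
  rw [die_apply K w hw _ MeasurableSet.univ]
  simp [h1]

open Classical in
/-- support of a die -/
noncomputable def dieSupp (K : ℕ) (w : ℕ → ℝ) : Finset ℝ :=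
  ((Finset.range (K + 1)).filter (fun v => w v ≠ 0)).image (fun v : ℕ => (v : ℝ))

lemma die_supp (K : ℕ) (w : ℕ → ℝ) (hw : ∀ v, 0 ≤ w v) : die K w (↑(dieSupp K w))ᶜ = 0 := by
  classical
  rw [die_apply K w hw _ (Finset.measurableSet _).compl, ENNReal.ofReal_eq_zero]
  apply le_of_eq
  apply Finset.sum_eq_zero
  intro v hv
  split_ifs with h
  · by_contra h0
    apply h
    simp only [dieSupp, Finset.coe_image, Set.mem_image, Finset.mem_coe, Finset.mem_filter]
    exact ⟨v, ⟨hv, h0⟩, rfl⟩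
  · rfl

variable {n : ℕ}

lemma wins_prob (M : Matroid (Fin n)) (hME : M.E = Set.univ) (K : ℕ) (w : Fin n → ℕ → ℝ)
    (hw : ∀ j v, 0 ≤ w j v) (h1 : ∀ j, ∑ v ∈ Finset.range (K + 1), w j v = 1) (i : Fin n)
    (hti : ∀ j, j ≠ i → ∀ v, 1 ≤ v → w i v = 0 ∨ w j v = 0) (π : Equiv.Perm (Fin n)) :
    ((Measure.pi (fun j => die K (w j))) {s | Wins M s π i}).toReal =
      ∑ v ∈ Finset.Icc 1 K, w i v *
        EB (fun j => ∑ l ∈ Finset.range (K + 1), if v < l then w j l else 0) (indW M i) := by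
  classical
  have : ∀ j, IsProbabilityMeasure (die K (w j)) := fun j => die_prob K (w j) (hw j) (h1 j)
  let box : ℕ → Finset (Fin n) → Fin n → Set ℝ := fun v B j =>
    if j = i then {(v : ℝ)} else if j ∈ B then Set.Ioi (v : ℝ) else Set.Iic (v : ℝ)
  let R : ℕ × Finset (Fin n) → Set (Fin n → ℝ) := fun vB => Set.pi Set.univ (box vB.1 vB.2)
  have hboxm : ∀ v B j, MeasurableSet (box v B j) := by
    intro v B j
    simp only [box]
    split_ifs <;> measurability
  let G : Finset (ℕ × Finset (Fin n)) := Finset.Icc 1 K ×ˢ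
    ((Finset.univ.erase i).powerset.filter (fun B : Finset (Fin n) => i ∉ M.closure (B : Set (Fin n))))
  have hae : ∀ᵐ s ∂(Measure.pi (fun j => die K (w j))),
      ∀ j, ∃ l ∈ Finset.range (K + 1), w j l ≠ 0 ∧ s j = (l : ℝ) := by
    rw [ae_all_iff]
    intro j
    have h : ∀ᵐ y ∂(die K (w j)), y ∈ dieSupp K (w j) := by
      have := die_supp K (w j) (hw j)
      exact this
    have h2 := (Measure.tendsto_eval_ae_ae (μ := fun j => die K (w j)) (i := j)).eventually h
    filter_upwards [h2] with s hs
    simp only [dieSupp, Function.eval, Finset.mem_image, Finset.mem_filter] at hs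
    obtain ⟨l, ⟨hl, hl'⟩, hls⟩ := hs
    exact ⟨l, hl, hl', hls.symm⟩
  have hset : {s | Wins M s π i} =ᵐ[Measure.pi (fun j => die K (w j))] ⋃ vB ∈ G, R vB := by
    filter_upwards [hae] with s hs
    apply propext
    change Wins M s π i ↔ s ∈ ⋃ vB ∈ G, R vB
    obtain ⟨v, hv, hv0, hsv⟩ := hs i
    have hrew : 0 < s i → {j | 0 < s j ∧ (s i < s j ∨ (s i = s j ∧ π i < π j))} =
        (↑((Finset.univ.erase i).filter (fun j => (v : ℝ) < s j)) : Set (Fin n)) := by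
      intro hpos
      ext j
      simp only [Set.mem_ofPred_eq, Finset.coe_filter, Finset.mem_erase, Finset.mem_univ, and_true]
      rw [← hsv]
      constructor
      · rintro ⟨h0, h | ⟨h, hπ⟩⟩
        · exact ⟨by rintro rfl; exact lt_irrefl _ h, h⟩
        · exfalso
          have hji : j ≠ i := by rintro rfl; exact lt_irrefl _ hπ
          obtain ⟨l, hl, hl0, hsl⟩ := hs j
          have hlv : l = v := by
            have : (l : ℝ) = v := by rw [← hsl, ← h, hsv]
            exact_mod_cast this
          subst hlv
          have hv1 : 1 ≤ l := by
            rw [hsv] at hpos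
            exact_mod_cast hpos
          rcases hti j hji l hv1 with h' | h'
          · exact hv0 h'
          · exact hl0 h'
      · rintro ⟨_, h⟩
        exact ⟨hpos.trans h, Or.inl h⟩
    simp only [Set.mem_iUnion]
    constructor
    · rintro ⟨_, hpos, hcl⟩
      rw [hrew hpos] at hcl
      refine ⟨(v, (Finset.univ.erase i).filter (fun j => (v : ℝ) < s j)), ?_, ?_⟩
      · simp only [G, Finset.mem_product, Finset.mem_Icc, Finset.mem_filter, Finset.mem_powerset]
        refine ⟨⟨?_, ?_⟩, Finset.filter_subset _ _, hcl⟩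
        · rw [hsv] at hpos
          exact_mod_cast hpos
        · simpa [Nat.lt_succ_iff] using hv
      · intro j _
        simp only [box]
        by_cases hj : j = i
        · subst hj; simp [hsv]
        · by_cases h : (v : ℝ) < s j
          · simp [hj, h]
          · simpa [hj, h] using not_lt.1 h
    · rintro ⟨⟨v', B⟩, hG, hR⟩
      simp only [G, Finset.mem_product, Finset.mem_Icc, Finset.mem_filter,
        Finset.mem_powerset] at hG
      obtain ⟨⟨hv1, _⟩, hB, hcl⟩ := hG
      have hi := hR i (Set.mem_univ _)
      simp only [box, if_true, Set.mem_singleton_iff] at hi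
      have hvv : v' = v := by
        have : (v' : ℝ) = v := by rw [← hi, hsv]
        exact_mod_cast this
      subst hvv
      have hpos : 0 < s i := by rw [hi]; exact_mod_cast hv1
      refine ⟨by simp [hME], hpos, ?_⟩
      rw [hrew hpos]
      have : (Finset.univ.erase i).filter (fun j => (v' : ℝ) < s j) = B := by
        ext j
        simp only [Finset.mem_filter, Finset.mem_erase, Finset.mem_univ, and_true]
        constructor
        · rintro ⟨hj, h⟩
          by_contra hjB
          have := hR j (Set.mem_univ _)
          simp only [box, hj, hjB, if_false, Set.mem_Iic] at this
          linarith
        · intro hjB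
          have hj : j ≠ i := by simpa using hB hjB
          have := hR j (Set.mem_univ _)
          simp only [box, hj, hjB, if_false, if_true, Set.mem_Ioi] at this
          exact ⟨hj, this⟩
      rw [this]
      exact hcl
  have hdisj : Set.PairwiseDisjoint (↑G) R := by
    rintro ⟨v, B⟩ hG ⟨v', B'⟩ hG' hne
    rw [Function.onFun, Set.disjoint_left]
    intro s hs hs'
    apply hne
    simp only [G, Finset.mem_coe, Finset.mem_product, Finset.mem_Icc, Finset.mem_filter,
        Finset.mem_powerset] at hG hG'
    have hi := hs i (Set.mem_univ _)
    have hi' := hs' i (Set.mem_univ _)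
    simp only [box, if_true, Set.mem_singleton_iff] at hi hi'
    have hvv : v = v' := by
      have : (v : ℝ) = v' := by rw [← hi, hi']
      exact_mod_cast this
    subst hvv
    have : B = B' := by
      ext j
      have hj := hs j (Set.mem_univ _)
      have hj' := hs' j (Set.mem_univ _)
      simp only [box] at hj hj'
      by_cases hji : j = i
      · subst hji
        have a1 : j ∉ B := fun h => by simpa using hG.2.1 h
        have a2 : j ∉ B' := fun h => by simpa using hG'.2.1 h
        simp [a1, a2]
      · rw [if_neg hji] at hj hj'
        by_cases b1 : j ∈ B <;> by_cases b2 : j ∈ B' <;> simp [b1, b2] at hj hj' ⊢ <;> linarith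
    rw [this]
  rw [measure_congr hset, measure_biUnion_finset hdisj
    (fun vB _ => MeasurableSet.univ_pi (fun j => hboxm _ _ _)),
    ENNReal.toReal_sum (fun vB _ => measure_ne_top _ _), Finset.sum_product]
  apply Finset.sum_congr rfl
  intro v hv
  rw [Finset.mem_Icc] at hv
  rw [EB_split _ _ i, Finset.mul_sum, Finset.sum_filter]
  apply Finset.sum_congr rfl
  intro B hB
  have hiB : i ∉ B := fun h => by simpa using (Finset.mem_powerset.1 hB) h
  have hind : indW M i B = if i ∉ M.closure (B : Set (Fin n)) then 1 else 0 := by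
    unfold indW
    rw [Finset.erase_eq_of_notMem hiB]
  rw [indW_insert, hind]
  split_ifs with hcl
  swap
  · rw [Measure.pi_pi, ENNReal.toReal_prod, ← Finset.mul_prod_erase _ _ (Finset.mem_univ i)]
    have e1 : (die K (w i) (box v B i)).toReal = w i v := by
      simp only [box, if_true]
      rw [die_apply K (w i) (hw i) _ (measurableSet_singleton _), ENNReal.toReal_ofReal
        (Finset.sum_nonneg fun _ _ => by split_ifs <;> simp [hw])]
      simp only [Set.mem_singleton_iff, Nat.cast_inj, Finset.sum_ite_eq', Finset.mem_range]
      rw [if_pos (by omega)]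
    have e2 : ∀ j ∈ Finset.univ.erase i, (die K (w j) (box v B j)).toReal =
        if j ∈ B then ∑ l ∈ Finset.range (K + 1), (if v < l then w j l else 0) else
          1 - ∑ l ∈ Finset.range (K + 1), (if v < l then w j l else 0) := by
      intro j hj
      have hj' := Finset.ne_of_mem_erase hj
      rw [die_apply K (w j) (hw j) _ (hboxm _ _ _), ENNReal.toReal_ofReal
        (Finset.sum_nonneg fun _ _ => by split_ifs <;> simp [hw])]
      by_cases hjB : j ∈ B
      · simp [box, hj', hjB]
      · simp only [box, hj', hjB, if_false, Set.mem_Iic, Nat.cast_le]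
        rw [← h1 j, ← Finset.sum_sub_distrib]
        apply Finset.sum_congr rfl
        intro l _
        by_cases h : v < l
        · simp [h]
        · simp [h, not_lt.1 h]
    rw [e1, Finset.prod_congr rfl e2]
    ring
  · simp

lemma winProb_die (M : Matroid (Fin n)) (hME : M.E = Set.univ) (K : ℕ) (w : Fin n → ℕ → ℝ)
    (hw : ∀ j v, 0 ≤ w j v) (h1 : ∀ j, ∑ v ∈ Finset.range (K + 1), w j v = 1) (i : Fin n)
    (hti : ∀ j, j ≠ i → ∀ v, 1 ≤ v → w i v = 0 ∨ w j v = 0) :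
    winProb M (fun j => die K (w j)) i =
      ∑ v ∈ Finset.Icc 1 K, w i v *
        EB (fun j => ∑ l ∈ Finset.range (K + 1), if v < l then w j l else 0) (indW M i) := by
  rw [winProb, Finset.sum_congr rfl (fun π _ => wins_prob M hME K w hw h1 i hti π),
    Finset.sum_const, nsmul_eq_mul, Finset.card_univ, Fintype.card_perm, Fintype.card_fin]
  rw [mul_div_cancel_left₀]
  exact_mod_cast Nat.factorial_ne_zero n

variable {T : Type} [Fintype T] [DecidableEq T]

lemma diceInterim_die (cand : T → Fin n) (f : T → ℝ)
    (M : Matroid (Fin n)) (hME : M.E = Set.univ) (K : ℕ) (w : T → ℕ → ℝ)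
    (hw : ∀ j v, 0 ≤ w j v) (h1 : ∀ j, ∑ v ∈ Finset.range (K + 1), w j v = 1)
    (hti : ∀ t u, t ≠ u → ∀ v, 1 ≤ v → w t v = 0 ∨ w u v = 0) (t : T) :
    diceInterim cand f M (fun u => die K (w u)) t =
      ∑ v ∈ Finset.Icc 1 K, w t v *
        WW cand f M (fun u => ∑ l ∈ Finset.range (K + 1), if v < l then w u l else 0) t := by
  simp only [WW, Finset.mul_sum]
  rw [Finset.sum_comm, diceInterim]
  apply Finset.sum_congr rfl
  intro p hp
  simp only [profiles, Finset.mem_filter, Finset.mem_univ, true_and] at hp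
  obtain ⟨hp, hpt⟩ := hp
  rw [winProb_die M hME K (fun j => w (p j)) (fun j => hw _) (fun j => h1 _) (cand t), hpt,
    Finset.mul_sum]
  · apply Finset.sum_congr rfl
    intro v _
    ring
  · intro j hj v hv
    apply hti _ _ _ _ hv
    intro h
    apply hj
    have := congrArg cand h
    rw [hp, hp] at this
    exact this.symm

end Dice
section Assemble

variable {T : Type} [DecidableEq T]

/-- weight of type `u` at value `v` -/
def massL : List (T × ℝ) → ℕ → T → ℝ
  | [], _, _ => 0
  | (s, a) :: L, v, u => if v = L.length + 1 then (if s = u then a else 0) else massL L v u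

lemma massL_big (L : List (T × ℝ)) (v : ℕ) (hv : L.length < v) (u : T) : massL L v u = 0 := by
  induction L with
  | nil => rfl
  | cons e L ih =>
    obtain ⟨s, a⟩ := e
    simp only [List.length_cons] at hv
    rw [massL, if_neg (by omega), ih (by omega)]

lemma massL_zero (L : List (T × ℝ)) (u : T) : massL L 0 u = 0 := by
  induction L with
  | nil => rfl
  | cons e L ih =>
    obtain ⟨s, a⟩ := e
    rw [massL, if_neg (by omega), ih]

lemma massL_nonneg (L : List (T × ℝ)) (h : ∀ e ∈ L, 0 ≤ e.2) (v : ℕ) (u : T) :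
    0 ≤ massL L v u := by
  induction L with
  | nil => exact le_rfl
  | cons e L ih =>
    obtain ⟨s, a⟩ := e
    have ha : 0 ≤ a := h (s, a) (by simp)
    rw [massL]
    split_ifs
    · exact ha
    · exact le_rfl
    · exact ih (fun e he => h e (by simp [he]))

lemma massL_tie (L : List (T × ℝ)) (v : ℕ) (t u : T) (h : t ≠ u) :
    massL L v t = 0 ∨ massL L v u = 0 := by
  induction L with
  | nil => exact Or.inl rfl
  | cons e L ih =>
    obtain ⟨s, a⟩ := e
    rw [massL, massL]
    by_cases hv : v = L.length + 1
    · simp only [hv, if_true]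
      by_cases hs : s = t
      · right; rw [if_neg (by rw [hs]; exact h)]
      · left; rw [if_neg hs]
    · simpa only [hv, if_false] using ih

lemma massL_sum (L : List (T × ℝ)) (z : T → ℝ) (u : T) :
    z u + ∑ v ∈ Finset.range (L.length + 1), massL L v u = runM L z u := by
  induction L generalizing z with
  | nil => simp [massL, runM]
  | cons e L ih =>
    obtain ⟨s, a⟩ := e
    rw [List.length_cons, Finset.sum_range_succ, runM, ← ih]
    have : ∀ v ∈ Finset.range (L.length + 1), massL ((s, a) :: L) v u = massL L v u := by
      intro v hv
      rw [massL, if_neg (by simp at hv; omega)]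
    rw [Finset.sum_congr rfl this, massL, if_pos rfl]
    by_cases hs : s = u
    · subst hs; simp; ring
    · simp [hs, Ne.symm hs]

lemma massL_card (L : List (T × ℝ)) (u : T) :
    ((Finset.range (L.length + 1)).filter (fun v => massL L v u ≠ 0)).card ≤ cntM L u := by
  induction L with
  | nil => simp [massL]
  | cons e L ih =>
    obtain ⟨s, a⟩ := e
    rw [List.length_cons, Finset.range_add_one, Finset.filter_insert, cntM_cons]
    have h1 : (Finset.range (L.length + 1)).filter (fun v => massL ((s, a) :: L) v u ≠ 0) =
        (Finset.range (L.length + 1)).filter (fun v => massL L v u ≠ 0) := by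
      apply Finset.filter_congr
      intro v hv
      rw [massL, if_neg (by simp at hv; omega)]
    rw [h1]
    by_cases hs : s = u
    · rw [if_pos hs]
      split_ifs
      · exact (Finset.card_insert_le _ _).trans (by omega)
      · omega
    · have : massL ((s, a) :: L) (L.length + 1) u = 0 := by simp [massL, hs]
      simp only [this, ne_eq, not_true_eq_false, if_false, hs]
      omega

lemma gainM_eq (W : (T → ℝ) → T → ℝ) (L : List (T × ℝ)) (z : T → ℝ) (t : T) :
    gainM W L z t = ∑ v ∈ Finset.Icc 1 L.length, massL L v t *
      W (fun u => z u + ∑ l ∈ Finset.range (L.length + 1), if v < l then massL L l u else 0) t := by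
  induction L generalizing z with
  | nil => simp [gainM]
  | cons e L ih =>
    obtain ⟨s, a⟩ := e
    rw [gainM, ih, List.length_cons, Finset.sum_Icc_succ_top (by omega), add_comm]
    congr 1
    · apply Finset.sum_congr rfl
      intro v hv
      rw [Finset.mem_Icc] at hv
      rw [massL, if_neg (by omega)]
      congr 2
      funext u
      rw [Finset.sum_range_succ _ (L.length + 1), if_pos (by omega)]
      have : ∀ l ∈ Finset.range (L.length + 1), (if v < l then massL ((s, a) :: L) l u else 0) =
          if v < l then massL L l u else 0 := by
        intro l hl
        rw [massL, if_neg (c := l = L.length + 1) (by simp at hl; omega)]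
      rw [Finset.sum_congr rfl this, massL, if_pos rfl]
      by_cases hs : s = u
      · subst hs; simp; ring
      · simp [hs, Ne.symm hs]
    · have h0 : (fun u => z u + ∑ l ∈ Finset.range (L.length + 1 + 1),
          if L.length + 1 < l then massL ((s, a) :: L) l u else 0) = z := by
        funext u
        rw [Finset.sum_eq_zero, add_zero]
        intro l hl
        rw [if_neg (by simp at hl; omega)]
      rw [h0, massL, if_pos rfl]
      split_ifs <;> simp

lemma zero_types (W : (T → ℝ) → T → ℝ) (x : T → ℝ) (P : T → Prop)
    (hx : ∀ t, 0 ≤ x t) (hx1 : ∀ t, x t ≤ 1)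
    (hW : ∀ z : T → ℝ, (∀ t, ¬ P t → z t = 0) → ∀ t, P t → x t * W z t = x t) (S : Finset T)
    (hS : ∀ t ∈ S, P t) :
    ∃ L : List (T × ℝ), (∀ e ∈ L, e.1 ∈ S) ∧ (∀ e ∈ L, 0 ≤ e.2) ∧ (∀ t, runM L 0 t ≤ 1) ∧
      (∀ t ∈ S, gainM W L 0 t = x t) ∧ ∀ t ∈ S, cntM L t ≤ 1 := by
  induction S using Finset.induction_on with
  | empty => exact ⟨[], by simp, by simp, by simp [runM], by simp, by simp⟩
  | insert u S hu ih =>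
    obtain ⟨L, h1, h2, h3, h4, h5⟩ := ih (fun t ht => hS t (by simp [ht]))
    have hr0 : ∀ t, t ∉ S → runM L 0 t = 0 := fun t ht => runM_notMem h1 ht 0
    refine ⟨L ++ [(u, x u)], ?_, ?_, ?_, ?_, ?_⟩
    · intro e he
      rcases List.mem_append.1 he with he | he
      · exact Finset.mem_insert_of_mem (h1 e he)
      · simp at he; subst he; simp
    · intro e he
      rcases List.mem_append.1 he with he | he
      · exact h2 e he
      · simp at he; subst he; exact hx u
    · intro t
      rw [runM_append, runM, runM]
      by_cases ht : t = u
      · subst ht; simp [hr0 t hu, hx1]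
      · simp [ht, h3]
    · intro t ht
      rw [gainM_append, gainM, gainM, add_zero]
      by_cases htu : t = u
      · subst htu
        rw [gainM_notMem W h1 hu, if_pos rfl, zero_add]
        apply hW _ _ t (hS t (by simp))
        intro s hs
        exact hr0 s (fun h => hs (hS s (by simp [h])))
      · rw [if_neg (Ne.symm htu), add_zero]
        exact h4 t (by simpa [htu] using ht)
    · intro t ht
      rw [cntM_append]
      by_cases htu : t = u
      · subst htu
        rw [cntM_notMem h1 hu]
        simp [cntM]
      · have := h5 t (by simpa [htu] using ht)
        simpa [cntM, Ne.symm htu] using this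

end Assemble

theorem finite_face_dice_exist
    (n : ℕ) (T : Type) [Fintype T] [DecidableEq T]
    (cand : T → Fin n) (f : T → ℝ)
    (hf0 : ∀ t, 0 ≤ f t)
    (hf1 : ∀ i : Fin n, ∑ t ∈ Finset.univ.filter (fun t => cand t = i), f t = 1)
    (M : Matroid (Fin n)) (hME : M.E = Set.univ)
    (x : T → ℝ) (hx : ∀ t, 0 ≤ x t ∧ x t ≤ 1)
    (hfeas : ∃ A, ImplementsRule cand f (fun S => M.Indep ↑S) A x) :
    ∃ D : T → Measure ℝ, (∀ t, IsProbabilityMeasure (D t)) ∧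
      (∀ t, ∃ F : Finset ℝ, F.card ≤ Fintype.card T + 1 ∧ D t (↑F)ᶜ = 0) ∧
      ∀ t, diceInterim cand f M D t = x t := by
  obtain ⟨A, hA⟩ := hfeas
  set W := WW cand f M with hWdef
  set Z : Finset T := Finset.univ.filter (fun t => f t = 0) with hZ
  set P : Finset T := Finset.univ.filter (fun t => f t ≠ 0) with hP
  -- zero-probability types
  obtain ⟨L0, a1, a2, a3, a4, a5⟩ := zero_types W x (fun t => f t = 0) (fun t => (hx t).1)
    (fun t => (hx t).2) (by
      intro z hz t _
      rw [hWdef, WW_zero cand f hf1 M z (fun t ht => hz t ht)]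
      unfold indW
      split_ifs with hcl
      swap
      · rw [mul_one]
      · rw [mul_zero, ← hA.2.2.2 t]
        symm
        apply Finset.sum_eq_zero
        intro p _
        rw [Finset.sum_eq_zero, mul_zero]
        intro S hS
        by_contra hne
        have hI : M.Indep ↑S := hA.2.2.1 p S hne
        have hmem : cand t ∈ (S : Set (Fin n)) := by simpa using hS
        rw [Finset.erase_empty, Finset.coe_empty] at hcl
        exact hI.notMem_closure_diff_of_mem hmem
          (M.closure_subset_closure (Set.empty_subset _) hcl)) Z
    (fun t ht => by simpa [hZ] using ht)
  set z := runM L0 0 with hz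
  have hz0 : ∀ t, f t ≠ 0 → z t = 0 := by
    intro t ht
    exact runM_notMem a1 (by simpa [hZ] using ht) 0
  obtain ⟨L1, b1, b2, b3, b4, b5⟩ := key (FF cand f M) W f (FF_move cand f M hME)
    (FF_submod cand f hf0 M) P.card P rfl
    (fun t ht => lt_of_le_of_ne (hf0 t) (Ne.symm (by simpa [hP] using ht))) z x
    (fun t => le_runM a2 t 0) a3 (fun t _ => (hx t).1)
    (fun U _ => feas_FF cand f hf0 M x A hA U z hz0)
  set L := L0 ++ L1 with hL
  have hLnn : ∀ e ∈ L, 0 ≤ e.2 := by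
    intro e he
    rcases List.mem_append.1 he with he | he
    · exact a2 e he
    · exact b2 e he
  have hrun : ∀ t, runM L 0 t ≤ 1 := by
    intro t
    rw [hL, runM_append]; exact b3 t
  have hgain : ∀ t, gainM W L 0 t = x t := by
    intro t
    rw [hL, gainM_append]
    by_cases ht : f t = 0
    · rw [a4 t (by simp [hZ, ht]), gainM_notMem W b1 (by simp [hP, ht]), add_zero]
    · rw [gainM_notMem W a1 (by simp [hZ, ht]), zero_add]
      exact b4 t (by simp [hP, ht])
  have hcnt : ∀ t, cntM L t ≤ Fintype.card T := by
    intro t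
    rw [hL, cntM_append]
    by_cases ht : f t = 0
    · have := a5 t (by simp [hZ, ht])
      rw [cntM_notMem b1 (by simp [hP, ht])]
      have : 0 < Fintype.card T := Fintype.card_pos_iff.2 ⟨t⟩
      omega
    · rw [cntM_notMem a1 (by simp [hZ, ht]), zero_add]
      exact (b5 t (by simp [hP, ht])).trans (Finset.card_le_univ P)
  let w : T → ℕ → ℝ := fun u v => if v = 0 then 1 - runM L 0 u else massL L v u
  have hwpos : ∀ u v, 1 ≤ v → w u v = massL L v u := by
    intro u v hv
    simp only [w]
    rw [if_neg (by omega)]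
  have hw : ∀ u v, 0 ≤ w u v := by
    intro u v
    simp only [w]
    split_ifs
    · linarith [hrun u]
    · exact massL_nonneg L hLnn v u
  have hw1 : ∀ u, ∑ v ∈ Finset.range (L.length + 1), w u v = 1 := by
    intro u
    have h := massL_sum L 0 u
    rw [Finset.sum_range_succ', massL_zero] at h
    rw [Finset.sum_range_succ', Finset.sum_congr rfl (fun v _ => hwpos u (v + 1) (by omega))]
    simp only [w, if_true]
    simp only [Pi.zero_apply] at h
    linarith
  refine ⟨fun u => die L.length (w u), fun u => die_prob _ _ (hw u) (hw1 u), fun u =>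
    ⟨dieSupp L.length (w u), ?_, die_supp _ _ (hw u)⟩, fun t => ?_⟩
  · refine Finset.card_image_le.trans ?_
    have hsub : ((Finset.range (L.length + 1)).filter (fun v => w u v ≠ 0)) ⊆
        insert 0 ((Finset.range (L.length + 1)).filter (fun v => massL L v u ≠ 0)) := by
      intro v hv
      simp only [Finset.mem_filter, Finset.mem_insert] at hv ⊢
      rcases Nat.eq_zero_or_pos v with h | h
      · exact Or.inl h
      · right
        rw [hwpos u v h] at hv
        exact hv
    have h1 := (Finset.card_le_card hsub).trans (Finset.card_insert_le _ _)
    have h2 := massL_card L u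
    have h3 := hcnt u
    convert h1.trans (Nat.succ_le_succ (h2.trans h3)) using 2
  · rw [diceInterim_die cand f M hME L.length w hw hw1, ← hgain t, gainM_eq]
    · apply Finset.sum_congr rfl
      intro v hv
      rw [hwpos t v (Finset.mem_Icc.1 hv).1]
      congr 2
      funext u
      rw [Pi.zero_apply, zero_add]
      apply Finset.sum_congr rfl
      intro l _
      split_ifs with h
      · exact hwpos u l (by omega)
      · rfl
    · intro t u htu v hv
      rw [hwpos t v hv, hwpos u v hv]
      exact massL_tie L v t u htu

end Stmt0
end

section
/- Let M be a matroid and x a feasible interim rule within the winner-selection environment (f, M). Then there exist winner-selecting dice, i.e., Borel probability distributions over ℝ (one per type), whose induced dice-based winner-selection rule implements x in (f, M). -/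
/-!
Statement 1: For every matroid winner-selection environment `(f, M)` and every interim
rule `x` that is feasible within it, there exist winner-selecting dice (Borel probability
distributions on ℝ, one per type) whose induced dice-based winner-selection rule
implements `x` in `(f, M)`.

Formalization conventions:
* Candidates are `Fin n`; all types (of all candidates) form the finite type `T`, and
  `cand t` is the candidate owning type `t` (type sets of distinct candidates are disjoint
  by construction).
* `f : T → ℝ` is the prior: for each candidate, the probabilities of its types sum to `1`.
* A type profile is `p : Fin n → T` with `cand (p i) = i` for all `i`; its prior weight is
  `∏ j, f (p j)` (types drawn independently).
* A randomized winner-selection rule is `A : (Fin n → T) → Finset (Fin n) → ℝ` giving, for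
  each profile, a distribution over winner sets; it must be supported on independent sets
  of the matroid `M`.
* The dice-based rule: every candidate rolls its realized type's die independently, and
  winners are selected greedily in decreasing order of score (ties broken uniformly at
  random, realized here by averaging over a uniformly random permutation used as a
  tie-breaker), adding a candidate while its score is positive and the set stays
  independent in `M`.  By the standard greedy characterization, candidate `i` wins iff its
  score is positive and `i` is not spanned by the higher-ranked positive-score candidates.
-/

open MeasureTheory Finset

namespace Stmt1

variable {n : ℕ} {T : Type} [Fintype T] [DecidableEq T]

/-- Greedy winning predicate with permutation tie-breaking: `i` is selected iff it is in
the ground set, has positive score, and is not spanned by the positive-score candidates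
preceding it in the order "higher score first, ties broken by `π`". -/
def Wins (M : Matroid (Fin n)) (s : Fin n → ℝ) (π : Equiv.Perm (Fin n)) (i : Fin n) : Prop :=
  i ∈ M.E ∧ 0 < s i ∧
    i ∉ M.closure {j | 0 < s j ∧ (s i < s j ∨ (s i = s j ∧ π i < π j))}

/-- Probability that candidate `i` wins, when candidate `j` rolls the die `d j`
(all rolls independent) and ties are broken uniformly at random. -/
noncomputable def winProb (M : Matroid (Fin n)) (d : Fin n → Measure ℝ) (i : Fin n) : ℝ :=
  (∑ π : Equiv.Perm (Fin n), ((Measure.pi d) {s | Wins M s π i}).toReal) / (Nat.factorial n)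

/-- Valid type profiles. -/
def profiles (cand : T → Fin n) : Finset (Fin n → T) :=
  Finset.univ.filter fun p => ∀ i, cand (p i) = i

/-- Conditional probability that type `t` wins under the dice-based rule, given that the
candidate `cand t` has realized type `t`. -/
noncomputable def diceInterim (cand : T → Fin n) (f : T → ℝ) (M : Matroid (Fin n))
    (D : T → Measure ℝ) (t : T) : ℝ :=
  ∑ p ∈ (profiles cand).filter (fun p => p (cand t) = t),
    (∏ j ∈ Finset.univ.erase (cand t), f (p j)) * winProb M (fun j => D (p j)) (cand t)

/-- `A` is a winner-selection rule with feasible sets `Feas` implementing the interim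
rule `x` for the prior `f`. -/
def ImplementsRule (cand : T → Fin n) (f : T → ℝ) (Feas : Finset (Fin n) → Prop)
    (A : (Fin n → T) → Finset (Fin n) → ℝ) (x : T → ℝ) : Prop :=
  (∀ p S, 0 ≤ A p S) ∧ (∀ p, ∑ S : Finset (Fin n), A p S = 1) ∧
  (∀ p S, A p S ≠ 0 → Feas S) ∧
  ∀ t : T, ∑ p ∈ (profiles cand).filter (fun p => p (cand t) = t),
      (∏ j ∈ Finset.univ.erase (cand t), f (p j)) *
        (∑ S ∈ Finset.univ.filter (fun S : Finset (Fin n) => cand t ∈ S), A p S) = x t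

open Classical in
theorem greedy_aux (M : Matroid (Fin n)) (hME : M.E = Set.univ) (s : Fin n → ℝ)
    (π : Equiv.Perm (Fin n)) (P : Finset (Fin n)) :
    (∀ j ∈ P, 0 < s j) → (∀ j ∈ P, ∀ k, 0 < s k → toLex (s j, π j) < toLex (s k, π k) → k ∈ P) →
    M.Indep (P.filter (fun i => Wins M s π i) : Set (Fin n)) ∧
    (P : Set (Fin n)) ⊆ M.closure (P.filter (fun i => Wins M s π i) : Set (Fin n)) ∧
    ∀ I : Finset (Fin n), M.Indep (I : Set (Fin n)) → ∀ m : ℝ, (∀ j ∈ P, m ≤ s j) →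
      ∑ i ∈ P.filter (fun i => i ∈ I), (s i - m) ≤
        ∑ i ∈ P.filter (fun i => Wins M s π i), (s i - m) := by
  induction P using Finset.induction_on_min_value (fun j => toLex (s j, π j)) with
  | empty => simp
  | insert a P haP hmin ih =>
    intro hpos hup
    have hlt : ∀ x ∈ P, toLex (s a, π a) < toLex (s x, π x) := by
      intro x hx
      refine lt_of_le_of_ne (hmin x hx) ?_
      intro h
      have h2 : π a = π x := congrArg (fun z => (ofLex z).2) h
      exact haP (π.injective h2 ▸ hx)
    obtain ⟨h1, h2, h3⟩ := ih (fun j hj => hpos j (Finset.mem_insert_of_mem hj)) (by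
      intro j hj k hk hjk
      rcases Finset.mem_insert.1 (hup j (Finset.mem_insert_of_mem hj) k hk hjk) with h | h
      · subst h; exact absurd hjk (not_lt.2 (hmin j hj))
      · exact h)
    have hpred : {j | 0 < s j ∧ (s a < s j ∨ (s a = s j ∧ π a < π j))} = (P : Set (Fin n)) := by
      ext k
      have : (s a < s k ∨ (s a = s k ∧ π a < π k)) ↔ toLex (s a, π a) < toLex (s k, π k) := by
        rw [Prod.Lex.toLex_lt_toLex]
      simp only [Set.mem_ofPred_eq, this, Finset.mem_coe]
      constructor
      · rintro ⟨hk, hak⟩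
        rcases Finset.mem_insert.1 (hup a (Finset.mem_insert_self _ _) k hk hak) with h | h
        · subst h; exact absurd hak (lt_irrefl _)
        · exact h
      · intro hk
        exact ⟨hpos k (Finset.mem_insert_of_mem hk), hlt k hk⟩
    have hW : Wins M s π a ↔ a ∉ M.closure (P : Set (Fin n)) := by
      unfold Wins
      rw [hpred]
      simp [hME, hpos a (Finset.mem_insert_self _ _)]
    have hcl : M.closure (P : Set (Fin n)) ⊆
        M.closure (P.filter (fun i => Wins M s π i) : Set (Fin n)) :=
      M.closure_subset_closure_of_subset_closure h2
    have hcl' : M.closure (P.filter (fun i => Wins M s π i) : Set (Fin n)) ⊆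
        M.closure (P : Set (Fin n)) :=
      M.closure_subset_closure (Finset.coe_subset.2 (Finset.filter_subset _ _))
    have hsub : (P.filter (fun i => Wins M s π i) : Set (Fin n)) ⊆
        ((insert a P).filter (fun i => Wins M s π i) : Set (Fin n)) := by
      intro z; simp; tauto
    have hI : M.Indep ((insert a P).filter (fun i => Wins M s π i) : Set (Fin n)) := by
      by_cases hw : Wins M s π a
      · rw [Finset.filter_insert, if_pos hw, Finset.coe_insert]
        rw [h1.insert_indep_iff]
        left
        refine ⟨by simp [hME], fun h => hW.1 hw (hcl' h)⟩
      · rw [Finset.filter_insert, if_neg hw]; exact h1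
    have hS : ((insert a P : Finset (Fin n)) : Set (Fin n)) ⊆
        M.closure ((insert a P).filter (fun i => Wins M s π i) : Set (Fin n)) := by
      rw [Finset.coe_insert]
      apply Set.insert_subset
      · by_cases hw : Wins M s π a
        · exact M.mem_closure_of_mem' (by simp [hw]) (by simp [hME])
        · have := not_not.1 (fun h => hw (hW.2 h))
          exact M.closure_subset_closure hsub (hcl this)
      · exact h2.trans (M.closure_subset_closure hsub)
    refine ⟨hI, hS, ?_⟩
    intro I hIi m hm
    have hcard : ((insert a P).filter (fun i => i ∈ I)).card ≤
        ((insert a P).filter (fun i => Wins M s π i)).card := by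
      have e1 : M.Indep ((insert a P).filter (fun i => i ∈ I) : Set (Fin n)) :=
        hIi.subset (by intro z; simp)
      have e2 : ((insert a P).filter (fun i => i ∈ I) : Set (Fin n)) ⊆
          M.closure ((insert a P).filter (fun i => Wins M s π i) : Set (Fin n)) :=
        Set.Subset.trans (by intro z; simp; tauto) hS
      have e3 := M.eRk_mono e2
      rw [e1.eRk_eq_encard, M.eRk_closure_eq] at e3
      have e4 := e3.trans (M.eRk_le_encard _)
      simpa only [Set.encard_coe_eq_coe_finsetCard, Nat.cast_le] using e4
    have key := h3 I hIi (s a) (by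
      intro j hj
      rcases Prod.Lex.toLex_lt_toLex.1 (hlt j hj) with h | h
      · exact h.le
      · exact h.1.le)
    have key2 : ∑ i ∈ (insert a P).filter (fun i => i ∈ I), (s i - s a) ≤
        ∑ i ∈ (insert a P).filter (fun i => Wins M s π i), (s i - s a) := by
      rw [Finset.sum_filter, Finset.sum_filter] at key ⊢
      rw [Finset.sum_insert haP, Finset.sum_insert haP]
      simpa using key
    have hma := hm a (Finset.mem_insert_self _ _)
    have hc : (((insert a P).filter (fun i => i ∈ I)).card : ℝ) ≤
        ((insert a P).filter (fun i => Wins M s π i)).card := by exact_mod_cast hcard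
    simp only [Finset.sum_sub_distrib, Finset.sum_const, nsmul_eq_mul] at key2 ⊢
    nlinarith

open Classical in
/-- Greedy value. -/
noncomputable def gval (M : Matroid (Fin n)) (π : Equiv.Perm (Fin n)) (s : Fin n → ℝ) : ℝ :=
  ∑ i, if Wins M s π i then s i else 0

theorem Wins.pos' {M : Matroid (Fin n)} {s : Fin n → ℝ} {π : Equiv.Perm (Fin n)} {i : Fin n}
    (h : Wins M s π i) : 0 < s i := h.2.1

open Classical in
theorem greedy_opt (M : Matroid (Fin n)) (hME : M.E = Set.univ) (s : Fin n → ℝ)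
    (π : Equiv.Perm (Fin n)) (I : Finset (Fin n)) (hI : M.Indep (I : Set (Fin n))) :
    ∑ i ∈ I, s i ≤ gval M π s := by
  obtain ⟨-, -, h⟩ := greedy_aux M hME s π (Finset.univ.filter (fun i => 0 < s i)) (by simp)
    (by intro j _ k hk _; simpa using hk)
  have := h I hI 0 (by intro j hj; exact (Finset.mem_filter.1 hj).2.le)
  simp only [sub_zero, Finset.filter_filter] at this
  unfold gval
  rw [← Finset.sum_filter]
  have e : (Finset.univ.filter (fun i => 0 < s i ∧ Wins M s π i)) =
      Finset.univ.filter (fun i => Wins M s π i) := by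
    ext i; simp only [Finset.mem_filter, Finset.mem_univ, true_and, and_iff_right_iff_imp]
    exact fun h => h.pos'
  rw [e] at this
  refine le_trans ?_ this
  have e2 : (Finset.univ.filter (fun i => 0 < s i ∧ i ∈ I)) = I.filter (fun i => 0 < s i) := by
    ext i; simp; tauto
  rw [e2, Finset.sum_filter]
  apply Finset.sum_le_sum
  intro i _
  split_ifs with h
  · exact le_rfl
  · exact not_lt.1 h

open Classical in
theorem wins_indep (M : Matroid (Fin n)) (hME : M.E = Set.univ) (s : Fin n → ℝ)
    (π : Equiv.Perm (Fin n)) :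
    M.Indep ((Finset.univ.filter (fun i => Wins M s π i) : Finset (Fin n)) : Set (Fin n)) := by
  obtain ⟨h, -, -⟩ := greedy_aux M hME s π (Finset.univ.filter (fun i => 0 < s i)) (by simp)
    (by intro j _ k hk _; simpa using hk)
  refine h.subset ?_
  intro i hi
  have hi' : Wins M s π i := by simpa using hi
  simp [hi', hi'.pos']

open Classical in
theorem gval_sub (M : Matroid (Fin n)) (hME : M.E = Set.univ) (s s' : Fin n → ℝ)
    (π : Equiv.Perm (Fin n)) :
    gval M π s' + ∑ i, (if Wins M s' π i then (s i - s' i) else 0) ≤ gval M π s := by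
  refine le_trans (le_of_eq ?_) (greedy_opt M hME s π _ (wins_indep M hME s' π))
  unfold gval
  rw [← Finset.sum_add_distrib, Finset.sum_filter]
  apply Finset.sum_congr rfl
  intro i _
  split_ifs <;> ring

theorem abstract_min {ι : Type} [Fintype ι] (Φ : (ι → ℝ) → ℝ) (G : (ι → ℝ) → ι → ℝ)
    (y : ι → ℝ) (hG : Continuous G)
    (ha : ∀ θ θ', Φ θ' + ∑ t, G θ' t * (θ t - θ' t) ≤ Φ θ)
    (hb : ∀ θ, ∑ t, y t * θ t ≤ Φ θ) (η : ℝ) (hη : 0 < η) :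
    ∃ θ, ∀ t, |G θ t - y t| ≤ η := by
  classical
  have hΦ0 : 0 ≤ Φ 0 := by simpa using hb 0
  have hGt : ∀ t, Continuous fun θ => G θ t := fun t => (continuous_apply t).comp hG
  have hΦ : Continuous Φ := by
    rw [continuous_iff_continuousAt]
    intro θ₀
    have l1 : Filter.Tendsto (fun θ => Φ θ₀ + ∑ t, G θ₀ t * (θ t - θ₀ t)) (nhds θ₀)
        (nhds (Φ θ₀)) := by
      have : Continuous (fun θ : ι → ℝ => Φ θ₀ + ∑ t, G θ₀ t * (θ t - θ₀ t)) := by fun_prop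
      simpa using this.tendsto θ₀
    have l2 : Filter.Tendsto (fun θ => Φ θ₀ - ∑ t, G θ t * (θ₀ t - θ t)) (nhds θ₀)
        (nhds (Φ θ₀)) := by
      have : Continuous (fun θ : ι → ℝ => Φ θ₀ - ∑ t, G θ t * (θ₀ t - θ t)) := by fun_prop
      simpa using this.tendsto θ₀
    refine tendsto_of_tendsto_of_tendsto_of_le_of_le l1 l2 ?_ ?_
    · intro θ; exact ha θ θ₀
    · intro θ; have := ha θ₀ θ; simp only; linarith
  set δ : ℝ := η ^ 2 / (2 * (Φ 0 + 1)) with hδ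
  have hδ0 : 0 < δ := by positivity
  let Ψ : (ι → ℝ) → ℝ := fun θ => Φ θ - ∑ t, y t * θ t + δ / 2 * ∑ t, θ t ^ 2
  have hΨ : Continuous Ψ := by fun_prop
  have hlow : ∀ θ, δ / 2 * ∑ t, θ t ^ 2 ≤ Ψ θ := by
    intro θ; have := hb θ; simp only [Ψ]; linarith
  have hΨ0 : Ψ 0 = Φ 0 := by simp [Ψ]
  -- minimize
  obtain ⟨θ₀, hmin⟩ : ∃ θ₀, ∀ θ, Ψ θ₀ ≤ Ψ θ := by
    set R : ℝ := Φ 0 * (2 / δ) + 1 with hR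
    have hR1 : 1 ≤ R := by have : 0 ≤ Φ 0 * (2 / δ) := by positivity
                           linarith
    obtain ⟨θ₀, h0, hm⟩ := (isCompact_closedBall (0 : ι → ℝ) R).exists_isMinOn
      ⟨0, by simp; linarith⟩ hΨ.continuousOn
    refine ⟨θ₀, fun θ => ?_⟩
    by_cases hθ : θ ∈ Metric.closedBall (0 : ι → ℝ) R
    · exact hm hθ
    · have h00 : Ψ θ₀ ≤ Ψ 0 := hm (by simp; linarith)
      have hn : R < ‖θ‖ := by simpa using hθ
      obtain ⟨t, ht⟩ : ∃ t, R < ‖θ t‖ := by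
        by_contra! hcon
        exact absurd ((pi_norm_le_iff_of_nonneg (by linarith)).2 hcon) (not_le.2 hn)
      have h1 : R ≤ θ t ^ 2 := by
        rw [Real.norm_eq_abs] at ht
        rw [← sq_abs]; nlinarith
      have h2 : θ t ^ 2 ≤ ∑ t, θ t ^ 2 :=
        Finset.single_le_sum (f := fun t => θ t ^ 2) (fun i _ => sq_nonneg _) (Finset.mem_univ t)
      have h3 := hlow θ
      have h4 : δ / 2 * R ≤ δ / 2 * ∑ t, θ t ^ 2 := by gcongr; linarith
      have h5 : δ / 2 * R = Φ 0 + δ / 2 := by rw [hR]; field_simp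
      linarith
  have hfoc : ∀ t, ∀ σ : ℝ, 0 ≤ σ * (G θ₀ t - y t + δ * θ₀ t) := by
    intro t σ
    have hlim : Filter.Tendsto (fun h : ℝ => σ * (G (θ₀ + h • Pi.single t σ) t - y t + δ * θ₀ t)
        + δ / 2 * σ ^ 2 * h) (nhdsWithin 0 (Set.Ioi 0))
        (nhds (σ * (G θ₀ t - y t + δ * θ₀ t))) := by
      have hc : Continuous (fun h : ℝ => σ * (G (θ₀ + h • Pi.single t σ) t - y t + δ * θ₀ t)
        + δ / 2 * σ ^ 2 * h) := by fun_prop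
      have := (hc.tendsto 0).mono_left (nhdsWithin_le_nhds (s := Set.Ioi 0))
      simpa using this
    refine ge_of_tendsto hlim ?_
    filter_upwards [self_mem_nhdsWithin] with h hh
    have hh0 : (0 : ℝ) < h := hh
    set θ := θ₀ + h • (Pi.single t σ : ι → ℝ) with hθ
    have e1 := ha θ₀ θ
    have e2 := hmin θ
    have eθ : ∀ k, θ k = θ₀ k + (if k = t then h * σ else 0) := by
      intro k; simp [hθ, Pi.single_apply]
    have s1 : ∑ k, G θ k * (θ₀ k - θ k) = - (G θ t * (h * σ)) := by
      simp [eθ]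
    have s2 : ∑ k, y k * θ k = ∑ k, y k * θ₀ k + y t * (h * σ) := by
      simp [eθ, mul_add, Finset.sum_add_distrib]
    have s3 : ∑ k, θ k ^ 2 = ∑ k, θ₀ k ^ 2 + (2 * θ₀ t * (h * σ) + (h * σ) ^ 2) := by
      have : ∀ k, θ k ^ 2 = θ₀ k ^ 2 + (if k = t then 2 * θ₀ t * (h * σ) + (h * σ) ^ 2 else 0) := by
        intro k; rw [eθ]; split_ifs with hk
        · subst hk; ring
        · ring
      simp [this, Finset.sum_add_distrib]
    simp only [Ψ] at e2
    rw [s2, s3] at e2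
    rw [s1] at e1
    have : 0 ≤ h * (σ * (G θ t - y t + δ * θ₀ t) + δ / 2 * σ ^ 2 * h) := by nlinarith
    exact nonneg_of_mul_nonneg_right this hh0
  refine ⟨θ₀, fun t => ?_⟩
  have p1 := hfoc t 1
  have p2 := hfoc t (-1)
  have e : G θ₀ t - y t = -(δ * θ₀ t) := by linarith
  rw [e, abs_neg]
  refine abs_le_of_sq_le_sq ?_ hη.le
  have h2 : θ₀ t ^ 2 ≤ ∑ t, θ₀ t ^ 2 :=
    Finset.single_le_sum (f := fun t => θ₀ t ^ 2) (fun i _ => sq_nonneg _) (Finset.mem_univ t)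
  have h3 := hlow θ₀
  have h4 := hmin 0
  rw [hΨ0] at h4
  have h5 : δ / 2 * θ₀ t ^ 2 ≤ Φ 0 := by nlinarith
  have h6 : δ * (2 * (Φ 0 + 1)) = η ^ 2 := by rw [hδ]; field_simp
  nlinarith

theorem compress {ι : Type} [Fintype ι] (θ : ι → ℝ) :
    ∃ θ' : ι → ℝ, (∀ k, 0 ≤ θ' k ∧ θ' k ≤ 2 * Fintype.card ι) ∧
      ∀ a b, θ a ≤ θ b → (θ' b - θ' a = θ b - θ a) ∨ (2 ≤ θ b - θ a ∧ 2 ≤ θ' b - θ' a) := by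
  let S : Set ℝ := ⋃ k, Set.Ioc (θ k) (θ k + 2)
  have hSm : MeasurableSet S := MeasurableSet.iUnion fun k => measurableSet_Ioc
  have hSv : volume S ≤ ENNReal.ofReal (2 * Fintype.card ι) := by
    refine (measure_iUnion_fintype_le _ _).trans ?_
    simp [Real.volume_Ioc]
    rw [mul_comm]
  have hfin : ∀ A, A ⊆ S → volume A ≠ ⊤ := fun A hA =>
    ne_top_of_le_ne_top ENNReal.ofReal_ne_top ((measure_mono hA).trans hSv)
  have hdiff : ∀ a b : ι, θ a ≤ θ b → (volume (S ∩ Set.Iic (θ b))).toReal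
      - (volume (S ∩ Set.Iic (θ a))).toReal = (volume (S ∩ Set.Ioc (θ a) (θ b))).toReal := by
    intro a b hab
    have : S ∩ Set.Iic (θ b) = (S ∩ Set.Iic (θ a)) ∪ (S ∩ Set.Ioc (θ a) (θ b)) := by
      rw [← Set.inter_union_distrib_left, Set.Iic_union_Ioc_eq_Iic hab]
    rw [this, measure_union _ (hSm.inter measurableSet_Ioc),
      ENNReal.toReal_add (hfin _ Set.inter_subset_left) (hfin _ Set.inter_subset_left)]
    · ring
    · rw [Set.disjoint_left]
      rintro z ⟨_, hz⟩ ⟨_, hz2⟩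
      exact absurd hz (not_le.2 hz2.1)
  refine ⟨fun k => (volume (S ∩ Set.Iic (θ k))).toReal, ?_, ?_⟩
  · intro k
    refine ⟨ENNReal.toReal_nonneg, ?_⟩
    exact ENNReal.toReal_le_of_le_ofReal (by positivity)
      ((measure_mono Set.inter_subset_left).trans hSv)
  · intro a b hab
    simp only
    rw [hdiff a b hab]
    by_cases h2 : θ b - θ a ≤ 2
    · left
      have : S ∩ Set.Ioc (θ a) (θ b) = Set.Ioc (θ a) (θ b) := by
        apply Set.inter_eq_self_of_subset_right
        intro z hz
        exact Set.mem_iUnion.2 ⟨a, hz.1, by linarith [hz.2]⟩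
      rw [this, Real.volume_Ioc, ENNReal.toReal_ofReal (by linarith)]
    · right
      refine ⟨by linarith, ?_⟩
      have hsub : Set.Ioc (θ a) (θ a + 2) ⊆ S ∩ Set.Ioc (θ a) (θ b) := by
        intro z hz
        exact ⟨Set.mem_iUnion.2 ⟨a, hz⟩, hz.1, by linarith [hz.2]⟩
      have := ENNReal.toReal_mono (hfin _ Set.inter_subset_left) (measure_mono (μ := volume) hsub)
      rw [Real.volume_Ioc, ENNReal.toReal_ofReal (by linarith)] at this
      linarith

theorem wins_congr (M : Matroid (Fin n)) (s s' : Fin n → ℝ) (π : Equiv.Perm (Fin n)) (i : Fin n)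
    (h0 : ∀ j, 0 < s j ↔ 0 < s' j) (h1 : ∀ j k, s j < s k ↔ s' j < s' k) :
    Wins M s π i ↔ Wins M s' π i := by
  have h2 : ∀ j k, s j = s k ↔ s' j = s' k := by
    intro j k
    have a := h1 j k
    have b := h1 k j
    constructor
    · intro h
      exact le_antisymm (not_lt.1 fun h' => by have := b.2 h'; linarith)
        (not_lt.1 fun h' => by have := a.2 h'; linarith)
    · intro h
      exact le_antisymm (not_lt.1 fun h' => by have := b.1 h'; linarith)
        (not_lt.1 fun h' => by have := a.1 h'; linarith)
  unfold Wins
  simp only [h0, h1, h2]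

theorem measurableSet_wins (M : Matroid (Fin n)) (π : Equiv.Perm (Fin n)) (i : Fin n) :
    MeasurableSet {s : Fin n → ℝ | Wins M s π i} := by
  classical
  have hb : ∀ j, MeasurableSet {s : Fin n → ℝ | 0 < s j ∧ (s i < s j ∨ (s i = s j ∧ π i < π j))} := by
    intro j
    refine (measurableSet_lt measurable_const (measurable_pi_apply j)).inter
      ((measurableSet_lt (measurable_pi_apply i) (measurable_pi_apply j)).union
      ((measurableSet_eq_fun (measurable_pi_apply i) (measurable_pi_apply j)).inter
        (MeasurableSet.const _)))
  have : {s : Fin n → ℝ | Wins M s π i} = {s | 0 < s i} ∩ ⋃ R : {R : Set (Fin n) // i ∈ M.E ∧ i ∉ M.closure R},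
      ⋂ j, {s | (0 < s j ∧ (s i < s j ∨ (s i = s j ∧ π i < π j))) ↔ j ∈ R.1} := by
    ext s
    simp only [Set.mem_ofPred_eq, Set.mem_inter_iff, Set.mem_iUnion, Set.mem_iInter]
    constructor
    · rintro ⟨h1, h2, h3⟩
      exact ⟨h2, ⟨_, h1, h3⟩, fun j => Iff.rfl⟩
    · rintro ⟨h2, ⟨R, h1, h3⟩, h⟩
      refine ⟨h1, h2, ?_⟩
      convert h3
      ext j
      exact h j
  rw [this]
  refine (measurableSet_lt measurable_const (measurable_pi_apply i)).inter
    (MeasurableSet.iUnion fun R => MeasurableSet.iInter fun j => ?_)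
  by_cases hj : j ∈ R.1
  · simpa [hj] using hb j
  · simp only [hj, iff_false]
    exact (hb j).compl

theorem level_null (φ : (Fin n → ℝ) →ₗ[ℝ] ℝ) (hφ : φ ≠ 0) (a : ℝ) :
    volume {u | φ u = a} = 0 := by
  by_cases hne : ∃ u₀, φ u₀ = a
  · obtain ⟨u₀, hu₀⟩ := hne
    have h := Measure.addHaar_affineSubspace (volume : Measure (Fin n → ℝ))
      (AffineSubspace.mk' u₀ (LinearMap.ker φ)) (by
        intro h
        have h2 := congrArg AffineSubspace.direction h
        rw [AffineSubspace.direction_mk', AffineSubspace.direction_top] at h2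
        exact hφ (LinearMap.ker_eq_top.1 h2))
    convert h using 2
    ext u
    simp [AffineSubspace.mem_mk', sub_eq_zero, hu₀]
  · have : {u | φ u = a} = ∅ := by
      ext u; simp; exact fun h => hne ⟨u, h⟩
    rw [this]; simp

open Classical in
/-- Winning probability with uniform noise. -/
noncomputable def qq (M : Matroid (Fin n)) (π : Equiv.Perm (Fin n)) (i : Fin n)
    (c : Fin n → ℝ) : ℝ :=
  ∫ u in Set.Icc (0 : Fin n → ℝ) 1, if Wins M (u + c) π i then (1 : ℝ) else 0

theorem meas_shift (M : Matroid (Fin n)) (π : Equiv.Perm (Fin n)) (i : Fin n) (c : Fin n → ℝ) :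
    MeasurableSet {u : Fin n → ℝ | Wins M (u + c) π i} :=
  (measurableSet_wins M π i).preimage (measurable_id.add_const c)

theorem noise_finite : IsFiniteMeasure ((volume : Measure (Fin n → ℝ)).restrict (Set.Icc 0 1)) :=
  ⟨by simpa using (isCompact_Icc (a := (0 : Fin n → ℝ)) (b := 1)).measure_lt_top⟩

theorem qq_continuous (M : Matroid (Fin n)) (π : Equiv.Perm (Fin n)) (i : Fin n) :
    Continuous (qq M π i) := by
  classical
  have := noise_finite (n := n)
  rw [continuous_iff_continuousAt]
  intro c
  refine MeasureTheory.continuousAt_of_dominated (bound := fun _ => 1) ?_ ?_ (integrable_const _) ?_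
  · refine Filter.Eventually.of_forall fun c' => ?_
    exact (Measurable.ite (meas_shift M π i c') measurable_const measurable_const).aestronglyMeasurable
  · refine Filter.Eventually.of_forall fun c' => Filter.Eventually.of_forall fun u => ?_
    split_ifs <;> simp
  · apply ae_restrict_of_ae
    have g1 : ∀ j : Fin n, ∀ᵐ u : Fin n → ℝ, u j + c j ≠ 0 := by
      intro j
      have := level_null (LinearMap.proj j : (Fin n → ℝ) →ₗ[ℝ] ℝ) (by
        intro h
        have := LinearMap.congr_fun h (Pi.single j 1)
        simp at this) (- c j)
      rw [ae_iff]
      convert this using 2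
      ext u; simp [add_eq_zero_iff_eq_neg]
    have g2 : ∀ j k : Fin n, ∀ᵐ u : Fin n → ℝ, j ≠ k → u j + c j ≠ u k + c k := by
      intro j k
      by_cases hjk : j = k
      · simp [hjk]
      have := level_null ((LinearMap.proj j : (Fin n → ℝ) →ₗ[ℝ] ℝ) -
        (LinearMap.proj k : (Fin n → ℝ) →ₗ[ℝ] ℝ)) (by
        intro h
        have := LinearMap.congr_fun h (Pi.single j 1)
        rw [LinearMap.sub_apply, LinearMap.proj_apply, LinearMap.proj_apply] at this
        simp [Ne.symm hjk] at this) (c k - c j)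
      rw [ae_iff]
      convert this using 2
      ext u
      simp only [hjk, ne_eq, not_false_eq_true, forall_const, not_not, Set.mem_ofPred_eq,
        LinearMap.sub_apply, LinearMap.proj_apply]
      constructor <;> intro h <;> linarith
    filter_upwards [ae_all_iff.2 g1, ae_all_iff.2 fun j => ae_all_iff.2 (g2 j)] with u h1 h2
    have hev : ∀ᶠ c' in nhds c, (if Wins M (u + c') π i then (1 : ℝ) else 0) =
        if Wins M (u + c) π i then 1 else 0 := by
      have ct : ∀ j, Continuous fun c' : Fin n → ℝ => u j + c' j := fun j => by fun_prop
      have k1 : ∀ j, ∀ᶠ c' : Fin n → ℝ in nhds c, (0 < u j + c' j ↔ 0 < u j + c j) := by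
        intro j
        rcases lt_or_gt_of_ne (h1 j) with h | h
        · filter_upwards [(ct j).continuousAt.eventually_lt_const h] with c' hc'
          constructor <;> intro <;> linarith
        · filter_upwards [(ct j).continuousAt.eventually_const_lt h] with c' hc'
          constructor <;> intro <;> linarith
      have k2 : ∀ j k, ∀ᶠ c' : Fin n → ℝ in nhds c,
          (u j + c' j < u k + c' k ↔ u j + c j < u k + c k) := by
        intro j k
        by_cases hjk : j = k
        · subst hjk; simp
        rcases lt_or_gt_of_ne (h2 j k hjk) with h | h
        · filter_upwards [(ct j).continuousAt.eventually_lt (ct k).continuousAt h] with c' hc'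
          constructor <;> intro <;> linarith
        · filter_upwards [(ct k).continuousAt.eventually_lt (ct j).continuousAt h] with c' hc'
          constructor <;> intro <;> linarith
      filter_upwards [Filter.eventually_all.2 k1,
        Filter.eventually_all.2 fun j => Filter.eventually_all.2 (k2 j)] with c' hc1 hc2
      have := wins_congr M (u + c') (u + c) π i (by simpa using hc1) (by simpa using hc2)
      simp only [this]
    exact continuousAt_const.congr (hev.mono fun _ h => h.symm)

/-- The dice. -/
noncomputable def die (a : ℝ) : Measure ℝ :=
  ((volume : Measure ℝ).restrict (Set.Icc 0 1)).map (fun z => z + a)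

theorem die_prob (a : ℝ) : IsProbabilityMeasure (die a) := by
  have : IsProbabilityMeasure ((volume : Measure ℝ).restrict (Set.Icc 0 1)) := ⟨by simp⟩
  exact Measure.isProbabilityMeasure_map (by fun_prop)

theorem pi_die (M : Matroid (Fin n)) (π : Equiv.Perm (Fin n)) (i : Fin n) (c : Fin n → ℝ) :
    ((Measure.pi fun j => die (c j)) {s | Wins M s π i}).toReal = qq M π i c := by
  classical
  have : ∀ a, IsProbabilityMeasure (((volume : Measure ℝ).restrict (Set.Icc 0 1)).map (fun z => z + a)) :=
    die_prob
  unfold die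
  rw [← Measure.pi_map_pi (μ := fun _ : Fin n => (volume : Measure ℝ).restrict (Set.Icc 0 1))
    (f := fun j z => z + c j) (fun j => by fun_prop)]
  rw [Measure.map_apply (by fun_prop) (measurableSet_wins M π i), ← Measure.restrict_pi_pi]
  have e : (Set.univ.pi fun _ : Fin n => Set.Icc (0 : ℝ) 1) = Set.Icc (0 : Fin n → ℝ) 1 := by
    rw [← Set.pi_univ_Icc]; rfl
  rw [e, ← volume_pi]
  unfold qq
  have : (fun u : Fin n → ℝ => if Wins M (u + c) π i then (1 : ℝ) else 0) =
      Set.indicator {u | Wins M (u + c) π i} (fun _ => 1) := by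
    ext u; simp [Set.indicator_apply]
  rw [this, integral_indicator (meas_shift M π i c)]
  simp [Measure.real]
  rfl

theorem qq_compress (M : Matroid (Fin n)) (π : Equiv.Perm (Fin n)) (i : Fin n) (c c' : Fin n → ℝ)
    (h0 : ∀ j, c' j = c j ∨ (2 ≤ c j ∧ 2 ≤ c' j) ∨ (c j ≤ -2 ∧ c' j ≤ -2))
    (h1 : ∀ j k, c' j - c' k = c j - c k ∨ (2 ≤ c j - c k ∧ 2 ≤ c' j - c' k) ∨
      (c j - c k ≤ -2 ∧ c' j - c' k ≤ -2)) :
    qq M π i c = qq M π i c' := by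
  classical
  unfold qq
  apply setIntegral_congr_fun measurableSet_Icc
  intro u hu
  have hu0 : ∀ j, 0 ≤ u j := fun j => hu.1 j
  have hu1 : ∀ j, u j ≤ 1 := fun j => hu.2 j
  have := wins_congr M (u + c) (u + c') π i (by
      intro j
      have a := hu0 j
      have b := hu1 j
      simp only [Pi.add_apply]
      rcases h0 j with h | h | h
      · rw [h]
      · constructor <;> intro <;> linarith
      · constructor <;> intro <;> linarith) (by
      intro j k
      have a := hu0 j
      have b := hu1 j
      have a' := hu0 k
      have b' := hu1 k
      simp only [Pi.add_apply]
      rcases h1 j k with h | h | h <;> constructor <;> intro <;> linarith)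
  simp only [this]

/-- expected greedy value. -/
noncomputable def vv (M : Matroid (Fin n)) (π : Equiv.Perm (Fin n)) (c : Fin n → ℝ) : ℝ :=
  ∫ u in Set.Icc (0 : Fin n → ℝ) 1, gval M π (u + c)

theorem noise_one : ((volume : Measure (Fin n → ℝ)).restrict (Set.Icc 0 1)).real Set.univ = 1 := by
  simp [Measure.real, Real.volume_Icc_pi]

open Classical in
theorem int_wins (M : Matroid (Fin n)) (π : Equiv.Perm (Fin n)) (i : Fin n) (c : Fin n → ℝ)
    (g : (Fin n → ℝ) → ℝ) (hg : Continuous g) :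
    Integrable (fun u => if Wins M (u + c) π i then g u else 0)
      ((volume : Measure (Fin n → ℝ)).restrict (Set.Icc 0 1)) := by
  have : (fun u : Fin n → ℝ => if Wins M (u + c) π i then g u else 0) =
      Set.indicator {u | Wins M (u + c) π i} g := by
    ext u; simp [Set.indicator_apply]
  rw [this]
  exact (hg.integrableOn_Icc).integrable.indicator (meas_shift M π i c)

theorem int_gval (M : Matroid (Fin n)) (π : Equiv.Perm (Fin n)) (c : Fin n → ℝ) :
    Integrable (fun u => gval M π (u + c))
      ((volume : Measure (Fin n → ℝ)).restrict (Set.Icc 0 1)) := by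
  unfold gval
  exact integrable_finsetSum _ fun i _ => int_wins M π i c (fun u => (u + c) i) (by fun_prop)

theorem vv_sub (M : Matroid (Fin n)) (hME : M.E = Set.univ) (π : Equiv.Perm (Fin n))
    (c c' : Fin n → ℝ) :
    vv M π c' + ∑ i, qq M π i c' * (c i - c' i) ≤ vv M π c := by
  classical
  unfold vv qq
  simp only [← integral_mul_const]
  have hint : ∀ i, Integrable (fun u : Fin n → ℝ => (if Wins M (u + c') π i then (1 : ℝ) else 0)
      * (c i - c' i)) ((volume : Measure (Fin n → ℝ)).restrict (Set.Icc 0 1)) :=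
    fun i => (int_wins M π i c' (fun _ => 1) continuous_const).mul_const _
  rw [← integral_finsetSum _ fun i _ => hint i,
    ← integral_add (int_gval M π c') (integrable_finsetSum _ fun i _ => hint i)]
  refine integral_mono ((int_gval M π c').add (integrable_finsetSum _ fun i _ => hint i))
    (int_gval M π c) ?_
  intro u
  refine le_trans (le_of_eq ?_) (gval_sub M hME (u + c) (u + c') π)
  simp [ite_mul]

theorem vv_lower (M : Matroid (Fin n)) (hME : M.E = Set.univ) (π : Equiv.Perm (Fin n))
    (c : Fin n → ℝ) (I : Finset (Fin n)) (hI : M.Indep (I : Set (Fin n))) :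
    ∑ i ∈ I, c i ≤ vv M π c := by
  have := noise_finite (n := n)
  have : ∑ i ∈ I, c i = ∫ _ in Set.Icc (0 : Fin n → ℝ) 1, ∑ i ∈ I, c i := by
    rw [integral_const, noise_one]; simp
  rw [this]
  unfold vv
  refine setIntegral_mono_on (integrable_const (μ := volume.restrict (Set.Icc (0 : Fin n → ℝ) 1)) _) (int_gval M π c) measurableSet_Icc ?_
  intro u hu
  refine le_trans ?_ (greedy_opt M hME (u + c) π I hI)
  apply Finset.sum_le_sum
  intro i _
  have : 0 ≤ u i := hu.1 i
  simp only [Pi.add_apply]; linarith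

theorem sum_reindex (cand : T → Fin n) (f v : T → ℝ) (H : (Fin n → T) → Fin n → ℝ) :
    ∑ t, (f t * ∑ p ∈ (profiles cand).filter (fun p => p (cand t) = t),
      (∏ j ∈ Finset.univ.erase (cand t), f (p j)) * H p (cand t)) * v t =
    ∑ p ∈ profiles cand, (∏ j, f (p j)) * ∑ i, H p i * v (p i) := by
  have h1 : ∀ t, (f t * ∑ p ∈ (profiles cand).filter (fun p => p (cand t) = t),
      (∏ j ∈ Finset.univ.erase (cand t), f (p j)) * H p (cand t)) * v t =
      ∑ p ∈ profiles cand, if p (cand t) = t then (∏ j, f (p j)) * (H p (cand t) * v t) else 0 := by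
    intro t
    rw [Finset.mul_sum, Finset.sum_mul, Finset.sum_filter]
    apply Finset.sum_congr rfl
    intro p _
    split_ifs with h
    · rw [← Finset.mul_prod_erase Finset.univ (fun j => f (p j)) (Finset.mem_univ (cand t)), h]
      ring
    · rfl
  simp only [h1]
  rw [Finset.sum_comm]
  apply Finset.sum_congr rfl
  intro p hp
  have hp' : ∀ i, cand (p i) = i := (Finset.mem_filter.1 hp).2
  rw [Finset.mul_sum, ← Finset.sum_filter]
  refine Finset.sum_bij' (fun t _ => cand t) (fun i _ => p i) ?_ ?_ ?_ ?_ ?_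
  · simp
  · intro i _; simp [hp']
  · intro t ht; exact (Finset.mem_filter.1 ht).2
  · intro i _; exact hp' i
  · intro t ht; simp only [(Finset.mem_filter.1 ht).2]

/-- Interim rule from shifted uniform dice. -/
noncomputable def wI (cand : T → Fin n) (M : Matroid (Fin n)) (f θ : T → ℝ) (t : T) : ℝ :=
  ∑ p ∈ (profiles cand).filter (fun p => p (cand t) = t),
    (∏ j ∈ Finset.univ.erase (cand t), f (p j)) *
      ((∑ π : Equiv.Perm (Fin n), qq M π (cand t) (fun j => θ (p j))) / (Nat.factorial n))

/-- Interim rule of a selection rule. -/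
noncomputable def xA (cand : T → Fin n) (A : (Fin n → T) → Finset (Fin n) → ℝ) (f : T → ℝ)
    (t : T) : ℝ :=
  ∑ p ∈ (profiles cand).filter (fun p => p (cand t) = t),
      (∏ j ∈ Finset.univ.erase (cand t), f (p j)) *
        (∑ S ∈ Finset.univ.filter (fun S : Finset (Fin n) => cand t ∈ S), A p S)

theorem wI_continuous (cand : T → Fin n) (M : Matroid (Fin n)) (t : T) :
    Continuous (fun z : (T → ℝ) × (T → ℝ) => wI cand M z.1 z.2 t) := by
  unfold wI
  have h : ∀ p : Fin n → T, ∀ π : Equiv.Perm (Fin n), Continuous fun z : (T → ℝ) × (T → ℝ) =>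
      qq M π (cand t) (fun j => z.2 (p j)) := fun p π =>
    (qq_continuous M π (cand t)).comp (by fun_prop)
  fun_prop

theorem xA_continuous (cand : T → Fin n) (A : (Fin n → T) → Finset (Fin n) → ℝ) (t : T) :
    Continuous (fun f : T → ℝ => xA cand A f t) := by
  unfold xA
  fun_prop

theorem wI_compress (cand : T → Fin n) (M : Matroid (Fin n)) (θ : T → ℝ) :
    ∃ θ' ∈ Metric.closedBall (0 : T → ℝ) (2 * Fintype.card (Option T)),
      ∀ f t, wI cand M f θ' t = wI cand M f θ t := by
  obtain ⟨g, hg1, hg2⟩ := compress (fun k : Option T => k.elim 0 θ)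
  have hpair : ∀ a b : Option T, (g a - g b = a.elim 0 θ - b.elim 0 θ) ∨
      (2 ≤ a.elim 0 θ - b.elim 0 θ ∧ 2 ≤ g a - g b) ∨
      (a.elim 0 θ - b.elim 0 θ ≤ -2 ∧ g a - g b ≤ -2) := by
    intro a b
    rcases le_total (a.elim 0 θ) (b.elim 0 θ) with h | h
    · rcases hg2 a b h with h' | h'
      · left; linarith
      · right; right; constructor <;> linarith
    · rcases hg2 b a h with h' | h'
      · left; linarith
      · right; left; constructor <;> linarith
  refine ⟨fun t => g (some t) - g none, ?_, ?_⟩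
  · rw [mem_closedBall_zero_iff, pi_norm_le_iff_of_nonneg (by positivity)]
    intro t
    rw [Real.norm_eq_abs, abs_le]
    have a := hg1 (some t)
    have b := hg1 none
    constructor <;> linarith
  · intro f t
    unfold wI
    apply Finset.sum_congr rfl
    intro p _
    congr 2
    apply Finset.sum_congr rfl
    intro π _
    symm
    apply qq_compress
    · intro j
      simpa using hpair (some (p j)) none
    · intro j k
      simpa using hpair (some (p j)) (some (p k))

theorem approx (cand : T → Fin n) (M : Matroid (Fin n)) (hME : M.E = Set.univ) (f : T → ℝ)
    (ε : ℝ) (hε : 0 < ε) (hf : ∀ t, ε ≤ f t) (A : (Fin n → T) → Finset (Fin n) → ℝ)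
    (hA0 : ∀ p S, 0 ≤ A p S) (hA1 : ∀ p, ∑ S : Finset (Fin n), A p S = 1)
    (hAf : ∀ p S, A p S ≠ 0 → M.Indep (S : Set (Fin n))) :
    ∃ θ ∈ Metric.closedBall (0 : T → ℝ) (2 * Fintype.card (Option T)),
      ∀ t, |wI cand M f θ t - xA cand A f t| ≤ ε := by
  classical
  have hf0 : ∀ t, 0 ≤ f t := fun t => hε.le.trans (hf t)
  have hfac : (0 : ℝ) < Nat.factorial n := by exact_mod_cast Nat.factorial_pos n
  obtain ⟨θ, hθ⟩ := abstract_min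
    (fun θ : T → ℝ => ∑ p ∈ profiles cand, (∏ j, f (p j)) *
      ((∑ π : Equiv.Perm (Fin n), vv M π (fun j => θ (p j))) / (Nat.factorial n)))
    (fun θ t => f t * wI cand M f θ t) (fun t => f t * xA cand A f t)
    (by
      refine continuous_pi fun t => continuous_const.mul ?_
      exact (wI_continuous cand M t).comp (continuous_const.prodMk continuous_id))
    (by
      intro θ θ'
      unfold wI
      rw [sum_reindex cand f (fun t => θ t - θ' t) (fun p i =>
        ((∑ π : Equiv.Perm (Fin n), qq M π i (fun j => θ' (p j))) / (Nat.factorial n))),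
        ← Finset.sum_add_distrib]
      apply Finset.sum_le_sum
      intro p _
      rw [← mul_add]
      apply mul_le_mul_of_nonneg_left _ (Finset.prod_nonneg fun j _ => hf0 _)
      have : ∑ i, (∑ π : Equiv.Perm (Fin n), qq M π i (fun j => θ' (p j))) / (Nat.factorial n)
          * (θ (p i) - θ' (p i)) = (∑ π : Equiv.Perm (Fin n), ∑ i, qq M π i (fun j => θ' (p j))
          * (θ (p i) - θ' (p i))) / (Nat.factorial n) := by
        rw [Finset.sum_comm, Finset.sum_div]
        apply Finset.sum_congr rfl
        intro i _
        rw [← Finset.sum_mul]; ring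
      rw [this, ← add_div, ← Finset.sum_add_distrib]
      apply div_le_div_of_nonneg_right _ hfac.le
      apply Finset.sum_le_sum
      intro π _
      exact vv_sub M hME π (fun j => θ (p j)) (fun j => θ' (p j)))
    (by
      intro θ
      unfold xA
      rw [sum_reindex cand f θ (fun p i =>
        (∑ S ∈ Finset.univ.filter (fun S : Finset (Fin n) => i ∈ S), A p S))]
      apply Finset.sum_le_sum
      intro p _
      apply mul_le_mul_of_nonneg_left _ (Finset.prod_nonneg fun j _ => hf0 _)
      set Z := ((∑ π : Equiv.Perm (Fin n), vv M π (fun j => θ (p j))) / (Nat.factorial n)) with hZ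
      have e : ∑ i, (∑ S ∈ Finset.univ.filter (fun S : Finset (Fin n) => i ∈ S), A p S) * θ (p i)
          = ∑ S : Finset (Fin n), A p S * ∑ i ∈ S, θ (p i) := by
        simp only [Finset.sum_filter, Finset.sum_mul, Finset.mul_sum]
        rw [Finset.sum_comm]
        apply Finset.sum_congr rfl
        intro S _
        simp [ite_mul]
      rw [e]
      calc _ ≤ ∑ S : Finset (Fin n), A p S * Z := by
            apply Finset.sum_le_sum
            intro S _
            by_cases hS : A p S = 0
            · simp [hS]
            · apply mul_le_mul_of_nonneg_left _ (hA0 p S)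
              rw [hZ, le_div_iff₀ hfac]
              have := Finset.card_nsmul_le_sum (Finset.univ : Finset (Equiv.Perm (Fin n)))
                (fun π => vv M π (fun j => θ (p j))) (∑ i ∈ S, θ (p i))
                (fun π _ => vv_lower M hME π (fun j => θ (p j)) S (hAf p S hS))
              rw [Finset.card_univ, Fintype.card_perm, Fintype.card_fin, nsmul_eq_mul] at this
              linarith
        _ = Z := by rw [← Finset.sum_mul, hA1, one_mul])
    (ε * ε) (by positivity)
  obtain ⟨θ', hθ', he⟩ := wI_compress cand M θ
  refine ⟨θ', hθ', fun t => ?_⟩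
  rw [he]
  have := hθ t
  rw [← mul_sub, abs_mul, abs_of_nonneg (hf0 t)] at this
  have h2 := hf t
  have h3 := abs_nonneg (wI cand M f θ t - xA cand A f t)
  have h4 : ε * |wI cand M f θ t - xA cand A f t| ≤ ε * ε :=
    (mul_le_mul_of_nonneg_right h2 h3).trans this
  exact le_of_mul_le_mul_left h4 hε

theorem continuous_dice_exist
    (n : ℕ) (T : Type) [Fintype T] [DecidableEq T]
    (cand : T → Fin n) (f : T → ℝ)
    (hf0 : ∀ t, 0 ≤ f t)
    (hf1 : ∀ i : Fin n, ∑ t ∈ Finset.univ.filter (fun t => cand t = i), f t = 1)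
    (M : Matroid (Fin n)) (hME : M.E = Set.univ)
    (x : T → ℝ) (hx : ∀ t, 0 ≤ x t ∧ x t ≤ 1)
    (hfeas : ∃ A, ImplementsRule cand f (fun S => M.Indep ↑S) A x) :
    ∃ D : T → Measure ℝ, (∀ t, IsProbabilityMeasure (D t)) ∧
      ∀ t, diceInterim cand f M D t = x t := by
  obtain ⟨A, hA0, hA1, hAf, hAx⟩ := hfeas
  have happ : ∀ k : ℕ, ∃ θ ∈ Metric.closedBall (0 : T → ℝ) (2 * Fintype.card (Option T)),
      ∀ t, |wI cand M (fun t => f t + 1 / ((k : ℝ) + 1)) θ t -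
        xA cand A (fun t => f t + 1 / ((k : ℝ) + 1)) t| ≤ 1 / ((k : ℝ) + 1) := fun k =>
    approx cand M hME _ (1 / ((k : ℝ) + 1)) (by positivity) (fun t => by have := hf0 t; linarith)
      A hA0 hA1 hAf
  choose θ hθb hθ using happ
  obtain ⟨θs, -, φ, hφ, hlim⟩ := (isCompact_closedBall (0 : T → ℝ)
    (2 * Fintype.card (Option T))).tendsto_subseq hθb
  have h0 : Filter.Tendsto (fun k => 1 / ((φ k : ℝ) + 1)) Filter.atTop (nhds 0) :=
    (tendsto_one_div_add_atTop_nhds_zero_nat (𝕜 := ℝ)).comp hφ.tendsto_atTop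
  have hflim : Filter.Tendsto (fun k => fun t => f t + 1 / ((φ k : ℝ) + 1)) Filter.atTop
      (nhds f) := by
    rw [tendsto_pi_nhds]
    intro t
    simpa using h0.const_add (f t)
  refine ⟨fun t => die (θs t), fun t => die_prob _, fun t => ?_⟩
  have l1 := ((wI_continuous cand M t).tendsto (f, θs)).comp (hflim.prodMk_nhds hlim)
  have l2 := ((xA_continuous cand A t).tendsto f).comp hflim
  have l3 := (l1.sub l2).abs
  have l4 := le_of_tendsto_of_tendsto' l3 h0 (fun k => hθ (φ k) t)
  have l5 := sub_eq_zero.1 (abs_eq_zero.1 (le_antisymm l4 (abs_nonneg _)))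
  have e1 : diceInterim cand f M (fun t => die (θs t)) t = wI cand M f θs t := by
    unfold diceInterim wI winProb
    refine Finset.sum_congr rfl fun p _ => ?_
    congr 2
    exact Finset.sum_congr rfl fun π _ => pi_die M π (cand t) (fun j => θs (p j))
  rw [e1, ← hAx t]
  exact l5

end Stmt1
end

section
/- Let M be a non-separable matroid and x > 0 a feasible interim rule within the winner-selection environment (f, M). Let S be a barrier set for (f, x, M), and let x_S denote the restriction of x to the types in S. Then there exists a vector of probability distributions (dice) (D_t)_{t∈S} over ℝ such that the dice-based rule given by these dice implements x_S in the restricted environment (f, M|S), where M|S is the matroid whose independent sets are the independent sets of M contained in the set of candidates having a type in S. -/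
/-!
Statement 2: Let `M` be a non-separable matroid and `x > 0` a feasible interim rule within
the winner-selection environment `(f, M)`.  Let `S` be a barrier set for `(f, x, M)`.
Then there exist dice `(D_t)_{t ∈ S}` over ℝ implementing the restriction `x_S` of `x`
in the restricted environment `(f, M|S)`, where `M|S` is the restriction of `M` to the
candidates having a type in `S`.

Formalization conventions are as in the other statements (candidates `Fin n`, all types
form `T` with owner map `cand`, independent prior `f`).  "Dice only for the types of `S`"
is modeled by requiring the dice of all types outside `S` to be the point mass at `-1`
(such types roll a negative score and therefore never win and never influence the greedy
selection); the interim condition is required for the types of `S` only.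
-/

open MeasureTheory Finset

namespace Stmt2

variable {n : ℕ} {T : Type} [Fintype T] [DecidableEq T]

/-- Greedy winning predicate with permutation tie-breaking. -/
def Wins (M : Matroid (Fin n)) (s : Fin n → ℝ) (π : Equiv.Perm (Fin n)) (i : Fin n) : Prop :=
  i ∈ M.E ∧ 0 < s i ∧
    i ∉ M.closure {j | 0 < s j ∧ (s i < s j ∨ (s i = s j ∧ π i < π j))}

/-- Probability that candidate `i` wins under independent die rolls `d` with uniform
tie-breaking. -/
noncomputable def winProb (M : Matroid (Fin n)) (d : Fin n → Measure ℝ) (i : Fin n) : ℝ :=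
  (∑ π : Equiv.Perm (Fin n), ((Measure.pi d) {s | Wins M s π i}).toReal) / (Nat.factorial n)

/-- Valid type profiles. -/
def profiles (cand : T → Fin n) : Finset (Fin n → T) :=
  Finset.univ.filter fun p => ∀ i, cand (p i) = i

/-- Conditional winning probability of type `t` under the dice-based rule. -/
noncomputable def diceInterim (cand : T → Fin n) (f : T → ℝ) (M : Matroid (Fin n))
    (D : T → Measure ℝ) (t : T) : ℝ :=
  ∑ p ∈ (profiles cand).filter (fun p => p (cand t) = t),
    (∏ j ∈ Finset.univ.erase (cand t), f (p j)) * winProb M (fun j => D (p j)) (cand t)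

/-- `A` is a winner-selection rule with feasible sets `Feas` implementing `x` for `f`. -/
def ImplementsRule (cand : T → Fin n) (f : T → ℝ) (Feas : Finset (Fin n) → Prop)
    (A : (Fin n → T) → Finset (Fin n) → ℝ) (x : T → ℝ) : Prop :=
  (∀ p S, 0 ≤ A p S) ∧ (∀ p, ∑ S : Finset (Fin n), A p S = 1) ∧
  (∀ p S, A p S ≠ 0 → Feas S) ∧
  ∀ t : T, ∑ p ∈ (profiles cand).filter (fun p => p (cand t) = t),
      (∏ j ∈ Finset.univ.erase (cand t), f (p j)) *
        (∑ S ∈ Finset.univ.filter (fun S : Finset (Fin n) => cand t ∈ S), A p S) = x t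

/-- A matroid is separable if it is the direct sum of two matroids on a nontrivial
partition of its ground set. -/
def Separable (M : Matroid (Fin n)) : Prop :=
  ∃ X : Set (Fin n), X.Nonempty ∧ (M.E \ X).Nonempty ∧ X ⊆ M.E ∧
    ∀ I : Set (Fin n), I ⊆ M.E → (M.Indep I ↔ M.Indep (I ∩ X) ∧ M.Indep (I \ X))

/-- The rank of a set in a matroid: the largest cardinality of an independent subset. -/
noncomputable def rk (M : Matroid (Fin n)) (X : Set (Fin n)) : ℕ :=
  sSup {k | ∃ I : Finset (Fin n), ↑I ⊆ X ∧ M.Indep ↑I ∧ I.card = k}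

/-- `R(S)`: the expected rank of the set of candidates whose realized type lies in `S`. -/
noncomputable def Rval (cand : T → Fin n) (f : T → ℝ) (M : Matroid (Fin n))
    (S : Finset T) : ℝ :=
  ∑ p ∈ profiles cand, (∏ j, f (p j)) * (rk M {i | p i ∈ S} : ℝ)

/-- A set of types is tight if its Border constraint holds with equality. -/
def Tight (cand : T → Fin n) (f : T → ℝ) (M : Matroid (Fin n)) (x : T → ℝ)
    (S : Finset T) : Prop :=
  Rval cand f M S = ∑ t ∈ S, f t * x t

/-- The active types. -/
noncomputable def Tplus (f : T → ℝ) (x : T → ℝ) : Finset T :=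
  Finset.univ.filter fun t => 0 < f t * x t

/-- Barrier sets: the inclusion-minimal nonempty tight sets of active types if a nonempty
tight set of active types exists; otherwise the set of all active types. -/
def IsBarrier (cand : T → Fin n) (f : T → ℝ) (M : Matroid (Fin n)) (x : T → ℝ)
    (S : Finset T) : Prop :=
  ((∃ C, C ⊆ Tplus f x ∧ C.Nonempty ∧ Tight cand f M x C) ∧
    (S ⊆ Tplus f x ∧ S.Nonempty ∧ Tight cand f M x S ∧
      ∀ C, C ⊆ Tplus f x → C.Nonempty → Tight cand f M x C → C ⊆ S → C = S))
  ∨ ((¬ ∃ C, C ⊆ Tplus f x ∧ C.Nonempty ∧ Tight cand f M x C) ∧ S = Tplus f x)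

/-- The candidates having a type in `S`. -/
def candSet (cand : T → Fin n) (S : Finset T) : Set (Fin n) :=
  {i | ∃ t ∈ S, cand t = i}

set_option linter.unusedSectionVars false

lemma rk_bdd (M : Matroid (Fin n)) (X : Set (Fin n)) :
    BddAbove {k | ∃ I : Finset (Fin n), ↑I ⊆ X ∧ M.Indep ↑I ∧ I.card = k} := by
  refine ⟨n, ?_⟩
  rintro k ⟨I, -, -, rfl⟩
  simpa using Finset.card_le_univ I

lemma card_le_rk (M : Matroid (Fin n)) (X : Set (Fin n)) (I : Finset (Fin n))
    (hIX : ↑I ⊆ X) (hI : M.Indep ↑I) : I.card ≤ rk M X :=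
  le_csSup (rk_bdd M X) ⟨I, hIX, hI, rfl⟩

lemma exists_rk (M : Matroid (Fin n)) (X : Set (Fin n)) :
    ∃ I : Finset (Fin n), ↑I ⊆ X ∧ M.Indep ↑I ∧ I.card = rk M X :=
  Nat.sSup_mem (s := {k | ∃ I : Finset (Fin n), (↑I : Set (Fin n)) ⊆ X ∧ M.Indep ↑I ∧ I.card = k})
    ⟨0, ∅, by simp, by simp, by simp⟩ (rk_bdd M X)

/-- extend an independent set inside `X` to one of size `rk`. -/
lemma exists_extend (M : Matroid (Fin n)) (X : Set (Fin n)) (I : Finset (Fin n))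
    (hIX : ↑I ⊆ X) (hI : M.Indep ↑I) :
    ∃ J : Finset (Fin n), I ⊆ J ∧ ↑J ⊆ X ∧ M.Indep ↑J ∧ J.card = rk M X := by
  classical
  -- take a maximal one
  have hne : (Finset.univ.filter fun J : Finset (Fin n) => I ⊆ J ∧ ↑J ⊆ X ∧ M.Indep ↑J).Nonempty :=
    ⟨I, by simp [hIX, hI]⟩
  obtain ⟨J, hJ, hmax⟩ := Finset.exists_max_image _ Finset.card hne
  simp only [Finset.mem_filter, Finset.mem_univ, true_and] at hJ hmax
  obtain ⟨h1, h2, h3⟩ := hJ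
  refine ⟨J, h1, h2, h3, le_antisymm (card_le_rk M X J h2 h3) ?_⟩
  by_contra hlt
  push Not at hlt
  obtain ⟨K, hK1, hK2, hK3⟩ := exists_rk M X
  obtain ⟨e, he, hei⟩ := h3.augment hK2 (by
    rw [Set.encard_coe_eq_coe_finsetCard, Set.encard_coe_eq_coe_finsetCard]
    exact_mod_cast (by omega))
  have he1 : e ∈ K := by simpa using he.1
  have he2 : e ∉ J := by simpa using he.2
  have := hmax (insert e J) ⟨h1.trans (Finset.subset_insert _ _), by
    rw [Finset.coe_insert]; exact Set.insert_subset (hK1 (by simpa using he1)) h2, by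
    rw [Finset.coe_insert]; exact hei⟩
  rw [Finset.card_insert_of_notMem he2] at this
  omega

open Classical in
/-- independent finsets -/
noncomputable def indeps (M : Matroid (Fin n)) : Finset (Finset (Fin n)) :=
  Finset.univ.filter fun I : Finset (Fin n) => M.Indep ↑I

lemma mem_indeps (M : Matroid (Fin n)) (I : Finset (Fin n)) : I ∈ indeps M ↔ M.Indep ↑I := by
  simp [indeps]

lemma indeps_nonempty (M : Matroid (Fin n)) : (indeps M).Nonempty :=
  ⟨∅, by simp [mem_indeps]⟩

noncomputable def W (M : Matroid (Fin n)) (s : Fin n → ℝ) : ℝ :=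
  (indeps M).sup' (indeps_nonempty M) fun I => ∑ i ∈ I, s i

lemma le_W (M : Matroid (Fin n)) (s : Fin n → ℝ) (I : Finset (Fin n)) (hI : M.Indep ↑I) :
    ∑ i ∈ I, s i ≤ W M s :=
  Finset.le_sup' (fun I => ∑ i ∈ I, s i) ((mem_indeps M I).2 hI)

lemma W_le (M : Matroid (Fin n)) (s : Fin n → ℝ) (c : ℝ)
    (h : ∀ I : Finset (Fin n), M.Indep ↑I → ∑ i ∈ I, s i ≤ c) : W M s ≤ c :=
  Finset.sup'_le _ _ fun I hI => h I ((mem_indeps M I).1 hI)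

lemma exists_W (M : Matroid (Fin n)) (s : Fin n → ℝ) :
    ∃ I : Finset (Fin n), M.Indep ↑I ∧ W M s = ∑ i ∈ I, s i := by
  obtain ⟨I, hI, h⟩ := Finset.exists_mem_eq_sup' (indeps_nonempty M) fun I => ∑ i ∈ I, s i
  exact ⟨I, (mem_indeps M I).1 hI, h⟩

lemma W_nonneg (M : Matroid (Fin n)) (s : Fin n → ℝ) : 0 ≤ W M s := by
  simpa using le_W M s ∅ (by simp)

lemma W_continuous (M : Matroid (Fin n)) : Continuous (W M) := by
  unfold W
  apply Continuous.finset_sup'_apply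
  intro I _
  fun_prop

lemma W_smul (M : Matroid (Fin n)) (s : Fin n → ℝ) (c : ℝ) (hc : 0 ≤ c) :
    W M (c • s) = c * W M s := by
  apply le_antisymm
  · apply W_le
    intro I hI
    simp only [Pi.smul_apply, smul_eq_mul, ← Finset.mul_sum]
    exact mul_le_mul_of_nonneg_left (le_W M s I hI) hc
  · obtain ⟨I, hI, h⟩ := exists_W M s
    rw [h]
    have := le_W M (c • s) I hI
    simpa only [Pi.smul_apply, smul_eq_mul, ← Finset.mul_sum] using this

lemma indep_mono {M : Matroid (Fin n)} {I J : Finset (Fin n)} (hJ : M.Indep ↑J) (h : I ⊆ J) :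
    M.Indep ↑I := hJ.subset (by exact_mod_cast h)

lemma card_top (M : Matroid (Fin n)) (w : Fin n → ℝ) (m : ℝ) (hm : 0 < m) (hw : ∀ i, w i ≤ m)
    (I : Finset (Fin n)) (hI : M.Indep ↑I) (hmax : W M w = ∑ i ∈ I, w i) :
    (I.filter fun i => w i = m).card = rk M {i | w i = m} := by
  classical
  set P := I.filter fun i => w i = m with hP
  have hPI : P ⊆ I := Finset.filter_subset _ _
  have hPi : M.Indep ↑P := indep_mono hI hPI
  obtain ⟨J, hPJ, hJX, hJ, hJc⟩ := exists_extend M {i | w i = m} P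
    (by intro i hi; simp [hP] at hi; exact hi.2) hPi
  rw [← hJc]
  by_contra hne
  have hss : P ⊂ J := Finset.ssubset_iff_subset_ne.2 ⟨hPJ, fun h => hne (by rw [h])⟩
  obtain ⟨e, heJ, heP⟩ := Finset.exists_of_ssubset hss
  have hem : w e = m := hJX (by exact_mod_cast heJ)
  have heI : e ∉ I := fun h => heP (by simp [hP, h, hem])
  have hQi : M.Indep ↑(insert e P) := indep_mono hJ (Finset.insert_subset heJ hPJ)
  obtain ⟨K, hQK, hKX, hK, hKc⟩ := exists_extend M (↑(insert e I) : Set (Fin n)) (insert e P)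
    (by exact_mod_cast Finset.insert_subset_insert _ hPI) hQi
  have hKI : K ⊆ insert e I := by exact_mod_cast hKX
  have hIK : I.card ≤ K.card := by
    rw [hKc]; exact card_le_rk _ _ _ (by simp) hI
  have hle := le_W M w K hK
  rw [hmax] at hle
  -- sum over insert e I splits
  have h1 : ∑ i ∈ insert e I \ K, w i + ∑ i ∈ K, w i = ∑ i ∈ insert e I, w i :=
    Finset.sum_sdiff hKI
  rw [Finset.sum_insert heI, hem] at h1
  have hcard : (insert e I \ K).card ≤ 1 := by
    rw [Finset.card_sdiff_of_subset hKI, Finset.card_insert_of_notMem heI]; omega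
  have h2 : ∑ i ∈ insert e I \ K, w i < m := by
    have : Nonempty (Fin n) := ⟨e⟩
    rcases Finset.card_le_one_iff_subset_singleton.1 hcard with ⟨d, hd⟩
    rcases Finset.subset_singleton_iff.1 hd with h | h
    · rw [h]; simpa using hm
    · rw [h, Finset.sum_singleton]
      have hd : d ∈ insert e I \ K := by rw [h]; simp
      simp only [Finset.mem_sdiff, Finset.mem_insert] at hd
      refine lt_of_le_of_ne (hw d) fun hdm => hd.2 (hQK ?_)
      rcases hd.1 with rfl | hdI
      · simp
      · simp [hP, hdI, hdm]
  linarith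

/-- layer-cake dominance -/
lemma dominance (s c : Fin n → ℝ) (h : ∀ θ : ℝ, 0 ≤ θ → 0 ≤ ∑ i, if θ < s i then c i else 0) :
    0 ≤ ∑ i, c i * max (s i) 0 := by
  have key : ∫ θ in Set.Ioi (0:ℝ), ∑ i, (c i * (Set.Iio (s i)).indicator 1 θ)
      = ∑ i, c i * max (s i) 0 := by
    rw [integral_finsetSum]
    · refine Finset.sum_congr rfl fun i _ => ?_
      rw [integral_const_mul, integral_indicator_one measurableSet_Iio,
        measureReal_restrict_apply measurableSet_Iio]
      congr 1
      have : Set.Iio (s i) ∩ Set.Ioi 0 = Set.Ioo 0 (s i) := by ext; simp [and_comm]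
      rw [this, Real.volume_real_Ioo, sub_zero]
    · intro i _
      apply Integrable.const_mul
      rw [integrable_indicator_iff measurableSet_Iio, IntegrableOn,
        Measure.restrict_restrict measurableSet_Iio]
      have : Set.Iio (s i) ∩ Set.Ioi 0 = Set.Ioo 0 (s i) := by ext; simp [and_comm]
      rw [this]
      exact integrableOn_const (by simp)
  rw [← key]
  apply setIntegral_nonneg measurableSet_Ioi
  intro θ hθ
  have := h θ (le_of_lt hθ)
  refine this.trans_eq (Finset.sum_congr rfl fun i _ => ?_)
  simp [Set.indicator_apply]

def key (s : Fin n → ℝ) (π : Equiv.Perm (Fin n)) (i : Fin n) : ℝ ×ₗ Fin n := toLex (s i, π i)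

lemma key_lt (s : Fin n → ℝ) (π : Equiv.Perm (Fin n)) (i j : Fin n) :
    key s π i < key s π j ↔ (s i < s j ∨ (s i = s j ∧ π i < π j)) := by
  simp [key, Prod.Lex.toLex_lt_toLex]

lemma key_inj (s : Fin n → ℝ) (π : Equiv.Perm (Fin n)) {i j : Fin n}
    (h : key s π i = key s π j) : i = j := by
  have := congrArg (fun z => (ofLex z).2) h
  simpa [key] using this

open Classical in
noncomputable def winSet (M : Matroid (Fin n)) (s : Fin n → ℝ) (π : Equiv.Perm (Fin n)) :
    Finset (Fin n) := Finset.univ.filter fun i => Wins M s π i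

lemma mem_winSet (M : Matroid (Fin n)) (s : Fin n → ℝ) (π : Equiv.Perm (Fin n)) (i : Fin n) :
    i ∈ winSet M s π ↔ Wins M s π i := by simp [winSet]

lemma winSet_indep (M : Matroid (Fin n)) (hME : M.E = Set.univ) (s : Fin n → ℝ)
    (π : Equiv.Perm (Fin n)) : M.Indep ↑(winSet M s π) := by
  classical
  by_contra hB
  rw [Matroid.not_indep_iff (by simp [hME])] at hB
  obtain ⟨C, hCB, hC⟩ := hB.exists_isCircuit_subset
  obtain ⟨e, heC, hemin⟩ := Set.exists_min_image C (key s π) (Set.toFinite C) hC.nonempty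
  have hw : Wins M s π e := (mem_winSet M s π e).1 (by exact_mod_cast hCB heC)
  refine hw.2.2 (M.closure_subset_closure ?_ (hC.mem_closure_sdiff_singleton_of_mem heC))
  rintro j ⟨hjC, hje⟩
  have hwj : Wins M s π j := (mem_winSet M s π j).1 (by exact_mod_cast hCB hjC)
  refine ⟨hwj.2.1, (key_lt s π e j).1 (lt_of_le_of_ne (hemin j hjC) fun h => hje ?_)⟩
  exact (key_inj s π h).symm

lemma winSet_span (M : Matroid (Fin n)) (hME : M.E = Set.univ) (s : Fin n → ℝ)
    (π : Equiv.Perm (Fin n)) (θ : ℝ) (hθ : 0 ≤ θ) :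
    {i | θ < s i} ⊆ M.closure {i | Wins M s π i ∧ θ < s i} := by
  have hwf : WellFounded fun a b : Fin n => key s π b < key s π a := by
    have : IsTrans (Fin n) fun a b => key s π b < key s π a := ⟨fun a b c h1 h2 => h2.trans h1⟩
    have : Std.Irrefl fun a b : Fin n => key s π b < key s π a := ⟨fun a h => lt_irrefl _ h⟩
    exact Finite.wellFounded_of_trans_of_irrefl _
  intro i
  induction i using hwf.induction with
  | _ i ih =>
    intro hi
    by_cases hw : Wins M s π i
    · exact M.mem_closure_of_mem (by exact ⟨hw, hi⟩) (by simp [hME])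
    · have : i ∈ M.closure {j | 0 < s j ∧ (s i < s j ∨ (s i = s j ∧ π i < π j))} := by
        by_contra hc
        exact hw ⟨by simp [hME], lt_of_le_of_lt hθ hi, hc⟩
      refine M.closure_subset_closure_of_subset_closure ?_ this
      rintro j ⟨_, hj⟩
      have hij : s i ≤ s j := by rcases hj with h | h; exacts [h.le, h.1.le]
      exact ih j ((key_lt s π i j).2 hj) (lt_of_lt_of_le hi hij)

lemma winSet_opt (M : Matroid (Fin n)) (hME : M.E = Set.univ) (s : Fin n → ℝ)
    (π : Equiv.Perm (Fin n)) : W M s = ∑ i ∈ winSet M s π, s i := by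
  classical
  apply le_antisymm _ (le_W _ _ _ (winSet_indep M hME s π))
  apply W_le
  intro I hI
  have := dominance s (fun i => (if i ∈ winSet M s π then 1 else 0) - (if i ∈ I then 1 else 0)) ?_
  · simp only [sub_mul, ite_mul, one_mul, zero_mul, Finset.sum_sub_distrib, Finset.sum_ite_mem,
      Finset.univ_inter] at this
    have h1 : ∑ i ∈ I, s i ≤ ∑ i ∈ I, max (s i) 0 := Finset.sum_le_sum fun i _ => le_max_left _ _
    have h2 : ∑ i ∈ winSet M s π, max (s i) 0 = ∑ i ∈ winSet M s π, s i :=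
      Finset.sum_congr rfl fun i hi => max_eq_left ((mem_winSet M s π i).1 hi).2.1.le
    linarith
  · intro θ hθ
    have hle : (I.filter fun i => θ < s i).card ≤ ((winSet M s π).filter fun i => θ < s i).card := by
      have hIi : M.Indep ↑(I.filter fun i => θ < s i) := indep_mono hI (Finset.filter_subset _ _)
      have h1 := hIi.encard_le_eRk_of_subset (X := M.closure {i | Wins M s π i ∧ θ < s i}) (by
        refine subset_trans ?_ (winSet_span M hME s π θ hθ)
        intro i hi
        simp at hi; exact hi.2)
      rw [Matroid.eRk_closure_eq] at h1
      have h2 := h1.trans (M.eRk_le_encard _)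
      have h3 : {i | Wins M s π i ∧ θ < s i} = ↑((winSet M s π).filter fun i => θ < s i) := by
        ext i; simp [mem_winSet]
      rw [h3, Set.encard_coe_eq_coe_finsetCard, Set.encard_coe_eq_coe_finsetCard] at h2
      exact_mod_cast h2
    have e : ∑ i, (if θ < s i then ((if i ∈ winSet M s π then (1:ℝ) else 0) - (if i ∈ I then 1 else 0)) else 0)
        = (((winSet M s π).filter fun i => θ < s i).card : ℝ) - (I.filter fun i => θ < s i).card := by
      rw [Finset.card_filter, Finset.card_filter]
      push_cast
      rw [← Finset.univ_inter (winSet M s π), ← Finset.univ_inter I, ← Finset.sum_ite_mem,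
        ← Finset.sum_ite_mem, ← Finset.sum_sub_distrib]
      refine Finset.sum_congr rfl fun i _ => ?_
      simp only [Finset.univ_inter]
      split_ifs <;> simp
    rw [e]
    have : ((I.filter fun i => θ < s i).card : ℝ) ≤ ((winSet M s π).filter fun i => θ < s i).card := by
      exact_mod_cast hle
    linarith

/-- subgradient inequality -/
lemma W_subgrad (M : Matroid (Fin n)) (hME : M.E = Set.univ) (s : Fin n → ℝ)
    (π : Equiv.Perm (Fin n)) (i : Fin n) (s' : Fin n → ℝ) (h : ℝ)
    (hs' : s' = s + Pi.single i h) [Decidable (Wins M s' π i)] :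
    W M s' - W M s ≤ h * (if Wins M s' π i then 1 else 0) := by
  classical
  have h1 := winSet_opt M hME s' π
  have h2 := le_W M s _ (winSet_indep M hME s' π)
  have h3 : ∑ j ∈ winSet M s' π, s' j = ∑ j ∈ winSet M s' π, s j
      + h * (if Wins M s' π i then 1 else 0) := by
    have : ∀ j, s' j = s j + (Pi.single i h : Fin n → ℝ) j := fun j => by rw [hs']; rfl
    simp only [this, Finset.sum_add_distrib]
    congr 1
    rw [Finset.sum_pi_single']
    simp [mem_winSet]
  linarith

lemma wins_restrict (M : Matroid (Fin n)) (hME : M.E = Set.univ) (X : Set (Fin n))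
    (s : Fin n → ℝ) (hs : ∀ j, 0 < s j → j ∈ X) (π : Equiv.Perm (Fin n)) (i : Fin n) :
    Wins (M.restrict X) s π i ↔ Wins M s π i := by
  unfold Wins
  rw [Matroid.restrict_closure_eq _ (by rintro j ⟨hj, _⟩; exact hs j hj) (by simp [hME])]
  simp only [Matroid.restrict_ground_eq, hME, Set.mem_univ, true_and, Set.mem_inter_iff]
  constructor
  · rintro ⟨h1, h2, h3⟩; exact ⟨h2, fun h => h3 ⟨h, h1⟩⟩
  · rintro ⟨h2, h3⟩; exact ⟨hs i h2, h2, fun h => h3 h.1⟩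

lemma wins_measurable (M : Matroid (Fin n)) (π : Equiv.Perm (Fin n)) (i : Fin n) :
    MeasurableSet {s : Fin n → ℝ | Wins M s π i} := by
  have hF : Measurable fun s : Fin n → ℝ =>
      ({j | 0 < s j ∧ (s i < s j ∨ (s i = s j ∧ π i < π j))} : Set (Fin n)) := by
    rw [measurable_set_iff]
    intro j
    refine Measurable.and ?_ (Measurable.or ?_ (Measurable.and ?_ measurable_const))
    · exact measurableSet_setOfPred.1 (measurableSet_lt measurable_const (measurable_pi_apply j))
    · exact measurableSet_setOfPred.1 (measurableSet_lt (measurable_pi_apply i) (measurable_pi_apply j))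
    · exact measurableSet_setOfPred.1 (measurableSet_eq_fun (measurable_pi_apply i) (measurable_pi_apply j))
  have h1 : MeasurableSet {X : Set (Fin n) | i ∉ M.closure X} := (Set.toFinite _).measurableSet
  have h2 := hF h1
  have h3 : MeasurableSet {s : Fin n → ℝ | i ∈ M.E ∧ 0 < s i} :=
    (MeasurableSet.const _).inter (measurableSet_lt measurable_const (measurable_pi_apply i))
  have := h3.inter h2
  convert this using 1
  ext s
  simp [Wins, and_assoc]

def score (S : Finset T) (u : T → ℝ) (p : Fin n → T) (g : Fin n → ℝ) : Fin n → ℝ :=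
  fun j => if p j ∈ S then u (p j) + g j else -1

noncomputable def cube (n : ℕ) : Measure (Fin n → ℝ) := volume.restrict (Set.Icc 0 1)

lemma cube_eq : cube n = Measure.pi fun _ : Fin n => (volume : Measure ℝ).restrict (Set.Icc 0 1) := by
  rw [← Measure.restrict_pi_pi, Set.pi_univ_Icc]
  rfl

instance unitProb : IsProbabilityMeasure ((volume : Measure ℝ).restrict (Set.Icc 0 1)) :=
  ⟨by simp⟩

instance cubeProb : IsProbabilityMeasure (cube n) := by
  rw [cube_eq]; infer_instance

noncomputable def die (S : Finset T) (u : T → ℝ) (t : T) : Measure ℝ :=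
  if t ∈ S then Measure.map (fun y => u t + y) ((volume : Measure ℝ).restrict (Set.Icc 0 1))
  else Measure.dirac (-1)

lemma die_prob (S : Finset T) (u : T → ℝ) (t : T) : IsProbabilityMeasure (die S u t) := by
  unfold die
  split_ifs
  · exact Measure.isProbabilityMeasure_map (by fun_prop)
  · infer_instance

lemma die_eq (S : Finset T) (u : T → ℝ) (t : T) : die S u t =
    Measure.map (fun y => if t ∈ S then u t + y else -1)
      ((volume : Measure ℝ).restrict (Set.Icc 0 1)) := by
  unfold die
  split_ifs
  · rfl
  · rw [Measure.map_const]; simp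

lemma score_continuous (S : Finset T) (p : Fin n → T) :
    Continuous fun z : (T → ℝ) × (Fin n → ℝ) => score S z.1 p z.2 := by
  unfold score
  refine continuous_pi fun j => ?_
  split_ifs <;> fun_prop

lemma score_measurable (S : Finset T) (u : T → ℝ) (p : Fin n → T) :
    Measurable (score S u p) :=
  ((score_continuous S p).comp (Continuous.prodMk_right u)).measurable

lemma pi_die (S : Finset T) (u : T → ℝ) (p : Fin n → T) :
    Measure.pi (fun j => die S u (p j)) = Measure.map (score S u p) (cube n) := by
  have hm : ∀ t : T, Measurable fun y : ℝ => if t ∈ S then u t + y else -1 := by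
    intro t; split_ifs <;> fun_prop
  have := fun j => Measure.isProbabilityMeasure_map
    (μ := (volume : Measure ℝ).restrict (Set.Icc 0 1)) (hm (p j)).aemeasurable
  rw [cube_eq]
  simp_rw [die_eq]
  rw [← Measure.pi_map_pi fun j => (hm (p j)).aemeasurable]
  rfl

noncomputable def wp (M : Matroid (Fin n)) (S : Finset T) (u : T → ℝ) (p : Fin n → T)
    (π : Equiv.Perm (Fin n)) (i : Fin n) : ℝ := (cube n).real {g | Wins M (score S u p g) π i}

lemma winProb_eq (cand : T → Fin n) (M : Matroid (Fin n)) (hME : M.E = Set.univ)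
    (S : Finset T) (u : T → ℝ) (p : Fin n → T) (hp : p ∈ profiles cand) (i : Fin n) :
    winProb (M.restrict (candSet cand S)) (fun j => die S u (p j)) i
      = (∑ π : Equiv.Perm (Fin n), wp M S u p π i) / (Nat.factorial n) := by
  unfold winProb wp
  congr 1
  refine Finset.sum_congr rfl fun π _ => ?_
  rw [pi_die, Measure.map_apply (score_measurable S u p) (wins_measurable _ _ _), Measure.real]
  congr 2
  ext g
  simp only [Set.mem_preimage, Set.mem_ofPred_eq]
  apply wins_restrict M hME
  intro j hj
  simp only [profiles, Finset.mem_filter, Finset.mem_univ, true_and] at hp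
  by_cases h : p j ∈ S
  · exact ⟨p j, h, hp j⟩
  · simp [score, h] at hj
    linarith

lemma sum_perm_avg (c : ℝ) : (∑ _π : Equiv.Perm (Fin n), c) / (Nat.factorial n) = c := by
  rw [Finset.sum_const, Finset.card_univ, Fintype.card_perm, Fintype.card_fin, nsmul_eq_mul]
  have : (Nat.factorial n : ℝ) ≠ 0 := by exact_mod_cast Nat.factorial_ne_zero n
  field_simp

lemma score_update (S : Finset T) (u : T → ℝ) (p : Fin n → T) (i : Fin n) (hi : p i ∈ S)
    (hp : ∀ j, p j = p i → j = i) (h : ℝ) (g : Fin n → ℝ) :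
    score S (u + Pi.single (p i) h) p g = score S u p g + Pi.single i h := by
  ext j
  by_cases hj : j = i
  · subst hj; simp [score, hi]; ring
  · have : p j ≠ p i := fun e => hj (hp j e)
    simp [score, hj, this]

lemma score_update' (S : Finset T) (u : T → ℝ) (p : Fin n → T) (i : Fin n) (hi : p i ∈ S)
    (hp : ∀ j, p j = p i → j = i) (h : ℝ) (g : Fin n → ℝ) :
    score S (u + Pi.single (p i) h) p g = score S u p (g + Pi.single i h) := by
  ext j
  by_cases hj : j = i
  · subst hj; simp [score, hi]; ring
  · have : p j ≠ p i := fun e => hj (hp j e)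
    simp [score, hj, this]

lemma wp_shift (M : Matroid (Fin n)) (S : Finset T) (u : T → ℝ) (p : Fin n → T)
    (π : Equiv.Perm (Fin n)) (i : Fin n) (hi : p i ∈ S) (hp : ∀ j, p j = p i → j = i) (h : ℝ) :
    wp M S (u + Pi.single (p i) h) p π i ≤ wp M S u p π i + |h| := by
  unfold wp
  simp_rw [score_update' S u p i hi hp h]
  set E : Set (Fin n → ℝ) := {g | Wins M (score S u p g) π i} with hE
  have hEm : MeasurableSet E := score_measurable S u p (wins_measurable M π i)
  have hτ : Measurable fun g : Fin n → ℝ => g + Pi.single i h := by fun_prop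
  change (cube n).real ((fun g : Fin n → ℝ => g + Pi.single i h) ⁻¹' E) ≤ _
  set τ := fun g : Fin n → ℝ => g + Pi.single i h with hτd
  set B : Set ℝ := {y | y + h ∉ Set.Icc (0:ℝ) 1} with hB
  have hBm : MeasurableSet B := (measurable_id.add_const h measurableSet_Icc).compl
  have hBm' : MeasurableSet (Function.eval i ⁻¹' B : Set (Fin n → ℝ)) :=
    (measurable_pi_apply i : Measurable fun g : Fin n → ℝ => g i) hBm
  have hsub : τ ⁻¹' E ∩ Set.Icc 0 1 ⊆
      (τ ⁻¹' (E ∩ Set.Icc 0 1)) ∪ ((Function.eval i ⁻¹' B) ∩ Set.Icc 0 1) := by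
    rintro g ⟨hgE, hg⟩
    by_cases hgB : g i + h ∈ Set.Icc (0:ℝ) 1
    · left
      refine ⟨hgE, ?_⟩
      rw [Set.mem_Icc, Pi.le_def, Pi.le_def] at hg ⊢
      constructor <;> intro j <;> by_cases hj : j = i
      · subst hj; simpa [hτd] using hgB.1
      · simpa [hτd, hj] using hg.1 j
      · subst hj; simpa [hτd] using hgB.2
      · simpa [hτd, hj] using hg.2 j
    · exact Or.inr ⟨hgB, hg⟩
  have h1 : cube n (τ ⁻¹' E) ≤ cube n E + cube n (Function.eval i ⁻¹' B) := by
    have e1 : cube n (τ ⁻¹' E) = volume (τ ⁻¹' E ∩ Set.Icc 0 1) :=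
      Measure.restrict_apply (hτ hEm)
    have e2 : cube n E = volume (τ ⁻¹' (E ∩ Set.Icc 0 1)) := by
      rw [hτd, measure_preimage_add_right]
      exact Measure.restrict_apply hEm
    have e3 : cube n (Function.eval i ⁻¹' B) = volume ((Function.eval i ⁻¹' B : Set (Fin n → ℝ)) ∩ Set.Icc 0 1) :=
      Measure.restrict_apply hBm'
    rw [e1, e2, e3]
    exact (measure_mono hsub).trans (measure_union_le _ _)
  have h2 : cube n (Function.eval i ⁻¹' B) ≤ ENNReal.ofReal |h| := by
    rw [cube_eq, (measurePreserving_eval _ i).measure_preimage hBm.nullMeasurableSet,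
      Measure.restrict_apply hBm]
    rcases le_total 0 h with h0 | h0
    · calc volume (B ∩ Set.Icc 0 1) ≤ volume (Set.Icc (1 - h) 1) := by
            apply measure_mono
            rintro y ⟨hy, hy1⟩
            simp only [hB, Set.mem_ofPred_eq, Set.mem_Icc, not_and, not_le] at hy
            have := hy (by linarith [hy1.1])
            exact ⟨by linarith, hy1.2⟩
        _ = ENNReal.ofReal |h| := by rw [Real.volume_Icc, abs_of_nonneg h0]; congr 1; ring
    · calc volume (B ∩ Set.Icc 0 1) ≤ volume (Set.Icc 0 (-h)) := by
            apply measure_mono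
            rintro y ⟨hy, hy1⟩
            simp only [hB, Set.mem_ofPred_eq, Set.mem_Icc, not_and, not_le] at hy
            refine ⟨hy1.1, ?_⟩
            by_contra hc
            have := hy (by linarith)
            linarith [hy1.2]
        _ = ENNReal.ofReal |h| := by rw [Real.volume_Icc, abs_of_nonpos h0]; congr 1; ring
  have h3 := h1.trans (add_le_add_right h2 (cube n E))
  have h4 := ENNReal.toReal_mono (by finiteness) h3
  rw [ENNReal.toReal_add (by finiteness) (by finiteness), ENNReal.toReal_ofReal (abs_nonneg h)] at h4
  exact h4

noncomputable def phi (M : Matroid (Fin n)) (S : Finset T) (p : Fin n → T) (u : T → ℝ) : ℝ :=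
  ∫ g, W M (score S u p g) ∂(cube n)

lemma phi_continuous (M : Matroid (Fin n)) (S : Finset T) (p : Fin n → T) :
    Continuous (phi M S p) := by
  unfold phi cube
  exact continuous_parametric_integral_of_continuous
    (f := fun u g => W M (score S u p g)) ((W_continuous M).comp (score_continuous S p)) isCompact_Icc

lemma phi_integrable (M : Matroid (Fin n)) (S : Finset T) (p : Fin n → T) (u : T → ℝ) :
    Integrable (fun g => W M (score S u p g)) (cube n) := by
  have : Continuous fun g => W M (score S u p g) :=
    (W_continuous M).comp ((score_continuous S p).comp (Continuous.prodMk_right u))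
  exact this.continuousOn.integrableOn_compact isCompact_Icc

lemma cube_ae : ∀ᵐ g ∂(cube n), g ∈ Set.Icc (0 : Fin n → ℝ) 1 :=
  ae_restrict_mem measurableSet_Icc

/-- compare integrals pointwise -/
lemma phi_le (M : Matroid (Fin n)) (S : Finset T) (p : Fin n → T) (u u' : T → ℝ) (c : ℝ)
    (h : ∀ g : Fin n → ℝ, (∀ i, 0 ≤ g i) → W M (score S u p g) ≤ W M (score S u' p g) + c) :
    phi M S p u ≤ phi M S p u' + c := by
  have : ∫ g, (W M (score S u' p g) + c) ∂(cube n) = phi M S p u' + c := by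
    rw [integral_add (phi_integrable M S p u') (integrable_const c)]; simp [phi]
  rw [← this]
  refine integral_mono_ae (phi_integrable M S p u)
    ((phi_integrable M S p u').add (integrable_const c)) ?_
  filter_upwards [cube_ae] with g hg
  exact h g fun i => hg.1 i

lemma phi_ge (M : Matroid (Fin n)) (S : Finset T) (p : Fin n → T) (u : T → ℝ) (c : ℝ)
    (h : ∀ g : Fin n → ℝ, (∀ i, 0 ≤ g i) → c ≤ W M (score S u p g)) :
    c ≤ phi M S p u := by
  have : ∫ _g, c ∂(cube n) = c := by simp
  rw [← this]
  refine integral_mono_ae (integrable_const c) (phi_integrable M S p u) ?_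
  filter_upwards [cube_ae] with g hg
  exact h g fun i => hg.1 i

lemma phi_subgrad (M : Matroid (Fin n)) (hME : M.E = Set.univ) (S : Finset T) (u : T → ℝ)
    (p : Fin n → T) (i : Fin n) (hi : p i ∈ S) (hp : ∀ j, p j = p i → j = i) (h : ℝ) :
    phi M S p (u + Pi.single (p i) h) - phi M S p u ≤
      h * ((∑ π : Equiv.Perm (Fin n), wp M S (u + Pi.single (p i) h) p π i) / (Nat.factorial n)) := by
  classical
  have key : ∀ π : Equiv.Perm (Fin n), phi M S p (u + Pi.single (p i) h) - phi M S p u ≤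
      h * wp M S (u + Pi.single (p i) h) p π i := by
    intro π
    set u' := u + Pi.single (p i) h with hu'
    have hm : MeasurableSet {g | Wins M (score S u' p g) π i} :=
      score_measurable S u' p (wins_measurable M π i)
    unfold phi wp
    rw [← integral_sub (phi_integrable M S p u') (phi_integrable M S p u),
      ← integral_indicator_one hm, ← integral_const_mul]
    refine integral_mono ((phi_integrable M S p u').sub (phi_integrable M S p u)) ?_ ?_
    · apply Integrable.const_mul
      exact (integrable_const (1:ℝ)).indicator hm
    · intro g
      have := W_subgrad M hME (score S u p g) π i (score S u' p g) h
        (by rw [hu', score_update S u p i hi hp])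
      simpa [Set.indicator_apply] using this
  refine (sum_perm_avg (n := n) _).symm.le.trans ?_
  rw [mul_div_assoc', Finset.mul_sum]
  gcongr with π
  exact key π

lemma phi_const (M : Matroid (Fin n)) (S : Finset T) (u : T → ℝ) (p : Fin n → T) (t : T)
    (ht : ∀ j, p j ≠ t) (h : ℝ) : phi M S p (u + Pi.single t h) = phi M S p u := by
  unfold phi
  congr 1
  ext g
  congr 1
  ext j
  simp [score, ht j]

lemma phi_congr (M : Matroid (Fin n)) (S : Finset T) (u u' : T → ℝ) (p : Fin n → T)
    (h : ∀ t ∈ S, u t = u' t) : phi M S p u = phi M S p u' := by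
  unfold phi
  congr 1
  ext g
  congr 1
  ext j
  by_cases hj : p j ∈ S
  · simp [score, hj, h _ hj]
  · simp [score, hj]

lemma phi_shift_le (M : Matroid (Fin n)) (S : Finset T) (u : T → ℝ) (p : Fin n → T) (c : ℝ)
    (hc : 0 ≤ c) : phi M S p (fun t => u t + c) ≤ phi M S p u + c * rk M {i | p i ∈ S} := by
  classical
  apply phi_le
  intro g _
  apply W_le
  intro I hI
  have h1 := le_W M (score S u p g) I hI
  have h2 := card_le_rk M {i | p i ∈ S} (I.filter fun i => p i ∈ S)
    (by intro i; simp) (indep_mono hI (Finset.filter_subset _ _))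
  have h3 : ∑ i ∈ I, score S (fun t => u t + c) p g i = ∑ i ∈ I, score S u p g i
      + c * (I.filter fun i => p i ∈ S).card := by
    rw [Finset.card_filter, Nat.cast_sum, Finset.mul_sum, ← Finset.sum_add_distrib]
    refine Finset.sum_congr rfl fun i _ => ?_
    by_cases hi : p i ∈ S <;> simp [score, hi]
    ring
  have h4 : c * ((I.filter fun i => p i ∈ S).card : ℝ) ≤ c * rk M {i | p i ∈ S} := by
    gcongr
  linarith

lemma phi_shift_ge (M : Matroid (Fin n)) (S : Finset T) (u : T → ℝ) (p : Fin n → T) (c : ℝ)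
    (hu : ∀ t ∈ S, 0 ≤ u t) :
    phi M S p u ≤ phi M S p (fun t => u t + c) + -(c * rk M {i | p i ∈ S}) := by
  classical
  apply phi_le
  intro g hg
  apply W_le
  intro I hI
  obtain ⟨J, hIJ, hJS, hJ, hJc⟩ := exists_extend M {i | p i ∈ S} (I.filter fun i => p i ∈ S)
    (by intro i; simp) (indep_mono hI (Finset.filter_subset _ _))
  have h1 := le_W M (score S (fun t => u t + c) p g) J hJ
  have hJS' : ∀ i ∈ J, p i ∈ S := fun i hi => hJS (by exact_mod_cast hi)
  have h3 : ∑ i ∈ J, score S (fun t => u t + c) p g i = ∑ i ∈ J, score S u p g i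
      + c * rk M {i | p i ∈ S} := by
    rw [← hJc, mul_comm, ← nsmul_eq_mul, ← Finset.sum_const, ← Finset.sum_add_distrib]
    refine Finset.sum_congr rfl fun i hi => ?_
    simp [score, hJS' i hi]
    ring
  have h4 : ∑ i ∈ I, score S u p g i ≤ ∑ i ∈ I.filter (fun i => p i ∈ S), score S u p g i := by
    rw [Finset.sum_filter]
    refine Finset.sum_le_sum fun i _ => ?_
    by_cases hi : p i ∈ S <;> simp [score, hi]
  have h5 : ∑ i ∈ I.filter (fun i => p i ∈ S), score S u p g i ≤ ∑ i ∈ J, score S u p g i := by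
    refine Finset.sum_le_sum_of_subset_of_nonneg hIJ fun i hi _ => ?_
    have := hu _ (hJS' i hi)
    have := hg i
    simp [score, hJS' i hi]
    linarith
  linarith

def vS (S : Finset T) (u : T → ℝ) (t : T) : ℝ := if t ∈ S then u t else 0

lemma phi_ge_rec (M : Matroid (Fin n)) (S : Finset T) (u : T → ℝ) (p : Fin n → T) :
    W M (fun j => vS S u (p j)) ≤ phi M S p u := by
  classical
  apply phi_ge
  intro g hg
  apply W_le
  intro I hI
  refine le_trans ?_ (le_W M (score S u p g) (I.filter fun i => p i ∈ S)
    (indep_mono hI (Finset.filter_subset _ _)))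
  rw [Finset.sum_filter]
  refine Finset.sum_le_sum fun i _ => ?_
  by_cases hi : p i ∈ S <;> simp [score, vS, hi, hg i]

lemma swap_sum (cand : T → Fin n) (G : T → (Fin n → T) → ℝ) :
    ∑ t, ∑ p ∈ (profiles cand).filter (fun p => p (cand t) = t), G t p
      = ∑ p ∈ profiles cand, ∑ i, G (p i) p := by
  simp_rw [Finset.sum_filter]
  rw [Finset.sum_comm]
  refine Finset.sum_congr rfl fun p hp => ?_
  simp only [profiles, Finset.mem_filter, Finset.mem_univ, true_and] at hp
  rw [← Finset.sum_filter]
  refine Finset.sum_nbij' cand p ?_ ?_ ?_ ?_ ?_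
  · simp
  · simp [hp]
  · simp
  · simp [hp]
  · intro t ht
    simp only [Finset.mem_filter, Finset.mem_univ, true_and] at ht
    rw [ht]

lemma lin_eq (cand : T → Fin n) (f x : T → ℝ) (Feas : Finset (Fin n) → Prop)
    (A : (Fin n → T) → Finset (Fin n) → ℝ) (hA : ImplementsRule cand f Feas A x) (v : T → ℝ) :
    ∑ t, v t * (f t * x t) =
      ∑ p ∈ profiles cand, (∏ j, f (p j)) * ∑ I, A p I * ∑ i ∈ I, v (p i) := by
  obtain ⟨-, -, -, h4⟩ := hA
  have e1 : ∀ t, v t * (f t * x t) = ∑ p ∈ (profiles cand).filter (fun p => p (cand t) = t),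
      v t * ((∏ j, f (p j)) *
        (∑ I ∈ Finset.univ.filter (fun I : Finset (Fin n) => cand t ∈ I), A p I)) := by
    intro t
    rw [← h4 t, Finset.mul_sum, Finset.mul_sum]
    refine Finset.sum_congr rfl fun p hp => ?_
    have hpt : p (cand t) = t := (Finset.mem_filter.1 hp).2
    rw [← Finset.mul_prod_erase Finset.univ (fun j => f (p j)) (Finset.mem_univ (cand t)), hpt]
    ring
  rw [Finset.sum_congr rfl fun t _ => e1 t, swap_sum cand]
  refine Finset.sum_congr rfl fun p hp => ?_
  simp only [profiles, Finset.mem_filter, Finset.mem_univ, true_and] at hp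
  simp_rw [hp, Finset.mul_sum, Finset.sum_filter]
  rw [Finset.sum_comm]
  refine Finset.sum_congr rfl fun I _ => ?_
  rw [← Finset.univ_inter I, ← Finset.sum_ite_mem]
  refine Finset.sum_congr rfl fun i _ => ?_
  simp only [Finset.univ_inter]
  split_ifs <;> ring

noncomputable def Kf (cand : T → Fin n) (f x : T → ℝ) (M : Matroid (Fin n)) (S : Finset T)
    (u : T → ℝ) : ℝ :=
  ∑ p ∈ profiles cand, (∏ j, f (p j)) * W M (fun j => vS S u (p j)) - ∑ t, vS S u t * (f t * x t)

noncomputable def Hf (cand : T → Fin n) (f x : T → ℝ) (M : Matroid (Fin n)) (S : Finset T)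
    (u : T → ℝ) : ℝ :=
  ∑ p ∈ profiles cand, (∏ j, f (p j)) * phi M S p u - ∑ t, vS S u t * (f t * x t)

lemma vS_continuous (S : Finset T) (t : T) : Continuous fun u : T → ℝ => vS S u t := by
  unfold vS
  split_ifs <;> fun_prop

lemma Kf_continuous (cand : T → Fin n) (f x : T → ℝ) (M : Matroid (Fin n)) (S : Finset T) :
    Continuous (Kf cand f x M S) := by
  unfold Kf
  refine Continuous.sub (continuous_finsetSum _ fun p _ => continuous_const.mul
    ((W_continuous M).comp (continuous_pi fun j => vS_continuous S _)))
    (continuous_finsetSum _ fun t _ => (vS_continuous S t).mul continuous_const)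

lemma Hf_continuous (cand : T → Fin n) (f x : T → ℝ) (M : Matroid (Fin n)) (S : Finset T) :
    Continuous (Hf cand f x M S) := by
  unfold Hf
  refine Continuous.sub (continuous_finsetSum _ fun p _ => continuous_const.mul
    (phi_continuous M S p))
    (continuous_finsetSum _ fun t _ => (vS_continuous S t).mul continuous_const)

lemma Kf_smul (cand : T → Fin n) (f x : T → ℝ) (M : Matroid (Fin n)) (S : Finset T)
    (u : T → ℝ) (c : ℝ) (hc : 0 ≤ c) : Kf cand f x M S (c • u) = c * Kf cand f x M S u := by
  have hv : ∀ t, vS S (c • u) t = c * vS S u t := by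
    intro t; unfold vS; split_ifs <;> simp
  have hW : ∀ p : Fin n → T, W M (fun j => c * vS S u (p j)) = c * W M (fun j => vS S u (p j)) :=
    fun p => W_smul M (fun j => vS S u (p j)) c hc
  unfold Kf
  simp_rw [hv, hW, mul_sub, Finset.mul_sum]
  congr 1
  · exact Finset.sum_congr rfl fun _ _ => by ring
  · exact Finset.sum_congr rfl fun _ _ => by ring

lemma Kf_le_Hf (cand : T → Fin n) (f x : T → ℝ) (hf0 : ∀ t, 0 ≤ f t) (M : Matroid (Fin n))
    (S : Finset T) (u : T → ℝ) : Kf cand f x M S u ≤ Hf cand f x M S u := by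
  unfold Kf Hf
  gcongr with p hp
  · exact Finset.prod_nonneg fun j _ => hf0 _
  · exact phi_ge_rec M S u p

/-- top level sets of zeros of `Kf` are tight -/
lemma tight_top (cand : T → Fin n) (f x : T → ℝ) (hf0 : ∀ t, 0 ≤ f t) (M : Matroid (Fin n))
    (A : (Fin n → T) → Finset (Fin n) → ℝ)
    (hA : ImplementsRule cand f (fun S => M.Indep ↑S) A x)
    (S : Finset T) (u : T → ℝ) (hK : Kf cand f x M S u ≤ 0) (m : ℝ) (hm : 0 < m)
    (hu : ∀ t ∈ S, u t ≤ m) : Tight cand f M x (S.filter fun t => u t = m) := by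
  classical
  set v := vS S u with hv
  have hpr : ∀ p : Fin n → T, 0 ≤ ∏ j, f (p j) := fun p => Finset.prod_nonneg fun j _ => hf0 _
  have hvm : ∀ t, v t ≤ m := by
    intro t; simp only [hv, vS]; split_ifs with h
    exacts [hu t h, hm.le]
  have hvC : ∀ t, v t = m ↔ t ∈ S.filter fun t => u t = m := by
    intro t
    simp only [hv, vS, Finset.mem_filter]
    split_ifs with h
    · simp [h]
    · simp [h, hm.ne]
  have hA1 := hA.1
  have hA2 := hA.2.1
  have hA3 := hA.2.2.1
  have hterm : ∀ p I, 0 ≤ A p I * (W M (fun j => v (p j)) - ∑ i ∈ I, v (p i)) := by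
    intro p I
    by_cases h : A p I = 0
    · simp [h]
    · exact mul_nonneg (hA1 p I) (sub_nonneg.2 (le_W M (fun j => v (p j)) I (hA3 p I h)))
  have hKe : Kf cand f x M S u = ∑ p ∈ profiles cand, (∏ j, f (p j)) *
      ∑ I, A p I * (W M (fun j => v (p j)) - ∑ i ∈ I, v (p i)) := by
    unfold Kf
    rw [lin_eq cand f x _ A hA, ← Finset.sum_sub_distrib]
    refine Finset.sum_congr rfl fun p _ => ?_
    simp_rw [mul_sub, Finset.sum_sub_distrib, ← Finset.sum_mul, hA2, one_mul]
    rw [mul_sub]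
  have h0 : ∀ p ∈ profiles cand, (∏ j, f (p j)) *
      ∑ I, A p I * (W M (fun j => v (p j)) - ∑ i ∈ I, v (p i)) = 0 := by
    have hnn : ∀ p ∈ profiles cand, 0 ≤ (∏ j, f (p j)) *
      ∑ I, A p I * (W M (fun j => v (p j)) - ∑ i ∈ I, v (p i)) := fun p _ =>
        mul_nonneg (hpr p) (Finset.sum_nonneg fun I _ => hterm p I)
    refine (Finset.sum_eq_zero_iff_of_nonneg hnn).1 ?_
    exact le_antisymm (hKe ▸ hK) (Finset.sum_nonneg hnn)
  have hlin : ∑ t ∈ S.filter (fun t => u t = m), f t * x t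
      = ∑ t, (if v t = m then 1 else 0) * (f t * x t) := by
    simp_rw [hvC, ite_mul, one_mul, zero_mul, Finset.sum_ite_mem, Finset.univ_inter]
  unfold Tight Rval
  rw [hlin, lin_eq cand f x _ A hA]
  refine Finset.sum_congr rfl fun p hp => ?_
  rcases mul_eq_zero.1 (h0 p hp) with h | h
  · rw [h]; simp
  · congr 1
    rw [Finset.sum_eq_zero_iff_of_nonneg fun I _ => hterm p I] at h
    have : ∀ I, A p I * ∑ i ∈ I, (if v (p i) = m then (1:ℝ) else 0)
        = A p I * (rk M {i | p i ∈ S.filter fun t => u t = m} : ℝ) := by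
      intro I
      by_cases hI0 : A p I = 0
      · simp [hI0]
      · have hI := hA3 p I hI0
        have h1 := (mul_eq_zero.1 (h I (Finset.mem_univ I))).resolve_left hI0
        have h2 := card_top M (fun j => v (p j)) m hm (fun i => hvm _) I hI (sub_eq_zero.1 h1)
        simp_rw [← hvC]
        rw [← h2, Finset.card_filter]
        push_cast
        rfl
    rw [Finset.sum_congr rfl fun I _ => this I, ← Finset.sum_mul, hA2, one_mul]

/-- existence of minimizers on a closed cone -/
lemma exists_min (cand : T → Fin n) (f x : T → ℝ) (hf0 : ∀ t, 0 ≤ f t) (M : Matroid (Fin n))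
    (S : Finset T) (Q : Set (T → ℝ)) (hQc : IsClosed Q) (hQ0 : 0 ∈ Q)
    (hQs : ∀ u ∈ Q, ∀ c : ℝ, 0 ≤ c → c • u ∈ Q)
    (hpos : ∀ u ∈ Q, u ≠ 0 → 0 < Kf cand f x M S u) :
    ∃ u ∈ Q, ∀ u' ∈ Q, Hf cand f x M S u ≤ Hf cand f x M S u' := by
  obtain ⟨ε, hε, hεK⟩ := ((isCompact_sphere (0 : T → ℝ) 1).inter_left hQc).exists_forall_le'
    (Kf_continuous cand f x M S).continuousOn (a := 0) (by
      rintro u ⟨hu, hu1⟩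
      refine hpos u hu ?_
      rintro rfl
      simp at hu1)
  have hlow : ∀ u ∈ Q, ε * ‖u‖ ≤ Hf cand f x M S u := by
    intro u hu
    refine le_trans ?_ (Kf_le_Hf cand f x hf0 M S u)
    by_cases h : u = 0
    · subst h
      have := Kf_smul cand f x M S 0 0 le_rfl
      simp at this
      simp [this]
    · have hn : 0 < ‖u‖ := norm_pos_iff.2 h
      have h1 := hεK (‖u‖⁻¹ • u) ⟨hQs u hu _ (by positivity), by
        simp [norm_smul, hn.ne']⟩
      rw [Kf_smul _ _ _ _ _ _ _ (by positivity)] at h1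
      rw [mul_comm]
      calc ‖u‖ * ε ≤ ‖u‖ * (‖u‖⁻¹ * Kf cand f x M S u) := by gcongr
        _ = Kf cand f x M S u := by field_simp
  obtain ⟨u, hu, hmin⟩ := (Hf_continuous cand f x M S).continuousOn.exists_isMinOn' hQc hQ0 (by
    have h1 : ∀ᶠ u in Filter.cocompact (T → ℝ), Hf cand f x M S 0 / ε ≤ ‖u‖ :=
      (tendsto_norm_cocompact_atTop (E := T → ℝ)).eventually_ge_atTop _
    rw [Filter.eventually_inf_principal]
    filter_upwards [h1] with u hu huQ
    refine le_trans ?_ (hlow u huQ)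
    rw [div_le_iff₀ hε] at hu
    linarith)
  exact ⟨u, hu, fun u' hu' => hmin hu'⟩

lemma profile_inj {cand : T → Fin n} {p : Fin n → T} (hp : p ∈ profiles cand) {i j : Fin n}
    (h : p j = p i) : j = i := by
  simp only [profiles, Finset.mem_filter, Finset.mem_univ, true_and] at hp
  rw [← hp j, ← hp i, h]

lemma interim_lip (cand : T → Fin n) (f : T → ℝ) (hf0 : ∀ t, 0 ≤ f t) (M : Matroid (Fin n))
    (hME : M.E = Set.univ) (S : Finset T) (t : T) (ht : t ∈ S) :
    ∃ C : ℝ, 0 ≤ C ∧ ∀ (u : T → ℝ) (h : ℝ),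
      diceInterim cand f (M.restrict (candSet cand S)) (die S (u + Pi.single t h)) t
        ≤ diceInterim cand f (M.restrict (candSet cand S)) (die S u) t + C * |h| := by
  have hpr : ∀ p : Fin n → T, 0 ≤ ∏ j ∈ Finset.univ.erase (cand t), f (p j) :=
    fun p => Finset.prod_nonneg fun j _ => hf0 _
  refine ⟨∑ p ∈ (profiles cand).filter (fun p => p (cand t) = t),
    (∏ j ∈ Finset.univ.erase (cand t), f (p j)), Finset.sum_nonneg fun p _ => hpr p, ?_⟩
  intro u h
  unfold diceInterim
  rw [Finset.sum_mul, ← Finset.sum_add_distrib]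
  refine Finset.sum_le_sum fun p hp => ?_
  obtain ⟨hp, hpt⟩ := Finset.mem_filter.1 hp
  rw [← mul_add]
  refine mul_le_mul_of_nonneg_left ?_ (hpr p)
  rw [winProb_eq cand M hME S _ p hp, winProb_eq cand M hME S _ p hp,
    ← sum_perm_avg (n := n) |h|, ← add_div, ← Finset.sum_add_distrib]
  gcongr with π
  have := wp_shift M S u p π (cand t) (by rw [hpt]; exact ht) (fun j hj => profile_inj hp hj) h
  rwa [hpt] at this

lemma Hf_subgrad (cand : T → Fin n) (f x : T → ℝ) (hf0 : ∀ t, 0 ≤ f t) (M : Matroid (Fin n))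
    (hME : M.E = Set.univ) (S : Finset T) (t : T) (ht : t ∈ S) (u : T → ℝ) (h : ℝ) :
    Hf cand f x M S (u + Pi.single t h) - Hf cand f x M S u ≤
      h * (f t * (diceInterim cand f (M.restrict (candSet cand S))
        (die S (u + Pi.single t h)) t - x t)) := by
  have hlin : ∑ s, vS S (u + Pi.single t h) s * (f s * x s) - ∑ s, vS S u s * (f s * x s)
      = h * (f t * x t) := by
    rw [← Finset.sum_sub_distrib, Finset.sum_eq_single t]
    · simp [vS, ht]; ring
    · intro s _ hs
      simp [vS, hs]
    · simp
  have hphi : ∑ p ∈ profiles cand, (∏ j, f (p j)) * phi M S p (u + Pi.single t h)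
      - ∑ p ∈ profiles cand, (∏ j, f (p j)) * phi M S p u ≤
      h * (f t * diceInterim cand f (M.restrict (candSet cand S))
        (die S (u + Pi.single t h)) t) := by
    unfold diceInterim
    rw [← Finset.sum_sub_distrib, Finset.mul_sum, Finset.mul_sum, Finset.sum_filter]
    refine Finset.sum_le_sum fun p hp => ?_
    split_ifs with hpt
    · rw [winProb_eq cand M hME S _ p hp]
      have := phi_subgrad M hME S u p (cand t) (by rw [hpt]; exact ht)
        (fun j hj => profile_inj hp hj) h
      rw [hpt] at this
      have h2 := mul_le_mul_of_nonneg_left this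
        (Finset.prod_nonneg fun j (_ : j ∈ Finset.univ) => hf0 (p j))
      rw [← mul_sub]
      refine h2.trans_eq ?_
      rw [← Finset.mul_prod_erase Finset.univ (fun j => f (p j)) (Finset.mem_univ (cand t)), hpt]
      ring
    · rw [phi_const]
      · simp
      · intro j hj
        simp only [profiles, Finset.mem_filter, Finset.mem_univ, true_and] at hp
        apply hpt
        rw [← hj, hp j]
  unfold Hf
  rw [mul_sub, mul_sub, ← hlin]
  linarith

lemma interim_of_min (cand : T → Fin n) (f x : T → ℝ) (hf0 : ∀ t, 0 ≤ f t) (M : Matroid (Fin n))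
    (hME : M.E = Set.univ) (S : Finset T) (u : T → ℝ)
    (hmin : ∀ u', Hf cand f x M S u ≤ Hf cand f x M S u') (t : T) (ht : t ∈ S) (hft : 0 < f t) :
    diceInterim cand f (M.restrict (candSet cand S)) (die S u) t = x t := by
  obtain ⟨C, hC, hlip⟩ := interim_lip cand f hf0 M hME S t ht
  set q := fun u => diceInterim cand f (M.restrict (candSet cand S)) (die S u) t with hq
  have hsub : ∀ h, 0 ≤ h * (f t * (q (u + Pi.single t h) - x t)) := fun h => by
    have h1 := Hf_subgrad cand f x hf0 M hME S t ht u h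
    have h2 := hmin (u + Pi.single t h)
    simp only [hq]
    linarith
  change q u = x t
  apply le_antisymm
  · apply le_of_forall_pos_le_add
    intro ε hε
    set h := ε / (C + 1) with hh
    have hhp : 0 < h := by positivity
    have h1 := hsub (-h)
    have h2 : q (u + Pi.single t (-h)) ≤ x t := by
      by_contra hc
      push Not at hc
      have := mul_pos hhp (mul_pos hft (sub_pos.2 hc))
      linarith
    have h3 := hlip (u + Pi.single t (-h)) h
    have e : u + Pi.single t (-h) + Pi.single t h = u := by
      rw [add_assoc, ← Pi.single_add]; simp
    rw [e, abs_of_pos hhp] at h3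
    change q u ≤ q _ + _ at h3
    have h4 : C * h ≤ ε := by
      have : (C + 1) * h = ε := by rw [hh]; field_simp
      linarith
    linarith
  · apply le_of_forall_pos_le_add
    intro ε hε
    set h := ε / (C + 1) with hh
    have hhp : 0 < h := by positivity
    have h1 := hsub h
    have h2 : x t ≤ q (u + Pi.single t h) := by
      by_contra hc
      push Not at hc
      have := mul_pos hhp (mul_pos hft (sub_pos.2 hc))
      linarith
    have h3 := hlip u h
    rw [abs_of_pos hhp] at h3
    change q _ ≤ q u + _ at h3
    have h4 : C * h ≤ ε := by
      have : (C + 1) * h = ε := by rw [hh]; field_simp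
      linarith
    linarith

lemma Hf_congr (cand : T → Fin n) (f x : T → ℝ) (M : Matroid (Fin n)) (S : Finset T)
    (u u' : T → ℝ) (h : ∀ t ∈ S, u t = u' t) : Hf cand f x M S u = Hf cand f x M S u' := by
  unfold Hf
  congr 1
  · exact Finset.sum_congr rfl fun p _ => by rw [phi_congr M S u u' p h]
  · refine Finset.sum_congr rfl fun t _ => ?_
    unfold vS
    split_ifs with ht
    · rw [h t ht]
    · rfl

lemma lin_shift (f x : T → ℝ) (S : Finset T) (u : T → ℝ) (c : ℝ) :
    ∑ t, vS S (fun t => u t + c) t * (f t * x t)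
      = ∑ t, vS S u t * (f t * x t) + c * ∑ t ∈ S, f t * x t := by
  rw [Finset.mul_sum, ← Finset.univ_inter S, ← Finset.sum_ite_mem, ← Finset.sum_add_distrib]
  refine Finset.sum_congr rfl fun t _ => ?_
  simp only [vS, Finset.univ_inter]
  split_ifs <;> ring

lemma Hf_shift_le (cand : T → Fin n) (f x : T → ℝ) (hf0 : ∀ t, 0 ≤ f t) (M : Matroid (Fin n))
    (S : Finset T) (hS : Tight cand f M x S) (u : T → ℝ) (c : ℝ) (hc : 0 ≤ c) :
    Hf cand f x M S (fun t => u t + c) ≤ Hf cand f x M S u := by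
  have h1 : ∑ p ∈ profiles cand, (∏ j, f (p j)) * phi M S p (fun t => u t + c) ≤
      ∑ p ∈ profiles cand, (∏ j, f (p j)) * phi M S p u + c * Rval cand f M S := by
    unfold Rval
    rw [Finset.mul_sum, ← Finset.sum_add_distrib]
    refine Finset.sum_le_sum fun p _ => ?_
    have := mul_le_mul_of_nonneg_left (phi_shift_le M S u p c hc)
      (Finset.prod_nonneg fun j (_ : j ∈ Finset.univ) => hf0 (p j))
    linarith
  unfold Hf
  rw [lin_shift]
  unfold Tight at hS
  rw [hS] at h1
  linarith

lemma Hf_shift_ge (cand : T → Fin n) (f x : T → ℝ) (hf0 : ∀ t, 0 ≤ f t) (M : Matroid (Fin n))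
    (S : Finset T) (hS : Tight cand f M x S) (u : T → ℝ) (c : ℝ) (hu : ∀ t ∈ S, 0 ≤ u t) :
    Hf cand f x M S u ≤ Hf cand f x M S (fun t => u t + c) := by
  have h1 : ∑ p ∈ profiles cand, (∏ j, f (p j)) * phi M S p u + c * Rval cand f M S ≤
      ∑ p ∈ profiles cand, (∏ j, f (p j)) * phi M S p (fun t => u t + c) := by
    unfold Rval
    rw [Finset.mul_sum, ← Finset.sum_add_distrib]
    refine Finset.sum_le_sum fun p _ => ?_
    have := mul_le_mul_of_nonneg_left (phi_shift_ge M S u p c hu)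
      (Finset.prod_nonneg fun j (_ : j ∈ Finset.univ) => hf0 (p j))
    linarith
  unfold Hf
  rw [lin_shift]
  unfold Tight at hS
  rw [hS] at h1
  linarith

lemma isClosed_supp (S : Finset T) : IsClosed {u : T → ℝ | ∀ t ∉ S, u t = 0} := by
  simp only [Set.ofPred_forall]
  exact isClosed_iInter fun t => isClosed_iInter fun _ =>
    isClosed_eq (continuous_apply t) continuous_const

lemma exists_global_min (cand : T → Fin n) (f x : T → ℝ) (hf0 : ∀ t, 0 ≤ f t)
    (M : Matroid (Fin n)) (A : (Fin n → T) → Finset (Fin n) → ℝ)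
    (hA : ImplementsRule cand f (fun S => M.Indep ↑S) A x)
    (S : Finset T) (hS : IsBarrier cand f M x S) :
    ∃ u, ∀ u', Hf cand f x M S u ≤ Hf cand f x M S u' := by
  rcases hS with ⟨-, hSp, hSne, hSt, hmin⟩ | ⟨hno, hSp⟩
  · have hex : ∃ u ∈ ({u | ∀ t ∉ S, u t = 0} ∩ ({u | ∀ t ∈ S, 0 ≤ u t} ∩ ⋃ t ∈ S, {u | u t = 0}) : Set (T → ℝ)),
        ∀ u' ∈ ({u | ∀ t ∉ S, u t = 0} ∩ ({u | ∀ t ∈ S, 0 ≤ u t} ∩ ⋃ t ∈ S, {u | u t = 0}) : Set (T → ℝ)),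
          Hf cand f x M S u ≤ Hf cand f x M S u' := by
      refine exists_min cand f x hf0 M S _ ?_ ?_ ?_ ?_
      · refine (isClosed_supp S).inter (IsClosed.inter ?_ ?_)
        · simp only [Set.ofPred_forall]
          exact isClosed_iInter fun t => isClosed_iInter fun _ =>
            isClosed_le continuous_const (continuous_apply t)
        · exact S.finite_toSet.isClosed_biUnion fun t _ =>
            isClosed_eq (continuous_apply t) continuous_const
      · obtain ⟨t, ht⟩ := hSne
        refine ⟨by simp, by simp, ?_⟩
        simp only [Set.mem_iUnion]
        exact ⟨t, ht, by simp⟩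
      · rintro u ⟨h1, h2, h3⟩ c hc
        simp only [Set.mem_iUnion] at h3
        obtain ⟨t, ht, h3⟩ := h3
        have h3' : u t = 0 := h3
        refine ⟨fun t ht => by simp [h1 t ht], fun t ht => mul_nonneg hc (h2 t ht), ?_⟩
        simp only [Set.mem_iUnion]
        exact ⟨t, ht, by simp [h3']⟩
      · rintro u ⟨h1, h2, h3⟩ hne
        simp only [Set.mem_iUnion] at h3
        obtain ⟨t, ht, h3⟩ := h3
        have h3' : u t = 0 := h3
        by_contra hK
        push Not at hK
        obtain ⟨t₁, ht₁, hmax⟩ := S.exists_max_image u hSne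
        have hm : 0 < u t₁ := by
          by_contra hle
          push Not at hle
          apply hne
          ext s
          by_cases hs : s ∈ S
          · exact le_antisymm ((hmax s hs).trans hle) (h2 s hs)
          · exact h1 s hs
        have htt := tight_top cand f x hf0 M A hA S u hK (u t₁) hm hmax
        have := hmin _ ((Finset.filter_subset _ _).trans hSp) ⟨t₁, by simp [ht₁]⟩ htt
          (Finset.filter_subset _ _)
        rw [← this] at ht
        have := (Finset.mem_filter.1 ht).2
        linarith
    obtain ⟨u, -, hu⟩ := hex
    · refine ⟨u, fun u' => ?_⟩
      obtain ⟨t₀, ht₀, hmin₀⟩ := S.exists_min_image u' hSne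
      set w : T → ℝ := fun t => if t ∈ S then u' t - u' t₀ else 0 with hw
      have hw0 : ∀ t ∈ S, 0 ≤ w t := fun t ht => by
        simp only [hw, ht, if_true]; linarith [hmin₀ t ht]
      have hwQ := hu w ⟨fun t ht => by simp [hw, ht], hw0, by
        simp only [Set.mem_iUnion]; exact ⟨t₀, ht₀, by simp [hw]⟩⟩
      refine hwQ.trans ?_
      rcases le_total 0 (u' t₀) with h | h
      · refine (Hf_shift_ge cand f x hf0 M S hSt w (u' t₀) hw0).trans_eq ?_
        exact Hf_congr _ _ _ _ _ _ _ fun t ht => by simp [hw, ht]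
      · refine Eq.trans_le ?_ (Hf_shift_le cand f x hf0 M S hSt u' (-u' t₀) (by linarith))
        exact Hf_congr _ _ _ _ _ _ _ fun t ht => by simp [hw, ht]; ring
  · have hex : ∃ u ∈ ({u | ∀ t ∉ S, u t = 0} : Set (T → ℝ)), ∀ u' ∈ ({u | ∀ t ∉ S, u t = 0} : Set (T → ℝ)),
          Hf cand f x M S u ≤ Hf cand f x M S u' := by
      refine exists_min cand f x hf0 M S _ (isClosed_supp S)
        (by simp) (fun u hu c _ t ht => by simp [hu t ht]) ?_
      · intro u h1 hne
        by_contra hK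
        push Not at hK
        obtain ⟨s, hs⟩ := Function.ne_iff.1 hne
        have hsS : s ∈ S := by
          by_contra h
          exact hs (h1 s h)
        obtain ⟨t₁, ht₁, hmax⟩ := S.exists_max_image u ⟨s, hsS⟩
        rcases lt_or_ge 0 (u t₁) with hm | hm
        · have htt := tight_top cand f x hf0 M A hA S u hK (u t₁) hm hmax
          exact hno ⟨_, (Finset.filter_subset _ _).trans hSp.le, ⟨t₁, by simp [ht₁]⟩, htt⟩
        · have hW : 0 ≤ ∑ p ∈ profiles cand, (∏ j, f (p j)) * W M (fun j => vS S u (p j)) :=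
            Finset.sum_nonneg fun p _ => mul_nonneg (Finset.prod_nonneg fun j _ => hf0 _) (W_nonneg _ _)
          have hfx : ∀ t ∈ S, 0 < f t * x t := fun t ht => by
            rw [hSp] at ht
            exact (Finset.mem_filter.1 ht).2
          have hlt : ∑ t, vS S u t * (f t * x t) < 0 := by
            refine Finset.sum_neg' ?_ ⟨s, Finset.mem_univ s, ?_⟩
            · intro t _
              unfold vS
              split_ifs with ht
              · exact mul_nonpos_of_nonpos_of_nonneg ((hmax t ht).trans hm) (hfx t ht).le
              · simp
            · have : u s < 0 := lt_of_le_of_ne ((hmax s hsS).trans hm) hs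
              simp only [vS, hsS, if_true]
              exact mul_neg_of_neg_of_pos this (hfx s hsS)
          unfold Kf at hK
          linarith
    obtain ⟨u, -, hu⟩ := hex
    · refine ⟨u, fun u' => ?_⟩
      refine (hu (fun t => if t ∈ S then u' t else 0) fun t ht => by simp [ht]).trans_eq ?_
      exact Hf_congr _ _ _ _ _ _ _ fun t ht => by simp [ht]

theorem barrier_dice_exist
    (n : ℕ) (T : Type) [Fintype T] [DecidableEq T]
    (cand : T → Fin n) (f : T → ℝ)
    (hf0 : ∀ t, 0 ≤ f t)
    (hf1 : ∀ i : Fin n, ∑ t ∈ Finset.univ.filter (fun t => cand t = i), f t = 1)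
    (M : Matroid (Fin n)) (hME : M.E = Set.univ) (hM : ¬ Separable M)
    (x : T → ℝ) (hx : ∀ t, 0 < x t ∧ x t ≤ 1)
    (hfeas : ∃ A, ImplementsRule cand f (fun S => M.Indep ↑S) A x)
    (S : Finset T) (hS : IsBarrier cand f M x S) :
    ∃ D : T → Measure ℝ, (∀ t, IsProbabilityMeasure (D t)) ∧
      (∀ t ∉ S, D t = Measure.dirac (-1)) ∧
      ∀ t ∈ S, diceInterim cand f (M.restrict (candSet cand S)) D t = x t := by
  obtain ⟨A, hA⟩ := hfeas
  obtain ⟨u, hu⟩ := exists_global_min cand f x hf0 M A hA S hS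
  refine ⟨die S u, die_prob S u, fun t ht => by simp [die, ht], fun t ht => ?_⟩
  have hSp : S ⊆ Tplus f x := by
    rcases hS with ⟨-, h, -⟩ | ⟨-, h⟩
    · exact h
    · exact h.le
  have hfx : 0 < f t * x t := (Finset.mem_filter.1 (hSp ht)).2
  exact interim_of_min cand f x hf0 M hME S u hu t ht (pos_of_mul_pos_left hfx (hx t).1.le)

end Stmt2
end
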